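/- There exists an absolute constant c such that for every primitive polynomial f ∈ ℤ[x_1,x_2] of degree d ≥ 1 that is irreducible over ℚ, and every real B ≥ 1, one has N_aff(f,B) ≤ c·d^3·B^{1/d}·(log B + d). -/

import Mathlib

/-- The number of integer points `x ∈ ℤ^N` with `|x_i| ≤ B` for all `i` and `f(x) = 0`. -/
noncomputable def Naff {N : ℕ} (f : MvPolynomial (Fin N) ℤ) (B : ℝ) : ℕ :=
  Set.ncard {x : Fin N → ℤ | (∀ i, |(x i : ℝ)| ≤ B) ∧ MvPolynomial.eval x f = 0}

/-! Part A -/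

open MvPolynomial

/-- triangular numbers -/
def Tri (l : ℕ) : ℕ := (l + 1) * (l + 2) / 2

theorem Tri_two (l : ℕ) : 2 * Tri l = (l + 1) * (l + 2) := by
  unfold Tri
  have h : 2 ∣ (l+1)*(l+2) := by
    have := Nat.even_mul_succ_self (l+1)
    exact this.two_dvd
  omega

theorem natCard_deg_le (l : ℕ) : Nat.card {m : Fin 2 →₀ ℕ | (m.sum fun _ e ↦ e) ≤ l} = Tri l := by
  have e : {m : Fin 2 →₀ ℕ | (m.sum fun _ e ↦ e) ≤ l} ≃
      (Finset.range (l+1)).sigma (fun i => Finset.range (l+1-i)) :=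
    { toFun := fun m => ⟨⟨m.1 0, m.1 1⟩, by
        have h := m.2
        simp only [Set.mem_ofPred_eq] at h
        rw [Finsupp.sum_fintype _ _ (by simp)] at h
        simp [Fin.sum_univ_two] at h ⊢
        omega⟩
      invFun := fun q => ⟨Finsupp.equivFunOnFinite.symm ![q.1.1, q.1.2], by
        have h := q.2
        simp only [Set.mem_ofPred_eq]
        rw [Finsupp.sum_fintype _ _ (by simp)]
        rw [Finset.mem_sigma, Finset.mem_range, Finset.mem_range] at h
        simp [Fin.sum_univ_two]
        omega⟩
      left_inv := by
        intro m
        ext i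
        fin_cases i <;> simp
      right_inv := by
        rintro ⟨⟨a, b⟩, h⟩
        simp }
  rw [Nat.card_congr e, Nat.card_eq_fintype_card, Fintype.card_coe, Finset.card_sigma]
  simp only [Finset.card_range]
  have : ∀ l, 2 * ∑ i ∈ Finset.range (l+1), (l+1-i) = (l+1)*(l+2) := by
    intro l
    rw [← Finset.sum_range_reflect]
    have : ∀ j ∈ Finset.range (l+1), (l + 1 - (l+1-1-j)) = j+1 := by
      intro j hj
      simp at hj; omega
    rw [Finset.sum_congr rfl this]
    induction l with
    | zero => simp
    | succ n ih =>
      rw [Finset.sum_range_succ, mul_add, ih]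
      · ring
      · intro j hj
        simp at hj; omega
  have h1 := this l
  have h2 := Tri_two l
  omega

theorem finrank_restrictTotalDegree (k : Type*) [Field k] (l : ℕ) :
    Module.finrank k (restrictTotalDegree (Fin 2) k l) = Tri l := by
  rw [← natCard_deg_le]
  exact Module.finrank_eq_nat_card_basis (basisRestrictSupport k _)

section bez
variable {k : Type*} [Field k]


/-- multiplication by `f` of polynomials of degree ≤ l. -/
noncomputable def mulSub (f : MvPolynomial (Fin 2) k) (l : ℕ) : Submodule k (MvPolynomial (Fin 2) k) :=
  (restrictTotalDegree (Fin 2) k l).map (LinearMap.mulLeft k f)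

instance (f : MvPolynomial (Fin 2) k) (l : ℕ) : Module.Finite k (mulSub f l) := by
  unfold mulSub; infer_instance

theorem finrank_mulSub (f : MvPolynomial (Fin 2) k) (hf : f ≠ 0) (l : ℕ) :
    Module.finrank k (mulSub f l) = Tri l := by
  rw [← finrank_restrictTotalDegree k l]
  unfold mulSub
  exact (Submodule.equivMapOfInjective _ (mul_right_injective₀ hf) _).finrank_eq.symm

theorem mem_mulSub {f x : MvPolynomial (Fin 2) k} {l : ℕ} :
    x ∈ mulSub f l ↔ ∃ q, q.totalDegree ≤ l ∧ f * q = x := by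
  unfold mulSub
  simp [Submodule.mem_map, mem_restrictTotalDegree]

/-- Linear form of Bezout's theorem. -/
theorem bezout_lin {f g : MvPolynomial (Fin 2) k} (hf : Prime f) (hfg : ¬ f ∣ g) {e : ℕ}
    (he : g.totalDegree ≤ e) {W : Type*} [AddCommGroup W] [Module k W] [Module.Finite k W]
    (Ψ : MvPolynomial (Fin 2) k →ₗ[k] W) (hs : Function.Surjective Ψ)
    (h1 : ∀ q, Ψ (f * q) = 0) (h2 : ∀ q, Ψ (g * q) = 0) :
    Module.finrank k W ≤ f.totalDegree * e := by
  classical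
  have hg : g ≠ 0 := fun h => hfg (h ▸ dvd_zero f)
  have hf0 := hf.ne_zero
  set d := f.totalDegree with hd
  set e' := g.totalDegree with he'
  suffices h : Module.finrank k W ≤ d * e' from h.trans (Nat.mul_le_mul_left _ he)
  -- spanning set
  obtain ⟨n, s, hsp⟩ := Module.Finite.exists_fin (R := k) (M := W)
  choose t ht using fun i => hs (s i)
  set l0 := ∑ i, (t i).totalDegree with hl0
  set l := l0 + d + e' with hl
  set Pl := restrictTotalDegree (Fin 2) k l with hPl
  set φ := Ψ.domRestrict Pl with hφ
  have hsurj : LinearMap.range φ = ⊤ := by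
    rw [eq_top_iff, ← hsp, Submodule.span_le]
    rintro _ ⟨i, rfl⟩
    refine ⟨⟨t i, ?_⟩, ?_⟩
    · rw [hPl, mem_restrictTotalDegree]
      have : (t i).totalDegree ≤ l0 := Finset.single_le_sum (f := fun i => (t i).totalDegree)
        (fun _ _ => Nat.zero_le _) (Finset.mem_univ i)
      omega
    · simp [hφ, ht]
  have hrk := LinearMap.finrank_range_add_finrank_ker φ
  have hfr : Module.finrank k Pl = Tri l := finrank_restrictTotalDegree k l
  rw [hsurj, finrank_top, hfr] at hrk
  set A := mulSub f (l0 + e')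
  set B := mulSub g (l0 + d)
  have hAB : A ⊔ B ≤ (LinearMap.ker φ).map Pl.subtype := by
    apply sup_le
    · intro x hx
      obtain ⟨q, hq, rfl⟩ := mem_mulSub.1 hx
      refine ⟨⟨f * q, ?_⟩, ?_, rfl⟩
      · rw [hPl, mem_restrictTotalDegree]
        have := totalDegree_mul f q
        omega
      · simp [hφ, h1]
    · intro x hx
      obtain ⟨q, hq, rfl⟩ := mem_mulSub.1 hx
      refine ⟨⟨g * q, ?_⟩, ?_, rfl⟩
      · rw [hPl, mem_restrictTotalDegree]
        have := totalDegree_mul g q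
        omega
      · simp [hφ, h2]
  have hle := Submodule.finrank_mono hAB
  rw [← (Submodule.equivMapOfInjective _ (Submodule.subtype_injective _) _).finrank_eq] at hle
  have hsi := Submodule.finrank_sup_add_finrank_inf_eq A B
  have hinf : A ⊓ B ≤ mulSub (f * g) l0 := by
    rintro x ⟨hx1, hx2⟩
    obtain ⟨a, ha, rfl⟩ := mem_mulSub.1 hx1
    obtain ⟨b, hb, hab⟩ := mem_mulSub.1 hx2
    have hdv : f ∣ b := (hf.dvd_or_dvd (a := g) (b := b) ⟨a, hab⟩).resolve_left hfg
    obtain ⟨c, rfl⟩ := hdv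
    refine mem_mulSub.2 ⟨c, ?_, ?_⟩
    · by_cases hc : c = 0
      · simp [hc]
      · rw [totalDegree_mul_of_isDomain hf0 hc] at hb
        omega
    · rw [← hab]; ring
  have hle2 := Submodule.finrank_mono hinf
  rw [finrank_mulSub _ (mul_ne_zero hf0 hg)] at hle2
  rw [finrank_mulSub _ hf0, finrank_mulSub _ hg] at hsi
  have t1 := Tri_two l
  have t2 := Tri_two l0
  have t3 := Tri_two (l0 + e')
  have t4 := Tri_two (l0 + d)
  rw [hl] at t1
  have : 2 * Tri (l0 + d + e') + 2 * Tri l0 = 2 * Tri (l0+e') + 2 * Tri (l0+d) + 2 * (d * e') := by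
    rw [t1, t2, t3, t4]; ring
  have hl' : Tri l = Tri (l0 + d + e') := by rw [hl]
  rw [hl'] at hrk
  generalize Module.finrank k W = w at *
  generalize Module.finrank k (LinearMap.ker φ) = w1 at *
  generalize Module.finrank k ↥(A ⊔ B) = w2 at *
  generalize Module.finrank k ↥(A ⊓ B) = w3 at *
  clear_value d e' l0
  nlinarith

theorem exists_lead {f : MvPolynomial (Fin 2) k} (hf : f ≠ 0) :
    ∃ a b : ℕ, a + b = f.totalDegree ∧ ∀ g : MvPolynomial (Fin 2) k, g ≠ 0 →
      (∀ m ∈ g.support, m 0 < a ∨ m 1 < b) → ¬ f ∣ g := by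
  refine ⟨MonomialOrder.degLex.degree f 0, MonomialOrder.degLex.degree f 1, ?_, ?_⟩
  · rw [← MvPolynomial.degree_degLexDegree, Finsupp.degree_eq_sum]
    simp
  · rintro g hg hm ⟨q, rfl⟩
    have hq : q ≠ 0 := by rintro rfl; simp at hg
    have h := hm _ (MonomialOrder.degLex.degree_mem_support hg)
    rw [MonomialOrder.degree_mul hf hq] at h
    simp at h

/-- standard monomials -/
noncomputable def Jm (a : ℕ) (r l : ℕ) : Fin 2 →₀ ℕ :=
  Finsupp.equivFunOnFinite.symm (if r < a then ![r, l] else ![a + l, r - a])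

theorem Jm_deg (a r l : ℕ) : Jm a r l 0 + Jm a r l 1 = r + l := by
  unfold Jm
  split_ifs with h
  · simp
  · simp; omega

theorem Jm_lt {a b r l : ℕ} (h : r < a + b) : Jm a r l 0 < a ∨ Jm a r l 1 < b := by
  unfold Jm
  split_ifs with h
  · simp; omega
  · simp; omega

theorem Jm_inj {a r l r' l' : ℕ} (h : Jm a r l = Jm a r' l') : r = r' ∧ l = l' := by
  have h0 := DFunLike.congr_fun h 0
  have h1 := DFunLike.congr_fun h 1
  unfold Jm at h0 h1
  split_ifs at h0 h1 <;> simp at h0 h1 <;> omega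

end bez

/-! Part B -/

open MvPolynomial

theorem taylor_y {K A : Type*} [CommRing K] [CommRing A] [Algebra K A] (x y h : A)
    (f : MvPolynomial (Fin 2) K) :
    ∃ r : A, aeval ![x, y + h] f = aeval ![x, y] f + aeval ![x, y] (pderiv 1 f) * h + r * h ^ 2 := by
  induction f using MvPolynomial.induction_on with
  | C a => exact ⟨0, by simp⟩
  | add p q hp hq =>
    obtain ⟨r, hr⟩ := hp
    obtain ⟨s, hs⟩ := hq
    refine ⟨r + s, ?_⟩
    simp only [map_add, hr, hs]; ring
  | mul_X p i hp =>
    obtain ⟨r, hr⟩ := hp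
    fin_cases i
    · refine ⟨r * x, ?_⟩
      simp [hr, pderiv_X]; ring
    · refine ⟨aeval ![x, y] (pderiv 1 p) + r * y + r * h, ?_⟩
      simp [hr, pderiv_X]; ring

section ser
variable {k : Type*} [Field k]

open PowerSeries in
/-- the substitution `x ↦ x0 + t`, `y ↦ Y` -/
noncomputable def sbs (x0 : k) (Y : PowerSeries k) : MvPolynomial (Fin 2) k →ₐ[k] PowerSeries k :=
  MvPolynomial.aeval ![PowerSeries.C x0 + PowerSeries.X, Y]

/-- `Y` parametrizes the curve `f = 0` at `P`. -/
structure IsPar (f : MvPolynomial (Fin 2) k) (P : Fin 2 → k) (Y : PowerSeries k) : Prop where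
  c0 : PowerSeries.constantCoeff Y = P 1
  zero : sbs (P 0) Y f = 0

theorem constCoeff_sbs {P : Fin 2 → k} {Y : PowerSeries k} (hY : PowerSeries.constantCoeff Y = P 1)
    (h : MvPolynomial (Fin 2) k) : PowerSeries.constantCoeff (sbs (P 0) Y h) = MvPolynomial.eval P h := by
  induction h using MvPolynomial.induction_on with
  | C a => simp [sbs]
  | add p q hp hq => simp [hp, hq]
  | mul_X p i hp =>
    simp only [map_mul, hp]
    fin_cases i <;> simp [sbs, hY]

theorem exists_par {f : MvPolynomial (Fin 2) k} {P : Fin 2 → k} (h0 : MvPolynomial.eval P f = 0)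
    (h1 : MvPolynomial.eval P (pderiv 1 f) ≠ 0) : ∃ Y, IsPar f P Y := by
  set β : k := (MvPolynomial.eval P (pderiv 1 f))⁻¹ with hβ
  let ys : ℕ → PowerSeries k := fun n => Nat.rec (PowerSeries.C (P 1))
    (fun _ y => y - PowerSeries.C β * sbs (P 0) y f) n
  have hys : ∀ n, ys (n+1) = ys n - PowerSeries.C β * sbs (P 0) (ys n) f := fun n => rfl
  have key : ∀ n, PowerSeries.constantCoeff (ys n) = P 1 ∧ PowerSeries.X ^ (n+1) ∣ sbs (P 0) (ys n) f := by
    intro n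
    induction n with
    | zero =>
      have hc : PowerSeries.constantCoeff (ys 0) = P 1 := by
        change PowerSeries.constantCoeff (PowerSeries.C (P 1)) = P 1
        simp
      refine ⟨hc, ?_⟩
      rw [zero_add, pow_one, PowerSeries.X_dvd_iff, constCoeff_sbs hc, h0]
    | succ n ih =>
      obtain ⟨hc, hd⟩ := ih
      refine ⟨?_, ?_⟩
      · rw [hys]
        simp [constCoeff_sbs hc, h0, hc]
      · rw [hys]
        obtain ⟨r, hr⟩ := taylor_y (PowerSeries.C (P 0) + PowerSeries.X) (ys n)
          (- (PowerSeries.C β * sbs (P 0) (ys n) f)) f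
        have e1 : sbs (P 0) (ys n - PowerSeries.C β * sbs (P 0) (ys n) f) f =
          sbs (P 0) (ys n) f * (1 - PowerSeries.C β * sbs (P 0) (ys n) (pderiv 1 f)) +
           r * (PowerSeries.C β)^2 * (sbs (P 0) (ys n) f * sbs (P 0) (ys n) f) := by
          rw [sub_eq_add_neg]
          refine hr.trans ?_
          unfold sbs
          ring
        rw [e1]
        apply dvd_add
        · rw [pow_succ]
          apply mul_dvd_mul hd
          rw [PowerSeries.X_dvd_iff]
          simp [constCoeff_sbs hc, hβ, inv_mul_cancel₀ h1]
        · apply Dvd.dvd.mul_left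
          rw [pow_succ]
          apply mul_dvd_mul hd
          exact (dvd_pow_self _ (Nat.succ_ne_zero _)).trans hd
  have hsucc : ∀ n, PowerSeries.X ^ (n+1) ∣ ys (n+1) - ys n := by
    intro n
    rw [hys]
    have := (key n).2
    rw [sub_sub_cancel_left, dvd_neg]
    exact this.mul_left _
  have hmono : ∀ n m, n ≤ m → PowerSeries.X ^ (n+1) ∣ ys m - ys n := by
    intro n m h
    induction m, h using Nat.le_induction with
    | base => simp
    | succ m hm ih =>
      have : ys (m+1) - ys n = (ys (m+1) - ys m) + (ys m - ys n) := by ring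
      rw [this]
      exact dvd_add ((pow_dvd_pow _ (by omega)).trans (hsucc m)) ih
  let Y : PowerSeries k := PowerSeries.mk fun n => PowerSeries.coeff n (ys n)
  have hYn : ∀ n, PowerSeries.X ^ (n+1) ∣ Y - ys n := by
    intro n
    rw [PowerSeries.X_pow_dvd_iff]
    intro m hm
    have := (PowerSeries.X_pow_dvd_iff.1 (hmono m n (by omega))) m (by omega)
    simp only [map_sub] at this ⊢
    simp only [Y, PowerSeries.coeff_mk]
    rw [sub_eq_zero] at this
    rw [this, sub_self]
  refine ⟨Y, ?_, ?_⟩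
  · have := (PowerSeries.X_pow_dvd_iff.1 (hYn 0)) 0 (by omega)
    rw [map_sub, sub_eq_zero, PowerSeries.coeff_zero_eq_constantCoeff_apply,
      PowerSeries.coeff_zero_eq_constantCoeff_apply, (key 0).1] at this
    exact this
  · ext n
    obtain ⟨r, hr⟩ := taylor_y (PowerSeries.C (P 0) + PowerSeries.X) (ys n) (Y - ys n) f
    rw [add_sub_cancel] at hr
    have : PowerSeries.X ^ (n+1) ∣ sbs (P 0) Y f := by
      unfold sbs
      rw [hr]
      refine dvd_add (dvd_add (key n).2 ((hYn n).mul_left _)) ?_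
      apply Dvd.dvd.mul_left
      exact (hYn n).trans (dvd_pow_self _ two_ne_zero)
    simpa using (PowerSeries.X_pow_dvd_iff.1 this) n (by omega)

/-- separating polynomial -/
theorem exists_sep (Z : Finset (Fin 2 → k)) (P : Fin 2 → k) (hP : P ∉ Z) :
    ∃ u : MvPolynomial (Fin 2) k, MvPolynomial.eval P u ≠ 0 ∧ ∀ Q ∈ Z, MvPolynomial.eval Q u = 0 := by
  classical
  have : ∀ Q : Fin 2 → k, ∃ v : MvPolynomial (Fin 2) k, Q ∈ Z → MvPolynomial.eval P v ≠ 0 ∧ MvPolynomial.eval Q v = 0 := by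
    intro Q
    by_cases h : Q ∈ Z
    · have hne : P ≠ Q := fun e => hP (e ▸ h)
      obtain ⟨i, hi⟩ := Function.ne_iff.1 hne
      refine ⟨X i - C (Q i), fun _ => ⟨?_, by simp⟩⟩
      simpa using sub_ne_zero.2 hi
    · exact ⟨0, fun h' => absurd h' h⟩
  choose v hv using this
  refine ⟨∏ Q ∈ Z, v Q, ?_, ?_⟩
  · rw [map_prod, Finset.prod_ne_zero_iff]
    exact fun Q hQ => (hv Q hQ).1
  · intro Q hQ
    rw [map_prod]
    exact Finset.prod_eq_zero hQ (hv Q hQ).2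

theorem bezout_points {f g : MvPolynomial (Fin 2) k} (hf : Prime f) (hfg : ¬ f ∣ g) {e : ℕ}
    (he : g.totalDegree ≤ e) (Z : Finset (Fin 2 → k))
    (h1 : ∀ P ∈ Z, MvPolynomial.eval P f = 0) (h2 : ∀ P ∈ Z, MvPolynomial.eval P g = 0) :
    Z.card ≤ f.totalDegree * e := by
  classical
  let Ψ : MvPolynomial (Fin 2) k →ₗ[k] (Z → k) :=
    LinearMap.pi fun P => (MvPolynomial.aeval P.1 : MvPolynomial (Fin 2) k →ₐ[k] k).toLinearMap
  have hΨ : ∀ q (P : Z), Ψ q P = MvPolynomial.eval P.1 q := fun q P => by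
    simp [Ψ, MvPolynomial.aeval_eq_eval]
  have := bezout_lin hf hfg he Ψ ?_ ?_ ?_
  · simpa using this
  · have hsep := fun P : Z => exists_sep (Z.erase P.1) P.1 (by simp)
    choose u hu hu' using hsep
    intro w
    refine ⟨∑ P, C (w P * (MvPolynomial.eval P.1 (u P))⁻¹) * u P, ?_⟩
    ext Q
    rw [hΨ, map_sum, Finset.sum_eq_single Q]
    · simp [hu Q]
    · intro P _ hPQ
      rw [map_mul, hu' P Q.1 (by
        rw [Finset.mem_erase]
        exact ⟨fun h => hPQ (Subtype.ext h.symm), Q.2⟩), mul_zero]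
    · simp
  · intro q; ext P; rw [hΨ]; simp [h1 P.1 P.2]
  · intro q; ext P; rw [hΨ]; simp [h2 P.1 P.2]

/-- multi-point order bound -/
theorem bezout_order {f g : MvPolynomial (Fin 2) k} (hf : Prime f) (hfg : ¬ f ∣ g) {e M : ℕ}
    (he : g.totalDegree ≤ e) (Z : Finset (Fin 2 → k)) (Y : (Fin 2 → k) → PowerSeries k)
    (h1 : ∀ P ∈ Z, IsPar f P (Y P)) (h2 : ∀ P ∈ Z, PowerSeries.X ^ M ∣ sbs (P 0) (Y P) g) :
    Z.card * M ≤ f.totalDegree * e := by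
  classical
  let Ψ : MvPolynomial (Fin 2) k →ₗ[k] (Z × Fin M → k) :=
    LinearMap.pi fun P => (PowerSeries.coeff (P.2 : ℕ)).comp (sbs (P.1.1 0) (Y P.1.1)).toLinearMap
  have hΨ : ∀ q (P : Z × Fin M), Ψ q P = PowerSeries.coeff (P.2 : ℕ) (sbs (P.1.1 0) (Y P.1.1) q) :=
    fun q P => rfl
  have := bezout_lin hf hfg he Ψ ?_ ?_ ?_
  · simpa using this
  · have hsep := fun P : Z => exists_sep (Z.erase P.1) P.1 (by simp)
    choose u hu hu' using hsep
    intro w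
    have hloc : ∀ P : Z, ∃ q : MvPolynomial (Fin 2) k, PowerSeries.X ^ M ∣ sbs (P.1 0) (Y P.1) (u P ^ M * q) -
        PowerSeries.mk (fun i => if h : i < M then w (P, ⟨i, h⟩) else 0) := by
      intro P
      set v := PowerSeries.mk (fun i => if h : i < M then w (P, ⟨i, h⟩) else 0)
      set z := sbs (P.1 0) (Y P.1) (u P ^ M) with hz
      have hz0 : PowerSeries.constantCoeff z ≠ 0 := by
        rw [hz, constCoeff_sbs (h1 _ P.2).c0]
        simp [hu P]
      set c : Polynomial k := PowerSeries.trunc M (v * z⁻¹) with hc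
      refine ⟨Polynomial.aeval (X 0 - C (P.1 0)) c, ?_⟩
      have e1 : sbs (P.1 0) (Y P.1) (Polynomial.aeval (X 0 - C (P.1 0)) c) = (c : PowerSeries k) := by
        rw [← Polynomial.aeval_algHom_apply]
        have : sbs (P.1 0) (Y P.1) (X 0 - C (P.1 0)) = PowerSeries.X := by
          simp [sbs]
        rw [this]
        have := Polynomial.aeval_algHom_apply (Polynomial.coeToPowerSeries.algHom k) Polynomial.X c
        simpa using this
      rw [map_mul, e1]
      have e2 : PowerSeries.X ^ M ∣ v * z⁻¹ - (c : PowerSeries k) := by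
        rw [PowerSeries.X_pow_dvd_iff]
        intro m hm
        rw [map_sub, Polynomial.coeff_coe, hc, PowerSeries.coeff_trunc, if_pos hm, sub_self]
      have e3 : z * (c : PowerSeries k) - v = - z * (v * z⁻¹ - (c : PowerSeries k)) := by
        have := PowerSeries.mul_inv_cancel z hz0
        linear_combination v * this
      rw [← hz, e3]
      exact e2.mul_left _
    choose q hq using hloc
    refine ⟨∑ P, u P ^ M * q P, ?_⟩
    ext ⟨Q, i⟩
    rw [hΨ, map_sum, map_sum, Finset.sum_eq_single Q]
    · have := (PowerSeries.X_pow_dvd_iff.1 (hq Q)) i i.2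
      rw [map_sub, sub_eq_zero] at this
      rw [this]; simp
    · intro P _ hPQ
      refine (PowerSeries.X_pow_dvd_iff (n := M)).1 ?_ i i.2
      rw [map_mul, map_pow]
      apply Dvd.dvd.mul_right
      apply pow_dvd_pow_of_dvd
      rw [PowerSeries.X_dvd_iff, constCoeff_sbs (h1 _ Q.2).c0]
      exact hu' P Q.1 (by
        rw [Finset.mem_erase]
        exact ⟨fun h => hPQ (Subtype.ext h.symm), Q.2⟩)
    · simp
  · intro q; ext P; rw [hΨ]; simp [(h1 P.1.1 P.1.2).zero]
  · intro q; ext P; rw [hΨ, map_mul]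
    exact (PowerSeries.X_pow_dvd_iff (n := M)).1 ((h2 _ P.1.2).mul_right _) P.2 P.2.2

theorem par_ker {f g : MvPolynomial (Fin 2) k} (hf : Prime f) {P : Fin 2 → k} {Y : PowerSeries k}
    (hY : IsPar f P Y) (hg : sbs (P 0) Y g = 0) : f ∣ g := by
  by_contra h
  have := bezout_order (M := f.totalDegree * g.totalDegree + 1) hf h le_rfl {P} (fun _ => Y)
    (by simpa using hY) (by simp [hg])
  simp at this

/-- chain rule -/
theorem chain_rule (x0 : k) (Y : PowerSeries k) (h : MvPolynomial (Fin 2) k) :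
    PowerSeries.derivative k (sbs x0 Y h) = sbs x0 Y (pderiv 0 h) +
      sbs x0 Y (pderiv 1 h) * PowerSeries.derivative k Y := by
  induction h using MvPolynomial.induction_on with
  | C a => simp [sbs]
  | add p q hp hq => simp only [map_add, hp, hq]; ring
  | mul_X p i hp =>
    have e0 : sbs x0 Y (X 0) = PowerSeries.C x0 + PowerSeries.X := by simp [sbs]
    have e1 : sbs x0 Y (X 1) = Y := by simp [sbs]
    fin_cases i
    · simp [Derivation.leibniz, hp, pderiv_X, e0]; ring
    · simp [Derivation.leibniz, hp, pderiv_X, e1]; ring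

/-- the derivation `f_y ∂_x − f_x ∂_y`. -/
noncomputable def DD (f : MvPolynomial (Fin 2) k) (h : MvPolynomial (Fin 2) k) : MvPolynomial (Fin 2) k :=
  pderiv 1 f * pderiv 0 h - pderiv 0 f * pderiv 1 h

theorem sbs_DD {f : MvPolynomial (Fin 2) k} {P : Fin 2 → k} {Y : PowerSeries k} (hY : IsPar f P Y)
    (h : MvPolynomial (Fin 2) k) :
    sbs (P 0) Y (DD f h) = sbs (P 0) Y (pderiv 1 f) * PowerSeries.derivative k (sbs (P 0) Y h) := by
  have h1 := chain_rule (P 0) Y h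
  have h2 := chain_rule (P 0) Y f
  rw [hY.zero, map_zero] at h2
  rw [h1, DD, map_sub, map_mul, map_mul]
  linear_combination (sbs (P 0) Y (pderiv 1 h)) * h2

end ser

/-! Part C -/

open MvPolynomial

theorem deg2 (m : Fin 2 →₀ ℕ) : (m.sum fun _ e => e) = m 0 + m 1 := by
  rw [Finsupp.sum_fintype _ _ (by simp)]; simp [Fin.sum_univ_two]

theorem le_deg2 {K : Type*} [CommSemiring K] {f : MvPolynomial (Fin 2) K} {m : Fin 2 →₀ ℕ}
    (h : m ∈ f.support) : m 0 + m 1 ≤ f.totalDegree := by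
  rw [← deg2]; exact le_totalDegree h

theorem totalDegree_le2 {K : Type*} [CommSemiring K] {f : MvPolynomial (Fin 2) K} {n : ℕ}
    (h : ∀ m ∈ f.support, m 0 + m 1 ≤ n) : f.totalDegree ≤ n := by
  rw [totalDegree, Finset.sup_le_iff]
  intro m hm
  have := h m hm
  rw [← deg2] at this
  exact this

theorem totalDegree_mon2 {K : Type*} [CommSemiring K] (m : Fin 2 →₀ ℕ) (c : K) :
    (monomial m c).totalDegree ≤ m 0 + m 1 := by
  rw [← deg2]
  exact totalDegree_monomial_le _ _

theorem totalDegree_pderiv_le {K : Type*} [CommRing K] (i : Fin 2) (f : MvPolynomial (Fin 2) K) :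
    (pderiv i f).totalDegree ≤ f.totalDegree - 1 := by
  conv_lhs => rw [f.as_sum, map_sum]
  apply totalDegree_finsetSum_le
  intro m hm
  rw [pderiv_monomial]
  have hm := le_deg2 hm
  by_cases h : m i = 0
  · simp [h]
  · refine (totalDegree_mon2 _ _).trans ?_
    fin_cases i
    · simp at h ⊢; omega
    · simp at h ⊢; omega

section st
variable {k : Type*} [Field k]

/-- linear version of `DD` -/
noncomputable def DL (f : MvPolynomial (Fin 2) k) : MvPolynomial (Fin 2) k →ₗ[k] MvPolynomial (Fin 2) k :=
  (LinearMap.mulLeft k (pderiv 1 f)).comp (pderiv 0 : Derivation k _ (MvPolynomial (Fin 2) k)).toLinearMap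
  - (LinearMap.mulLeft k (pderiv 0 f)).comp (pderiv 1 : Derivation k _ (MvPolynomial (Fin 2) k)).toLinearMap

theorem DL_apply (f h : MvPolynomial (Fin 2) k) : DL f h = DD f h := rfl

theorem totalDegree_DL (f h : MvPolynomial (Fin 2) k) :
    (DL f h).totalDegree ≤ h.totalDegree + f.totalDegree := by
  rw [DL_apply, DD]
  refine (totalDegree_sub _ _).trans (max_le ?_ ?_)
  · have h1 := totalDegree_mul (pderiv 1 f) (pderiv 0 h)
    have h2 := totalDegree_pderiv_le 1 f
    have h3 := totalDegree_pderiv_le 0 h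
    omega
  · have h1 := totalDegree_mul (pderiv 0 f) (pderiv 1 h)
    have h2 := totalDegree_pderiv_le 0 f
    have h3 := totalDegree_pderiv_le 1 h
    omega

theorem totalDegree_DLpow (f h : MvPolynomial (Fin 2) k) (n : ℕ) :
    ((DL f ^ n) h).totalDegree ≤ h.totalDegree + n * f.totalDegree := by
  induction n with
  | zero => simp
  | succ n ih =>
    rw [pow_succ', Module.End.mul_apply]
    have := totalDegree_DL f ((DL f ^ n) h)
    rw [add_mul, one_mul]; omega

theorem DL_mul_pow (p : ℕ) [CharP k p] (f α β : MvPolynomial (Fin 2) k) :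
    DL f (α * β ^ p) = DL f α * β ^ p := by
  rw [DL_apply, DL_apply, DD, DD]
  have hp : ∀ i : Fin 2, pderiv i (β ^ p) = 0 := by
    intro i
    rw [Derivation.leibniz_pow]
    have : (p : MvPolynomial (Fin 2) k) = 0 := by
      rw [← map_natCast (C : k →+* MvPolynomial (Fin 2) k), CharP.cast_eq_zero, map_zero]
    rw [← Nat.cast_smul_eq_nsmul (MvPolynomial (Fin 2) k), this, zero_smul]
  simp only [Derivation.leibniz, hp, smul_eq_mul]
  ring

theorem DLpow_mul_pow (p : ℕ) [CharP k p] (f α β : MvPolynomial (Fin 2) k) (n : ℕ) :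
    (DL f ^ n) (α * β ^ p) = (DL f ^ n) α * β ^ p := by
  induction n with
  | zero => simp
  | succ n ih => rw [pow_succ', Module.End.mul_apply, ih, DL_mul_pow, Module.End.mul_apply]

/-- Vanishing of the iterated derivatives gives order of vanishing. -/
theorem order_of_iter (p : ℕ) [CharP k p] {w : PowerSeries k} (hw : PowerSeries.constantCoeff w ≠ 0)
    {M : ℕ} (hM : M ≤ p) (F : PowerSeries k)
    (h : ∀ i < M, PowerSeries.constantCoeff ((fun G => w * PowerSeries.derivative k G)^[i] F) = 0) :
    PowerSeries.X ^ M ∣ F := by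
  by_contra hn
  have hF : F ≠ 0 := by rintro rfl; simp at hn
  have key : ∀ j G, PowerSeries.constantCoeff G ≠ 0 → j < p →
    PowerSeries.constantCoeff ((fun G => w * PowerSeries.derivative k G)^[j] (PowerSeries.X ^ j * G)) ≠ 0 := by
    intro j
    induction j with
    | zero => intro G hG _; simpa using hG
    | succ j ih =>
      intro G hG hj
      rw [Function.iterate_succ_apply]
      have e : w * PowerSeries.derivative k (PowerSeries.X ^ (j+1) * G) =
        PowerSeries.X ^ j * (w * (((j + 1 : ℕ) : PowerSeries k) * G + PowerSeries.X * PowerSeries.derivative k G)) := by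
        rw [Derivation.leibniz, Derivation.leibniz_pow]
        simp
        ring
      rw [e]
      apply ih _ _ (by omega)
      have : ((j + 1 : ℕ) : k) ≠ 0 := by
        rw [Ne, CharP.cast_eq_zero_iff k p]
        exact fun h => absurd (Nat.le_of_dvd (by omega) h) (by omega)
      push_cast at this
      simp [hw, hG, this]
  obtain ⟨G, hG⟩ := PowerSeries.X_pow_order_dvd (φ := F)
  set j := F.order.toNat with hj
  have hjo : F.order = j := (PowerSeries.coe_toNat_order hF).symm
  have hG0 : PowerSeries.constantCoeff G ≠ 0 := by
    have := PowerSeries.coeff_order hF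
    rw [← hj] at this
    rw [hG, PowerSeries.coeff_X_pow_mul', if_pos le_rfl, Nat.sub_self] at this
    simpa using this
  have hjM : j < M := by
    by_contra hc
    exact hn ((pow_dvd_pow _ (not_lt.1 hc)).trans ⟨G, hG⟩)
  have := key j G hG0 (by omega)
  rw [← hG] at this
  exact this (h j hjM)

theorem sbs_DLpow {f : MvPolynomial (Fin 2) k} {P : Fin 2 → k} {Y : PowerSeries k} (hY : IsPar f P Y)
    (h : MvPolynomial (Fin 2) k) (n : ℕ) :
    sbs (P 0) Y ((DL f ^ n) h) = (fun G => sbs (P 0) Y (pderiv 1 f) * PowerSeries.derivative k G)^[n]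
      (sbs (P 0) Y h) := by
  induction n with
  | zero => simp
  | succ n ih =>
    rw [pow_succ', Module.End.mul_apply, DL_apply, sbs_DD hY, ih, Function.iterate_succ_apply']

theorem multiples_quot {f : MvPolynomial (Fin 2) k} (hf : f ≠ 0) {L : ℕ} (hL : f.totalDegree ≤ L)
    (hd : 1 ≤ f.totalDegree) :
    ∃ K : Submodule k (restrictTotalDegree (Fin 2) k L), (∀ x ∈ K, f ∣ x.1) ∧
      Module.finrank k (restrictTotalDegree (Fin 2) k L ⧸ K) ≤ f.totalDegree * (L + 1) := by
  set V := restrictTotalDegree (Fin 2) k L with hV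
  have hVf : Module.finrank k V = Tri L := finrank_restrictTotalDegree k L
  refine ⟨(mulSub f (L - f.totalDegree)).comap V.subtype, ?_, ?_⟩
  · intro x hx
    obtain ⟨q, _, hq⟩ := mem_mulSub.1 hx
    exact ⟨q, hq.symm⟩
  · have h1 := Submodule.finrank_quotient_add_finrank ((mulSub f (L - f.totalDegree)).comap V.subtype)
    have hle : mulSub f (L - f.totalDegree) ≤ V := by
      intro x hx
      obtain ⟨q, hq, rfl⟩ := mem_mulSub.1 hx
      rw [hV, mem_restrictTotalDegree]
      have := totalDegree_mul f q
      omega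
    have h2 := (Submodule.comapSubtypeEquivOfLe hle).finrank_eq
    rw [finrank_mulSub f hf] at h2
    rw [h2, hVf] at h1
    obtain ⟨c, hc⟩ := Nat.exists_eq_add_of_le hL
    set d := f.totalDegree
    have hs : Tri (L - d) = Tri c := by congr 1; omega
    rw [hs] at h1
    have t1 := Tri_two L
    have t2 := Tri_two c
    have h3 : 2 * Tri L ≤ 2 * (d * (L + 1)) + 2 * Tri c := by
      rw [t1, t2, hc]; clear_value d; nlinarith
    omega

end st

section st2
variable {p : ℕ} [Fact p.Prime]

/-- Polynomial from coefficients on the standard monomials -/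
noncomputable def stdPoly {k : Type*} [Field k] (a d n : ℕ) (c : Fin d × Fin n → k) : MvPolynomial (Fin 2) k :=
  ∑ j, monomial (Jm a j.1 j.2) (c j)

theorem stdPoly_coeff {k : Type*} [Field k] (a d n : ℕ) (c : Fin d × Fin n → k) (j) :
    (stdPoly a d n c).coeff (Jm a j.1 j.2) = c j := by
  classical
  unfold stdPoly
  rw [coeff_sum, Finset.sum_eq_single j]
  · simp
  · intro i _ hij
    rw [coeff_monomial, if_neg]
    intro h
    obtain ⟨h1, h2⟩ := Jm_inj h
    exact hij (Prod.ext (Fin.ext h1) (Fin.ext h2))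
  · simp

theorem stdPoly_ne {k : Type*} [Field k] {a d n : ℕ} {c : Fin d × Fin n → k} (hc : c ≠ 0) :
    stdPoly a d n c ≠ 0 := by
  intro h
  apply hc
  ext j
  rw [← stdPoly_coeff a d n c j, h]; simp

theorem stdPoly_support {k : Type*} [Field k] {a d n : ℕ} {c : Fin d × Fin n → k} {m}
    (hm : m ∈ (stdPoly a d n c).support) : ∃ r < d, ∃ l < n, m = Jm a r l := by
  classical
  unfold stdPoly at hm
  have := Finsupp.mem_support_iff.1 hm
  by_contra hcon
  push Not at hcon
  apply this
  change coeff m _ = 0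
  rw [coeff_sum]
  apply Finset.sum_eq_zero
  intro j _
  rw [coeff_monomial, if_neg]
  exact fun h => hcon j.1 j.1.2 j.2 j.2.2 h.symm

theorem stdPoly_deg {k : Type*} [Field k] {a d n : ℕ} {c : Fin d × Fin n → k} :
    (stdPoly a d n c).totalDegree ≤ d - 1 + (n - 1) := by
  apply totalDegree_le2
  intro m hm
  obtain ⟨r, hr, l, hl, rfl⟩ := stdPoly_support hm
  rw [Jm_deg]
  omega

theorem exists_std {k : Type*} [Field k] {f : MvPolynomial (Fin 2) k} (hf : f ≠ 0) :
    ∃ a ≤ f.totalDegree, ∀ n (c : Fin f.totalDegree × Fin n → k), c ≠ 0 → ¬ f ∣ stdPoly a f.totalDegree n c := by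
  obtain ⟨a, b, hab, h⟩ := exists_lead hf
  refine ⟨a, by omega, fun n c hc => h _ (stdPoly_ne hc) ?_⟩
  intro m hm
  obtain ⟨r, hr, l, hl, rfl⟩ := stdPoly_support hm
  exact Jm_lt (by omega)

end st2

/-! Part C2 -/

open MvPolynomial

section st3
variable {p : ℕ} [hp : Fact p.Prime]

theorem stdPoly_add {k : Type*} [Field k] (a d n : ℕ) (c c' : Fin d × Fin n → k) :
    stdPoly a d n (c + c') = stdPoly a d n c + stdPoly a d n c' := by
  simp [stdPoly, Finset.sum_add_distrib]

theorem stdPoly_smul {k : Type*} [Field k] (a d n : ℕ) (t : k) (c : Fin d × Fin n → k) :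
    stdPoly a d n (t • c) = t • stdPoly a d n c := by
  simp [stdPoly, Finset.smul_sum, smul_monomial]

/-- `g ^ p ≡ g(0) mod t ^ p`. -/
theorem pow_p_mod (g : PowerSeries (ZMod p)) :
    PowerSeries.X ^ p ∣ g ^ p - PowerSeries.C (PowerSeries.constantCoeff g) := by
  have h1 : PowerSeries.X ∣ g - PowerSeries.C (PowerSeries.constantCoeff g) := by
    rw [PowerSeries.X_dvd_iff]; simp
  obtain ⟨h, hh⟩ := h1
  have : CharP (PowerSeries (ZMod p)) p := by
    apply charP_of_injective_algebraMap (R := ZMod p) (PowerSeries.C_injective)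
  have h2 := sub_pow_char (R := PowerSeries (ZMod p)) (p := p) g (PowerSeries.C (PowerSeries.constantCoeff g))
  rw [← map_pow, ZMod.pow_card, hh, mul_pow] at h2
  exact ⟨_, h2.symm⟩

theorem stepanov_nonvanish {f : MvPolynomial (Fin 2) (ZMod p)} (hf : Prime f) {a m1 : ℕ}
    (ha : ∀ n (c : Fin f.totalDegree × Fin n → ZMod p), c ≠ 0 → ¬ f ∣ stdPoly a f.totalDegree n c)
    (hm : f.totalDegree * (f.totalDegree - 1 + (m1 - 1)) < p)
    {P : Fin 2 → ZMod p} {Y : PowerSeries (ZMod p)} (hY : IsPar f P Y)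
    (γ : Fin f.totalDegree × Fin m1 → MvPolynomial (Fin 2) (ZMod p))
    (hγ : ∃ i, ¬ f ∣ γ i)
    (hR : f ∣ ∑ i, monomial (Jm a i.1 i.2) 1 * γ i ^ p) : False := by
  classical
  set φ := sbs (P 0) Y with hφ
  obtain ⟨i0, hi0⟩ := hγ
  have hne : ∃ i, φ (γ i) ≠ 0 := ⟨i0, fun h => hi0 (par_ker hf hY h)⟩
  have hsum : ∑ i, φ (monomial (Jm a i.1 i.2) 1) * φ (γ i) ^ p = 0 := by
    obtain ⟨q, hq⟩ := hR
    have := congrArg φ hq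
    rw [map_mul, hφ, hY.zero, zero_mul, map_sum] at this
    simpa using this
  -- minimal order
  have hex : ∃ n, ∃ i, ¬ PowerSeries.X ^ (n+1) ∣ φ (γ i) := by
    obtain ⟨i, hi⟩ := hne
    by_contra hcon
    push Not at hcon
    apply hi
    ext n
    simpa using PowerSeries.X_pow_dvd_iff.1 (hcon n i) n (by omega)
  let μ := Nat.find hex
  obtain ⟨i1, hi1⟩ : ∃ i, ¬ PowerSeries.X ^ (μ+1) ∣ φ (γ i) := Nat.find_spec hex
  have hdiv : ∀ i, PowerSeries.X ^ μ ∣ φ (γ i) := by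
    intro i
    rcases Nat.eq_zero_or_pos μ with h | h
    · simp [h]
    · have := Nat.find_min hex (m := μ - 1) (by omega)
      push Not at this
      have := this i
      rwa [Nat.sub_add_cancel h] at this
  choose g hg using hdiv
  have hg1 : PowerSeries.constantCoeff (g i1) ≠ 0 := by
    intro h
    rw [← PowerSeries.X_dvd_iff] at h
    apply hi1
    rw [hg i1, pow_succ]
    exact mul_dvd_mul_left _ h
  have hsum2 : ∑ i, φ (monomial (Jm a i.1 i.2) 1) * g i ^ p = 0 := by
    have hX : (PowerSeries.X ^ μ : PowerSeries (ZMod p)) ^ p ≠ 0 := pow_ne_zero _ (pow_ne_zero _ PowerSeries.X_ne_zero)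
    apply mul_left_cancel₀ hX
    rw [mul_zero, Finset.mul_sum, ← hsum]
    apply Finset.sum_congr rfl
    intro i _
    rw [hg i, mul_pow]; ring
  set c : Fin f.totalDegree × Fin m1 → ZMod p := fun i => PowerSeries.constantCoeff (g i) with hc
  have hcne : c ≠ 0 := fun h => hg1 (congrFun h i1)
  have hX : PowerSeries.X ^ p ∣ φ (stdPoly a f.totalDegree m1 c) := by
    have e : φ (stdPoly a f.totalDegree m1 c) = - ∑ i, φ (monomial (Jm a i.1 i.2) 1) * (g i ^ p - PowerSeries.C (c i)) := by
      simp only [mul_sub, Finset.sum_sub_distrib, hsum2, zero_sub, neg_neg, stdPoly, map_sum]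
      apply Finset.sum_congr rfl
      intro i _
      have : (monomial (Jm a i.1 i.2)) (c i) = c i • monomial (Jm a i.1 i.2) (1 : ZMod p) := by
        rw [smul_monomial]; simp
      rw [this, map_smul, PowerSeries.smul_eq_C_mul, mul_comm]
    rw [e, dvd_neg]
    exact Finset.dvd_sum fun i _ => (pow_p_mod (g i)).mul_left _
  have := bezout_order hf (ha m1 c hcne) (stdPoly_deg) {P} (fun _ => Y)
    (by simpa using hY) (by simpa using hX)
  simp only [Finset.card_singleton, one_mul] at this
  omega

theorem stepanov_core {f : MvPolynomial (Fin 2) (ZMod p)} (hf : Prime f) (hd : 1 ≤ f.totalDegree)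
    {m1 n1 m n M : ℕ} (hm : m = f.totalDegree - 1 + (m1 - 1)) (hn : n = f.totalDegree - 1 + (n1 - 1))
    (hMp : M ≤ p) (hmp : f.totalDegree * m < p) (hM1 : 1 ≤ M)
    (hcount : M * (f.totalDegree * (m + n + M * f.totalDegree + 1)) < (f.totalDegree * m1) * (f.totalDegree * n1))
    (Z : Finset (Fin 2 → ZMod p)) (h1 : ∀ P ∈ Z, MvPolynomial.eval P f = 0)
    (h2 : ∀ P ∈ Z, MvPolynomial.eval P (pderiv 1 f) ≠ 0) :
    Z.card * M ≤ f.totalDegree * (m + p * n) := by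
  classical
  rcases Z.eq_empty_or_nonempty with rfl | ⟨P0, hP0⟩
  · simp
  obtain ⟨a, -, ha⟩ := exists_std hf.ne_zero
  set d := f.totalDegree with hdd
  set L := m + n + M * d with hL
  obtain ⟨K, hK, hKf⟩ := multiples_quot hf.ne_zero (L := L) (by rw [hL, ← hdd]; nlinarith) hd
  let α : Fin d × Fin m1 → MvPolynomial (Fin 2) (ZMod p) := fun i => monomial (Jm a i.1 i.2) 1
  have hα : ∀ i, (α i).totalDegree ≤ m := by
    intro i
    refine (totalDegree_mon2 _ _).trans ?_
    rw [Jm_deg]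
    have := i.1.2; have := i.2.2
    omega
  let γ : ((Fin d × Fin m1) × (Fin d × Fin n1) → ZMod p) → Fin d × Fin m1 → MvPolynomial (Fin 2) (ZMod p) :=
    fun c i => stdPoly a d n1 (fun j => c (i, j))
  have hγ : ∀ c i, (γ c i).totalDegree ≤ n := fun c i => stdPoly_deg.trans hn.ge
  have hdeg : ∀ (t : ℕ), t < M → ∀ c, ∑ i, ((DL f ^ t) (α i)) * γ c i ∈ restrictTotalDegree (Fin 2) (ZMod p) L := by
    intro t ht c
    rw [mem_restrictTotalDegree]
    apply totalDegree_finsetSum_le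
    intro i _
    have e1 := totalDegree_mul ((DL f ^ t) (α i)) (γ c i)
    have e2 := totalDegree_DLpow f (α i) t
    rw [← hdd] at e2
    have e3 := hα i
    have e4 := hγ c i
    have e5 : t * d ≤ M * d := Nat.mul_le_mul_right _ ht.le
    omega
  let Φ : Fin M → (((Fin d × Fin m1) × (Fin d × Fin n1) → ZMod p) →ₗ[ZMod p] restrictTotalDegree (Fin 2) (ZMod p) L) :=
    fun t => 
    { toFun := fun c => ⟨∑ i, ((DL f ^ (t:ℕ)) (α i)) * γ c i, hdeg t t.2 c⟩
      map_add' := by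
        intro c c'
        ext1
        simp only [Submodule.coe_add]
        rw [← Finset.sum_add_distrib]
        apply Finset.sum_congr rfl
        intro i _
        rw [← mul_add]
        congr 1
        exact stdPoly_add a d n1 _ _
      map_smul' := by
        intro s c
        ext1
        simp only [Submodule.coe_smul, RingHom.id_apply]
        rw [Finset.smul_sum]
        apply Finset.sum_congr rfl
        intro i _
        rw [← mul_smul_comm]
        congr 1
        exact stdPoly_smul a d n1 s _ }
  let Θ : ((Fin d × Fin m1) × (Fin d × Fin n1) → ZMod p) →ₗ[ZMod p] (Fin M → (restrictTotalDegree (Fin 2) (ZMod p) L ⧸ K)) :=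
    LinearMap.pi fun t => K.mkQ.comp (Φ t)
  have hker : LinearMap.ker Θ ≠ ⊥ := by
    apply LinearMap.ker_ne_bot_of_finrank_lt
    rw [Module.finrank_pi_fintype, Module.finrank_fintype_fun_eq_card]
    simp only [Finset.sum_const, Finset.card_univ, Fintype.card_fin, Fintype.card_prod, smul_eq_mul]
    exact lt_of_le_of_lt (Nat.mul_le_mul_left _ hKf) hcount
  obtain ⟨c, hc, hc0⟩ := (Submodule.ne_bot_iff _).1 hker
  have hdvd : ∀ t < M, f ∣ ∑ i, ((DL f ^ t) (α i)) * γ c i := by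
    intro t ht
    have h3 : Θ c ⟨t, ht⟩ = 0 := by rw [LinearMap.mem_ker.1 hc]; rfl
    have h4 : Φ ⟨t, ht⟩ c ∈ K := by
      rw [← Submodule.Quotient.mk_eq_zero]; exact h3
    exact hK _ h4
  set R := ∑ i, α i * γ c i ^ p with hR
  have hpar : ∀ P : Fin 2 → ZMod p, ∃ Y, P ∈ Z → IsPar f P Y := by
    intro P
    by_cases h : P ∈ Z
    · obtain ⟨Y, hY⟩ := exists_par (h1 P h) (h2 P h)
      exact ⟨Y, fun _ => hY⟩
    · exact ⟨0, fun h' => absurd h' h⟩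
  choose Y hY using hpar
  have hnR : ¬ f ∣ R := by
    intro h
    refine stepanov_nonvanish (m1 := m1) hf ha (by rw [← hdd, ← hm]; exact hmp) (hY P0 hP0) (γ c) ?_ h
    obtain ⟨⟨i, j⟩, hij⟩ := Function.ne_iff.1 hc0
    refine ⟨i, ha n1 _ ?_⟩
    intro h0
    exact hij (congrFun h0 j)
  refine bezout_order hf hnR (e := m + p * n) ?_ Z Y (fun P hP => hY P hP) ?_
  · rw [hR]
    apply totalDegree_finsetSum_le
    intro i _
    refine (totalDegree_mul _ _).trans (add_le_add (hα i) ((totalDegree_pow _ _).trans ?_))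
    exact Nat.mul_le_mul_left _ (hγ c i)
  · intro P hP
    refine order_of_iter p (w := sbs (P 0) (Y P) (pderiv 1 f)) ?_ hMp _ ?_
    · rw [constCoeff_sbs (hY P hP).c0]; exact h2 P hP
    · intro t ht
      rw [← sbs_DLpow (hY P hP), constCoeff_sbs (hY P hP).c0, hR, map_sum]
      simp_rw [DLpow_mul_pow p]
      obtain ⟨q, hq⟩ := hdvd t ht
      have := congrArg (MvPolynomial.eval P) hq
      rw [map_mul, h1 P hP, zero_mul, map_sum] at this
      rw [map_sum, ← this]
      apply Finset.sum_congr rfl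
      intro i _
      rw [map_mul, map_mul, map_pow, ZMod.pow_card]

theorem step_hen {e v M : ℕ} (hd : 1 ≤ e) (hev1 : e * v ≤ M + 4 * e^2) :
    e * (e - 1 + v) + e ≤ M + 5 * e ^ 2 := by
  obtain ⟨e', rfl⟩ : ∃ e', e = e' + 1 := ⟨e - 1, by omega⟩
  simp only [Nat.add_sub_cancel]
  have : (e'+1) * (e' + v) + (e'+1) = (e'+1)*v + (e'+1)^2 := by ring
  rw [this]; omega

theorem step_count {e p M m v m1 : ℕ} (hd : 1 ≤ e) (hMM : M * M ≤ p) (hM16 : 16 * e ^ 2 ≤ M)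
    (he4 : 256 * e ^ 4 ≤ p) (hem1 : e * m ≤ p - 1) (hem2 : p - 1 < e * m + e)
    (hev1 : e * v ≤ M + 4 * e^2) (hev2 : M + 4 * e^2 < e * v + e) (hm1 : m1 + e = m + 2) :
    M * (e * (m + (e - 1 + v) + M * e + 1)) < (e * m1) * (e * (v + 1)) := by
  have hen := step_hen hd hev1
  have hee : e ≤ e ^ 2 := by nlinarith
  have q1 : p ≤ e * m1 + e ^ 2 := by
    have : e * m1 + e^2 = e * m + 2 * e := by
      calc e * m1 + e^2 = e * (m1 + e) := by ring
        _ = _ := by rw [hm1]; ring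
    omega
  have q2 : M + 4 * e^2 + 1 ≤ e * (v + 1) := by rw [mul_add, mul_one]; omega
  have q3 : M * (e * (m + (e - 1 + v) + M * e + 1)) ≤ M * (p + (M + 5 * e^2) + M * e^2) := by
    apply Nat.mul_le_mul_left
    have : e * (m + (e - 1 + v) + M * e + 1) = e * m + (e * (e - 1 + v) + e) + M * e^2 := by ring
    omega
  refine lt_of_le_of_lt q3 (lt_of_lt_of_le ?_ (Nat.mul_le_mul_left _ q2))
  have e1 : 1 ≤ e ^ 2 := Nat.one_le_pow _ _ hd
  have q4 : 16 * M ≤ p := le_trans (Nat.mul_le_mul_right M (by omega)) hMM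
  have q6 : M * M * e ^ 2 ≤ p * e^2 := Nat.mul_le_mul_right _ hMM
  have q7 : 16 * M * e ^ 2 ≤ p * e ^ 2 := Nat.mul_le_mul_right _ q4
  have q8 : p * (M + 4 * e^2 + 1) ≤ (e * m1 + e ^ 2) * (M + 4 * e^2 + 1) := Nat.mul_le_mul_right _ q1
  have q9 : 16 * e^2 * e^2 ≤ p * e^2 := Nat.mul_le_mul_right _ (by omega)
  have q11 : e^2 ≤ e^2 * e^2 := by nlinarith
  have q12 : 0 < p * e ^ 2 := by
    have : 0 < p := by have := Nat.one_le_pow 4 e hd; omega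
    positivity
  generalize e ^ 2 = D at *
  generalize e * m1 = x at *
  nlinarith

theorem step_final {e d p M m v z : ℕ} (hd : 1 ≤ e) (hfd : e ≤ d) (hM2 : p < (M + 1) * (M + 1))
    (hM16 : 16 * e ^ 2 ≤ M) (hem1 : e * m ≤ p - 1)
    (hev1 : e * v ≤ M + 4 * e^2) (core : z * M ≤ e * (m + p * (e - 1 + v))) :
    (z : ℝ) ≤ p + 12 * d ^ 2 * Real.sqrt p := by
  have hen := step_hen hd hev1
  have e1 : 1 ≤ e ^ 2 := Nat.one_le_pow _ _ hd
  have h3 : z * M ≤ p * M + 5 * p * e ^ 2 := by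
    calc z * M ≤ e * m + p * (e * (e - 1 + v)) := by refine core.trans (le_of_eq ?_); ring
      _ ≤ p + p * (e * (e - 1 + v)) := by omega
      _ = p * (e * (e - 1 + v) + 1) := by ring
      _ ≤ p * (M + 5 * e ^ 2) := Nat.mul_le_mul_left _ (by omega)
      _ = _ := by ring
  have h3' : (z : ℝ) * M ≤ p * M + 5 * p * (e:ℝ) ^ 2 := by exact_mod_cast h3
  have hM1 : 1 ≤ M := by omega
  have hMpos : (0:ℝ) < M := by exact_mod_cast hM1
  have hsq : Real.sqrt p ≤ 2 * M := by
    rw [Real.sqrt_le_left (by positivity)]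
    have : p ≤ (2 * M)^2 := by nlinarith
    exact_mod_cast this
  have hsp : Real.sqrt p * Real.sqrt p = p := Real.mul_self_sqrt (by positivity)
  have hed : (e:ℝ)^2 ≤ (d:ℝ)^2 := by
    have : (e:ℝ) ≤ d := by exact_mod_cast hfd
    gcongr
  have h4 : (p:ℝ) ≤ 2 * M * Real.sqrt p := by
    nlinarith [Real.sqrt_nonneg (p:ℝ)]
  have h5 : (z : ℝ) * M ≤ (p + 12 * d ^ 2 * Real.sqrt p) * M := by
    calc (z : ℝ) * M ≤ p * M + 5 * p * (e:ℝ) ^ 2 := h3'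
      _ ≤ p * M + 5 * (2 * M * Real.sqrt p) * (d:ℝ) ^ 2 := by gcongr
      _ ≤ _ := by nlinarith [show 0 ≤ Real.sqrt p * M * (d:ℝ)^2 by positivity]
  exact le_of_mul_le_mul_right h5 hMpos

theorem stepanov {f : MvPolynomial (Fin 2) (ZMod p)} (hf : Prime f) {d : ℕ} (hd : 1 ≤ f.totalDegree)
    (hfd : f.totalDegree ≤ d) (hpd : 256 * d ^ 4 ≤ p)
    (Z : Finset (Fin 2 → ZMod p)) (h1 : ∀ P ∈ Z, MvPolynomial.eval P f = 0)
    (h2 : ∀ P ∈ Z, MvPolynomial.eval P (pderiv 1 f) ≠ 0) :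
    (Z.card : ℝ) ≤ p + 12 * d ^ 2 * Real.sqrt p := by
  set e := f.totalDegree with he
  set M := Nat.sqrt p with hM
  have hMM : M * M ≤ p := Nat.sqrt_le p
  have hM2 : p < (M + 1) * (M + 1) := Nat.sqrt_lt'.1 (by rw [← hM]; omega) |>.trans_eq (sq _)
  have he4 : 256 * e ^ 4 ≤ p := le_trans (by gcongr) hpd
  have hM16 : 16 * e ^ 2 ≤ M := by
    rw [hM, Nat.le_sqrt]
    refine le_trans (le_of_eq ?_) he4; ring
  set m := (p - 1) / e with hm
  set v := (M + 4 * e ^ 2) / e with hv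
  have hp1 : 1 < p := hp.out.one_lt
  have hem1 : e * m ≤ p - 1 := Nat.mul_div_le _ _
  have hem2 : p - 1 < e * m + e := by
    have := Nat.lt_mul_div_succ (p-1) (show 0 < e by omega)
    rw [mul_add, mul_one] at this; exact this
  have hev1 : e * v ≤ M + 4 * e^2 := Nat.mul_div_le _ _
  have hev2 : M + 4 * e^2 < e * v + e := by
    have := Nat.lt_mul_div_succ (M + 4 * e^2) (show 0 < e by omega)
    rw [mul_add, mul_one] at this; exact this
  clear_value m v
  have hee4 : e ^ 2 ≤ e ^ 4 := Nat.pow_le_pow_right hd (by norm_num)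
  have e1 : 1 ≤ e ^ 2 := Nat.one_le_pow _ _ hd
  have hme : e ≤ m := by
    by_contra hcon
    have : e * m + e ≤ e * e := by
      rw [← Nat.mul_succ]; exact Nat.mul_le_mul_left _ (by omega)
    have e2 : e * e = e ^ 2 := by ring
    omega
  have hMp : M ≤ p := Nat.sqrt_le_self p
  clear_value M
  obtain ⟨m1, hm1⟩ : ∃ m1, m1 + e = m + 2 := ⟨m + 2 - e, by omega⟩
  have core := stepanov_core (m1 := m1) (n1 := v + 1) (m := m) (n := e - 1 + v) (M := M) hf hd
    (by omega) (by omega) hMp (by rw [← he]; omega) (by omega)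
    (step_count hd hMM hM16 he4 hem1 hem2 hev1 hev2 hm1) Z h1 h2
  exact step_final hd hfd hM2 hM16 hem1 hev1 core
end st3

/-! Part D -/

open MvPolynomial

theorem pderiv_swap {K : Type*} [CommRing K] (f : MvPolynomial (Fin 2) K) :
    pderiv 0 (pderiv 1 f) = pderiv 1 (pderiv 0 f) := by
  induction f using MvPolynomial.induction_on with
  | C a => simp
  | add p q hp hq => simp [hp, hq]
  | mul_X p i hp =>
    fin_cases i
    · simp [pderiv_mul, hp, pderiv_X]; ring
    · simp [pderiv_mul, hp, pderiv_X]; ring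

/-- Ruppert's operator. -/
noncomputable def Rup {K : Type*} [CommRing K] (f g h : MvPolynomial (Fin 2) K) : MvPolynomial (Fin 2) K :=
  f * (pderiv 1 g - pderiv 0 h) - g * pderiv 1 f + h * pderiv 0 f

theorem Rup_grad {K : Type*} [CommRing K] (f : MvPolynomial (Fin 2) K) :
    Rup f (pderiv 0 f) (pderiv 1 f) = 0 := by
  unfold Rup; rw [pderiv_swap]; ring

theorem Rup_pow {K : Type*} [CommRing K] (q s : MvPolynomial (Fin 2) K) (e j : ℕ) :
    Rup (q ^ e * s) (q ^ j * s * pderiv 0 q) (q ^ j * s * pderiv 1 q) = 0 := by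
  unfold Rup
  simp only [pderiv_mul, pderiv_pow, pderiv_swap]
  ring

section rq
variable {k : Type*} [Field k]

theorem totalDegree_pow_dom {q : MvPolynomial (Fin 2) k} (hq : q ≠ 0) (e : ℕ) :
    (q ^ e).totalDegree = e * q.totalDegree := by
  induction e with
  | zero => simp
  | succ n ih => rw [pow_succ, totalDegree_mul_of_isDomain (pow_ne_zero _ hq) hq, ih]; ring

theorem eq_zero_of_dvd_of_deg {f g : MvPolynomial (Fin 2) k} (h : f ∣ g)
    (hd : g.totalDegree < f.totalDegree) : g = 0 := by
  obtain ⟨q, rfl⟩ := h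
  by_contra hne
  have hf : f ≠ 0 := by rintro rfl; simp at hne
  have hq : q ≠ 0 := by rintro rfl; simp at hne
  rw [totalDegree_mul_of_isDomain hf hq] at hd
  omega

theorem rup_unique [CharZero k] {f : MvPolynomial (Fin 2) k} (hf : Prime f) (hd : 1 ≤ f.totalDegree)
    {P : Fin 2 → k}
    (h0 : MvPolynomial.eval P f = 0) (h1 : MvPolynomial.eval P (pderiv 1 f) ≠ 0)
    {g h : MvPolynomial (Fin 2) k} (hg : g.totalDegree ≤ f.totalDegree - 1)
    (hh : h.totalDegree ≤ f.totalDegree - 1) (hR : Rup f g h = 0) :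
    ∃ b : k, g = C b * pderiv 0 f ∧ h = C b * pderiv 1 f := by
  obtain ⟨Y, hY⟩ := exists_par h0 h1
  set φ := sbs (P 0) Y with hφ
  have hφf : φ f = 0 := hY.zero
  have hw0 : PowerSeries.constantCoeff (φ (pderiv 1 f)) ≠ 0 := by
    rw [hφ, constCoeff_sbs hY.c0]; exact h1
  set w := φ (pderiv 1 f) with hw
  have hwne : w ≠ 0 := by intro hz; rw [hz] at hw0; simp at hw0
  -- first relation
  have r1 : φ g * w = φ h * φ (pderiv 0 f) := by
    have := congrArg φ hR
    simp only [Rup, map_add, map_sub, map_mul, hφf, map_zero, zero_mul, zero_sub] at this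
    linear_combination -this
  have r2 : φ (DD f h) = φ h * φ (pderiv 0 (pderiv 1 f)) - φ g * φ (pderiv 1 (pderiv 1 f)) := by
    have := congrArg φ (congrArg (pderiv 1) hR)
    simp only [Rup, pderiv_mul, map_add, map_sub, map_mul, hφf, map_zero, zero_mul] at this
    rw [DD, pderiv_swap]
    simp only [map_sub, map_mul]
    linear_combination -this
  have r3 : φ (DD f (pderiv 1 f)) = w * φ (pderiv 0 (pderiv 1 f)) - φ (pderiv 0 f) * φ (pderiv 1 (pderiv 1 f)) := by
    simp [DD, hw]
  have r4 : w * φ (DD f h) = φ h * φ (DD f (pderiv 1 f)) := by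
    rw [r2, r3]; linear_combination - φ (pderiv 1 (pderiv 1 f)) * r1
  rw [hφ, sbs_DD hY, sbs_DD hY, ← hφ, ← hw] at r4
  have r5 : w * PowerSeries.derivative k (φ h) = φ h * PowerSeries.derivative k w := by
    apply mul_left_cancel₀ hwne
    linear_combination r4
  set Q := φ h * w⁻¹ with hQ
  have hQw : φ h = Q * w := by
    rw [hQ, mul_assoc, PowerSeries.inv_mul_cancel _ hw0, mul_one]
  have hQ' : PowerSeries.derivative k Q = 0 := by
    rw [hQw, Derivation.leibniz] at r5
    simp only [smul_eq_mul] at r5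
    have : w * w * PowerSeries.derivative k Q = 0 := by linear_combination r5
    exact (mul_eq_zero.1 this).resolve_left (mul_ne_zero hwne hwne)
  have hQc : Q = PowerSeries.C (PowerSeries.constantCoeff Q) := by
    apply PowerSeries.derivative.ext
    · rw [hQ', PowerSeries.derivative_C]
    · simp
  set b := PowerSeries.constantCoeff Q with hb
  have hφC : φ (C b) = PowerSeries.C b := by
    rw [hφ, sbs]; simp
  have d1 := totalDegree_pderiv_le 1 f
  have d0 := totalDegree_pderiv_le 0 f
  have hdeg : ∀ i (u : MvPolynomial (Fin 2) k), u.totalDegree ≤ f.totalDegree - 1 →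
      (u - C b * pderiv i f).totalDegree < f.totalDegree := by
    intro i u hu
    have e1 := totalDegree_sub u (C b * pderiv i f)
    have e2 := totalDegree_mul (C b) (pderiv i f)
    have e3 := totalDegree_pderiv_le i f
    rw [totalDegree_C] at e2
    have : max u.totalDegree (C b * pderiv i f).totalDegree ≤ f.totalDegree - 1 := max_le hu (by omega)
    omega
  have hh' : h = C b * pderiv 1 f := by
    rw [← sub_eq_zero]
    refine eq_zero_of_dvd_of_deg (f := f) (par_ker hf hY ?_) (hdeg 1 h hh)
    rw [← hφ, map_sub, map_mul, hφC, hQw, ← hQc, sub_self]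
  refine ⟨b, ?_, hh'⟩
  rw [← sub_eq_zero]
  refine eq_zero_of_dvd_of_deg (f := f) (par_ker hf hY ?_) (hdeg 0 g hg)
  apply mul_right_cancel₀ hwne
  rw [← hφ, map_sub, map_mul, hφC, sub_mul, r1, hQw, ← hQc]
  ring

theorem const_of_pderiv {p d : ℕ} [CharP k p] (hpd : d < p) {f : MvPolynomial (Fin 2) k}
    (hf : f.totalDegree ≤ d) (h : ∀ i, pderiv i f = 0) : f = C (coeff 0 f) := by
  ext m
  rw [coeff_C]
  split_ifs with hm
  · rw [← hm]
  · by_contra hne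
    have hmem := le_deg2 (mem_support_iff.2 hne)
    have hi : ∃ i, m i ≠ 0 := by
      by_contra hcon
      push Not at hcon
      exact hm (Finsupp.ext fun i => (hcon i).symm)
    obtain ⟨i, hi⟩ := hi
    have h1 := coeff_pderiv (i := i) f (m - Finsupp.single i 1)
    have hle : Finsupp.single i 1 ≤ m := by
      rw [Finsupp.single_le_iff]; omega
    rw [h i, tsub_add_cancel_of_le hle, coeff_zero] at h1
    have hmi : ((m - Finsupp.single i 1 : Fin 2 →₀ ℕ) i + 1) = m i := by simp; omega
    have hmp : m i < p := by
      fin_cases i <;> simp at * <;> omega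
    have hc : ((m i : ℕ) : k) ≠ 0 := by
      rw [Ne, CharP.cast_eq_zero_iff k p]
      exact fun hdv => absurd (Nat.le_of_dvd (by omega) hdv) (by omega)
    rw [← hmi] at hc
    push_cast at hc h1
    rcases mul_eq_zero.1 h1.symm with h2 | h2
    · exact hne h2
    · exact hc h2

theorem rup_two {p d : ℕ} [CharP k p] (hpd : d < p) {f : MvPolynomial (Fin 2) k} (hf0 : f ≠ 0)
    (hfd : f.totalDegree ≤ d) (hu : ¬ IsUnit f) (hirr : ¬ Irreducible f) :
    ∃ g h g' h' : MvPolynomial (Fin 2) k, Rup f g h = 0 ∧ Rup f g' h' = 0 ∧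
      g.totalDegree ≤ d - 1 ∧ h.totalDegree ≤ d - 1 ∧ g'.totalDegree ≤ d - 1 ∧ h'.totalDegree ≤ d - 1 ∧
      ∀ s t : k, C s * g + C t * g' = 0 → C s * h + C t * h' = 0 → s = 0 ∧ t = 0 := by
  obtain ⟨q, hq, hqf⟩ := WfDvdMonoid.exists_irreducible_factor hu hf0
  have hfin : FiniteMultiplicity q f := FiniteMultiplicity.of_not_isUnit hq.not_isUnit hf0
  obtain ⟨r, hr, hqr⟩ := hfin.exists_eq_pow_mul_and_not_dvd
  set e := multiplicity q f with he
  have he1 : 1 ≤ e := by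
    rcases Nat.eq_zero_or_pos e with h | h
    · rw [h, pow_zero, one_mul] at hr
      exact absurd (hr ▸ hqf) hqr
    · exact h
  have hr0 : r ≠ 0 := by rintro rfl; simp at hqr
  have hq0 := hq.ne_zero
  have hqp : Prime q := hq.prime
  have hunitC : ∀ c : k, c ≠ 0 → IsUnit (C c : MvPolynomial (Fin 2) k) := fun c hc =>
    (IsUnit.mk0 c hc).map C
  have hqdeg : 1 ≤ q.totalDegree := by
    by_contra hcon
    have : q.totalDegree = 0 := by omega
    rw [totalDegree_eq_zero_iff_eq_C] at this
    apply hq.not_isUnit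
    rw [this]
    apply hunitC
    intro hz; rw [hz, map_zero] at this; exact hq0 this
  have hdegf : f.totalDegree = e * q.totalDegree + r.totalDegree := by
    rw [hr, totalDegree_mul_of_isDomain (pow_ne_zero _ hq0) hr0, totalDegree_pow_dom hq0]
  have hqd : q.totalDegree ≤ d := by nlinarith
  have hrd : r.totalDegree ≤ d := by omega
  have hgrad : ∃ i, pderiv i q ≠ 0 := by
    by_contra hcon
    push Not at hcon
    have := const_of_pderiv hpd hqd hcon
    rw [this, totalDegree_C] at hqdeg
    omega
  obtain ⟨i, hi⟩ := hgrad
  have hqi : ¬ q ∣ pderiv i q := fun h => hi (eq_zero_of_dvd_of_deg h (by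
    have := totalDegree_pderiv_le i q; omega))
  have hdegj : ∀ j < e, ∀ i, (q ^ j * r * pderiv i q).totalDegree ≤ d - 1 := by
    intro j hj i
    have e1 := totalDegree_mul (q ^ j * r) (pderiv i q)
    have e2 := totalDegree_mul (q ^ j) r
    have e3 := totalDegree_pow q j
    have e4 := totalDegree_pderiv_le i q
    have e5 : (j + 1) * q.totalDegree ≤ e * q.totalDegree := Nat.mul_le_mul_right _ hj
    rw [add_mul, one_mul] at e5
    omega
  rcases Nat.lt_or_ge 1 e with he2 | he2
  · refine ⟨q ^ (e-1) * r * pderiv 0 q, q ^ (e-1) * r * pderiv 1 q, q ^ (e-2) * r * pderiv 0 q,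
      q ^ (e-2) * r * pderiv 1 q, ?_, ?_, hdegj _ (by omega) _, hdegj _ (by omega) _,
      hdegj _ (by omega) _, hdegj _ (by omega) _, ?_⟩
    · conv_lhs => rw [hr]
      exact Rup_pow _ _ _ _
    · conv_lhs => rw [hr]
      exact Rup_pow _ _ _ _
    · intro s t h0 h1
      have hst : ∀ i, C s * (q ^ (e-1) * r * pderiv i q) + C t * (q ^ (e-2) * r * pderiv i q) = 0 := by
        intro i; fin_cases i
        · exact h0
        · exact h1
      have h2 := hst i
      have hee : e - 1 = (e - 2) + 1 := by omega
      rw [hee, pow_succ] at h2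
      have h3 : (q ^ (e-2) * r * pderiv i q) * (C s * q + C t) = 0 := by linear_combination h2
      have h4 : C s * q + C t = 0 := (mul_eq_zero.1 h3).resolve_left
        (mul_ne_zero (mul_ne_zero (pow_ne_zero _ hq0) hr0) hi)
      have h5 : t = 0 := by
        by_contra hne
        have : q ∣ C t := ⟨- C s, by linear_combination h4⟩
        exact hq.not_isUnit (isUnit_of_dvd_unit this (hunitC t hne))
      refine ⟨?_, h5⟩
      rw [h5, map_zero, add_zero] at h4
      have := (mul_eq_zero.1 h4).resolve_right hq0
      simpa using this
  · have he' : e = 1 := by omega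
    rw [he', pow_one] at hr
    have hru : ¬ IsUnit r := by
      intro hru
      apply hirr
      rw [hr]
      exact (irreducible_mul_isUnit hru).2 hq
    refine ⟨q ^ 0 * r * pderiv 0 q, q ^ 0 * r * pderiv 1 q, pderiv 0 f, pderiv 1 f, ?_, Rup_grad f,
      hdegj _ (by omega) _, hdegj _ (by omega) _, ?_, ?_, ?_⟩
    · have := Rup_pow q r 1 0
      rwa [pow_one, ← hr] at this
    · exact (totalDegree_pderiv_le _ _).trans (by omega)
    · exact (totalDegree_pderiv_le _ _).trans (by omega)
    · intro s t h0 h1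
      have hst : ∀ i, C s * (q ^ 0 * r * pderiv i q) + C t * (pderiv i f) = 0 := by
        intro i; fin_cases i
        · exact h0
        · exact h1
      have hst' : ∀ i, C (s + t) * (r * pderiv i q) + C t * (q * pderiv i r) = 0 := by
        intro i
        have h2 := hst i
        rw [hr, pderiv_mul, pow_zero, one_mul] at h2
        rw [map_add]
        linear_combination h2
      have hs : s + t = 0 := by
        by_contra hne
        have h2 := hst' i
        have : q ∣ C (s+t) * (r * pderiv i q) := ⟨- C t * pderiv i r, by linear_combination h2⟩
        rcases hqp.dvd_or_dvd this with h3 | h3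
        · exact hq.not_isUnit (isUnit_of_dvd_unit h3 (hunitC _ hne))
        · rcases hqp.dvd_or_dvd h3 with h4 | h4
          · exact hqr h4
          · exact hqi h4
      have ht : t = 0 := by
        by_contra hne
        have hz : ∀ i, pderiv i r = 0 := by
          intro i
          have h2 := hst' i
          rw [hs, map_zero, zero_mul, zero_add] at h2
          have h3 := (mul_eq_zero.1 h2).resolve_left (by simpa using hne)
          exact (mul_eq_zero.1 h3).resolve_left hq0
        have := const_of_pderiv hpd hrd hz
        apply hru
        rw [this]
        apply hunitC
        intro h5
        rw [h5, map_zero] at this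
        exact hr0 this
      rw [ht, add_zero] at hs
      exact ⟨hs, ht⟩

end rq

/-! Part D2 -/

open MvPolynomial

section gram

theorem gram_ne_zero {m n : Type*} [Fintype m] [Fintype n] [DecidableEq n] (A : Matrix m n ℤ)
    (h : ∀ v : n → ℤ, A.mulVec v = 0 → v = 0) : (A.transpose * A).det ≠ 0 := by
  intro h0
  obtain ⟨v, hv, hv0⟩ := Matrix.exists_mulVec_eq_zero_iff.2 h0
  apply hv
  apply h
  have h1 : A.mulVec v ⬝ᵥ A.mulVec v = 0 := by
    rw [Matrix.dotProduct_mulVec, ← Matrix.mulVec_transpose, Matrix.mulVec_mulVec, hv0, zero_dotProduct]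
  exact dotProduct_self_eq_zero.1 h1

theorem gram_mod {m n : Type*} [Fintype m] [Fintype n] [DecidableEq n] (A : Matrix m n ℤ) {p : ℕ}
    [Fact p.Prime] (hp : ¬ (p : ℤ) ∣ (A.transpose * A).det) (v : n → ZMod p)
    (hv : (A.map (Int.castRingHom (ZMod p))).mulVec v = 0) : v = 0 := by
  by_contra hne
  have h1 : ((A.map (Int.castRingHom (ZMod p))).transpose * (A.map (Int.castRingHom (ZMod p)))).det = 0 := by
    apply Matrix.exists_mulVec_eq_zero_iff.1
    refine ⟨v, hne, ?_⟩
    rw [← Matrix.mulVec_mulVec, hv, Matrix.mulVec_zero]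
  apply hp
  rw [← ZMod.intCast_zmod_eq_zero_iff_dvd, ← h1, ← Matrix.transpose_map, ← Matrix.map_mul]
  exact RingHom.map_det (Int.castRingHom (ZMod p)) _

theorem gram_le {m n : Type*} [Fintype m] [Fintype n] [DecidableEq n] (A : Matrix m n ℤ) (x : ℤ)
    (hx : ∀ i j, |A i j| ≤ x) : |(A.transpose * A).det| ≤
      (Fintype.card n).factorial * (Fintype.card m * x ^ 2) ^ Fintype.card n := by
  have := Matrix.det_le (A := A.transpose * A) (abv := AbsoluteValue.abs) (x := Fintype.card m * x ^ 2) (by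
    intro i j
    simp only [Matrix.mul_apply, Matrix.transpose_apply, AbsoluteValue.abs_apply]
    refine (Finset.abs_sum_le_sum_abs _ _).trans ?_
    have : ∀ k ∈ Finset.univ, |A k i * A k j| ≤ x ^ 2 := by
      intro k _
      rw [abs_mul, sq]
      exact mul_le_mul (hx _ _) (hx _ _) (abs_nonneg _) ((abs_nonneg _).trans (hx k i))
    refine (Finset.sum_le_card_nsmul _ _ _ this).trans ?_
    simp)
  simpa using this

/-- monomials of degree less than `d` -/
abbrev Sx (d : ℕ) := {q : Fin d × Fin d // q.1.1 + q.2.1 < d}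

noncomputable def mk2 (a b : ℕ) : Fin 2 →₀ ℕ := Finsupp.equivFunOnFinite.symm ![a, b]

theorem mk2_zero (a b : ℕ) : mk2 a b 0 = a := rfl
theorem mk2_one (a b : ℕ) : mk2 a b 1 = b := rfl
theorem mk2_eq (m : Fin 2 →₀ ℕ) : mk2 (m 0) (m 1) = m := by
  ext i; fin_cases i <;> rfl

noncomputable def sm {d : ℕ} (q : Sx d) : Fin 2 →₀ ℕ := mk2 q.1.1.1 q.1.2.1

theorem sm_deg {d : ℕ} (q : Sx d) : sm q 0 + sm q 1 < d := q.2

theorem sm_inj {d : ℕ} {q r : Sx d} (h : sm q = sm r) : q = r := by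
  have h0 := DFunLike.congr_fun h 0
  have h1 := DFunLike.congr_fun h 1
  apply Subtype.ext
  apply Prod.ext
  · exact Fin.ext h0
  · exact Fin.ext h1

variable {K : Type*} [CommRing K]

noncomputable def vp {d : ℕ} (v : Fin 2 × Sx d → K) (i : Fin 2) : MvPolynomial (Fin 2) K :=
  ∑ c, if c.1 = i then monomial (sm c.2) (v c) else 0

theorem vp_coeff {d : ℕ} (v : Fin 2 × Sx d → K) (i : Fin 2) (q : Sx d) :
    (vp v i).coeff (sm q) = v (i, q) := by
  classical
  unfold vp
  rw [coeff_sum, Finset.sum_eq_single (i, q)]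
  · simp
  · rintro ⟨j, r⟩ _ hne
    split_ifs with h
    · rw [coeff_monomial, if_neg]
      intro h2
      apply hne
      exact Prod.ext h (sm_inj h2)
    · simp
  · simp

theorem vp_deg {d : ℕ} (v : Fin 2 × Sx d → K) (i : Fin 2) : (vp v i).totalDegree ≤ d - 1 := by
  unfold vp
  apply totalDegree_finsetSum_le
  intro c _
  split_ifs
  · have h1 := totalDegree_mon2 (sm c.2) (v c)
    have h2 := sm_deg c.2
    omega
  · simp

theorem vp_of {d : ℕ} (hd : 1 ≤ d) (g : Fin 2 → MvPolynomial (Fin 2) K) (hg : ∀ i, (g i).totalDegree ≤ d - 1) (i : Fin 2) :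
    vp (fun c : Fin 2 × Sx d => (g c.1).coeff (sm c.2)) i = g i := by
  have key : ∀ h : MvPolynomial (Fin 2) K, h.totalDegree ≤ d - 1 → ∀ m : Fin 2 →₀ ℕ,
      (¬ ∃ q : Sx d, m = sm q) → h.coeff m = 0 := by
    intro h hh m hm
    by_contra hne
    apply hm
    have := le_deg2 (mem_support_iff.2 hne)
    refine ⟨⟨(⟨m 0, by omega⟩, ⟨m 1, by omega⟩), by simp only; omega⟩, ?_⟩
    exact (mk2_eq m).symm
  ext m
  by_cases hm : ∃ q : Sx d, m = sm q
  · obtain ⟨q, rfl⟩ := hm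
    rw [vp_coeff]
  · rw [key _ (vp_deg _ _) m hm, key _ (hg i) m hm]

theorem Rup_sum {ι : Type*} (s : Finset ι) (f : MvPolynomial (Fin 2) K) (g h : ι → MvPolynomial (Fin 2) K) :
    Rup f (∑ i ∈ s, g i) (∑ i ∈ s, h i) = ∑ i ∈ s, Rup f (g i) (h i) := by
  classical
  induction s using Finset.induction_on with
  | empty => simp [Rup]
  | insert a s ha ih =>
    rw [Finset.sum_insert ha, Finset.sum_insert ha, Finset.sum_insert ha, ← ih]
    simp only [Rup, map_add]; ring

noncomputable def RupC {d : ℕ} (f : MvPolynomial (Fin 2) K) (c : Fin 2 × Sx d) : MvPolynomial (Fin 2) K :=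
  Rup f (if c.1 = 0 then monomial (sm c.2) 1 else 0) (if c.1 = 1 then monomial (sm c.2) 1 else 0)

theorem Rup_vp {d : ℕ} (f : MvPolynomial (Fin 2) K) (v : Fin 2 × Sx d → K) :
    Rup f (vp v 0) (vp v 1) = ∑ c, C (v c) * RupC f c := by
  unfold vp
  rw [Rup_sum]
  apply Finset.sum_congr rfl
  intro c _
  have hm : monomial (sm c.2) (v c) = C (v c) * monomial (sm c.2) 1 := by
    rw [C_mul_monomial, mul_one]
  rw [RupC, hm]
  obtain ⟨i, q⟩ := c
  fin_cases i <;> simp [Rup, pderiv_mul] <;> ring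

theorem RupC_map {L : Type*} [CommRing L] (φ : K →+* L) {d : ℕ} (f : MvPolynomial (Fin 2) K) (c : Fin 2 × Sx d) :
    RupC (map φ f) c = map φ (RupC f c) := by
  obtain ⟨i, q⟩ := c
  fin_cases i <;> simp [RupC, Rup, ← pderiv_map]

theorem Rup_deg {d : ℕ} (hd : 1 ≤ d) {f g h : MvPolynomial (Fin 2) K} (hf : f.totalDegree ≤ d)
    (hg : g.totalDegree ≤ d - 1) (hh : h.totalDegree ≤ d - 1) : (Rup f g h).totalDegree < 2 * d := by
  have a1 := totalDegree_pderiv_le 1 g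
  have a2 := totalDegree_pderiv_le 0 h
  have a3 := totalDegree_pderiv_le 1 f
  have a4 := totalDegree_pderiv_le 0 f
  have b1 := totalDegree_mul f (pderiv 1 g - pderiv 0 h)
  have b2 := totalDegree_sub (pderiv 1 g) (pderiv 0 h)
  have b3 := totalDegree_mul g (pderiv 1 f)
  have b4 := totalDegree_mul h (pderiv 0 f)
  have c1 := totalDegree_add (f * (pderiv 1 g - pderiv 0 h) - g * pderiv 1 f) (h * pderiv 0 f)
  have c2 := totalDegree_sub (f * (pderiv 1 g - pderiv 0 h)) (g * pderiv 1 f)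
  unfold Rup
  omega

/-- The Ruppert matrix with one extra row. -/
noncomputable def RM (d : ℕ) (f : MvPolynomial (Fin 2) K) (u : Fin 2 × Sx d) :
    Matrix (Fin (2*d) × Fin (2*d) ⊕ Unit) (Fin 2 × Sx d) K :=
  fun r c => Sum.elim (fun r : Fin (2*d) × Fin (2*d) => (RupC f c).coeff (mk2 r.1 r.2)) (fun _ => if c = u then 1 else 0) r

theorem RM_map {L : Type*} [CommRing L] (φ : K →+* L) {d : ℕ} (f : MvPolynomial (Fin 2) K) (u : Fin 2 × Sx d) :
    RM d (map φ f) u = (RM d f u).map φ := by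
  ext r c
  rcases r with r | r
  · simp [RM, RupC_map, coeff_map]
  · simp [RM]

theorem RM_ker {d : ℕ} (hd : 1 ≤ d) {f : MvPolynomial (Fin 2) K} (hf : f.totalDegree ≤ d) {v : Fin 2 × Sx d → K}
    (c0 : Fin 2 × Sx d) : (RM d f c0).mulVec v = 0 ↔ Rup f (vp v 0) (vp v 1) = 0 ∧ v c0 = 0 := by
  have e1 : ∀ r, (RM d f c0).mulVec v (Sum.inl r) = (Rup f (vp v 0) (vp v 1)).coeff (mk2 r.1 r.2) := by
    intro r
    rw [Rup_vp, coeff_sum]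
    simp only [coeff_C_mul, Matrix.mulVec, dotProduct, RM, Sum.elim_inl]
    exact Finset.sum_congr rfl fun _ _ => mul_comm _ _
  have e2 : ∀ r, (RM d f c0).mulVec v (Sum.inr r) = v c0 := by
    intro r
    simp [Matrix.mulVec, dotProduct, RM]
  constructor
  · intro h
    refine ⟨?_, by rw [← e2 (), h]; rfl⟩
    ext m
    by_contra hne
    have hm := le_deg2 (mem_support_iff.2 hne)
    have h2 := Rup_deg hd hf (vp_deg v 0) (vp_deg v 1)
    have := e1 (⟨m 0, by omega⟩, ⟨m 1, by omega⟩)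
    rw [h] at this
    simp only [mk2_eq] at this
    exact hne this.symm
  · rintro ⟨h1, h2⟩
    ext r
    rcases r with r | r
    · rw [e1, h1]; simp
    · rw [e2, h2]; rfl

end gram

theorem coeff_pderiv_le {d : ℕ} {f : MvPolynomial (Fin 2) ℤ} (hf : f.totalDegree ≤ d) {H : ℤ}
    (hH : ∀ m, |f.coeff m| ≤ H) (i : Fin 2) (m) : |(pderiv i f).coeff m| ≤ d * H := by
  have hH0 : 0 ≤ H := (abs_nonneg _).trans (hH 0)
  rw [coeff_pderiv, abs_mul]
  by_cases h : f.coeff (m + Finsupp.single i 1) = 0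
  · rw [h]; simp; positivity
  · have := le_deg2 (mem_support_iff.2 h)
    have h2 : m i + 1 ≤ d := by
      fin_cases i <;> simp at this ⊢ <;> omega
    have h3 : |((m i : ℤ) + 1)| ≤ d := by
      rw [abs_of_nonneg (by positivity)]; exact_mod_cast h2
    rw [mul_comm]
    exact mul_le_mul h3 (hH _) (abs_nonneg _) (by positivity)

theorem coeff_mul_mon_le {f : MvPolynomial (Fin 2) ℤ} {H : ℤ} (hH : ∀ m, |f.coeff m| ≤ H) (s m) (r : ℤ) :
    |(f * monomial s r).coeff m| ≤ H * |r| := by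
  classical
  have hH0 : 0 ≤ H := (abs_nonneg _).trans (hH 0)
  rw [coeff_mul_monomial']
  split_ifs
  · rw [abs_mul]
    exact mul_le_mul_of_nonneg_right (hH _) (abs_nonneg _)
  · simp; positivity

theorem RM_le {d : ℕ} {f : MvPolynomial (Fin 2) ℤ} (hf : f.totalDegree ≤ d) {H : ℤ} (hH1 : 1 ≤ H)
    (hH : ∀ m, |f.coeff m| ≤ H) (u : Fin 2 × Sx d) (r c) : |RM d f u r c| ≤ 2 * d * H := by
  have hd : 1 ≤ d := by
    have := u.2.1.1.2; omega
  have hd' : (1:ℤ) ≤ d := by exact_mod_cast hd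
  rcases r with r | r
  · simp only [RM, Sum.elim_inl]
    obtain ⟨i, q⟩ := c
    have hq := sm_deg q
    have main : ∀ j : Fin 2, |(f * pderiv j (monomial (sm q) 1) - monomial (sm q) 1 * pderiv j f).coeff (mk2 r.1 r.2)| ≤ 2 * d * H := by
      intro j
      rw [coeff_sub]
      refine (abs_sub _ _).trans ?_
      rw [pderiv_monomial, mul_comm (monomial _ _) (pderiv j f)]
      have h1 := coeff_mul_mon_le hH (sm q - Finsupp.single j 1) (mk2 r.1 r.2) (1 * (sm q j))
      have h2 := coeff_mul_mon_le (coeff_pderiv_le hf hH j) (sm q) (mk2 r.1 r.2) 1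
      have h3 : |(1 * (sm q j : ℤ))| ≤ d := by
        rw [one_mul, abs_of_nonneg (by positivity)]
        have : sm q j ≤ d := by fin_cases j <;> simp <;> omega
        exact_mod_cast this
      have h4 : H * |(1 * (sm q j : ℤ))| ≤ H * d := mul_le_mul_of_nonneg_left h3 (by omega)
      simp only [abs_one, mul_one] at h2
      linarith
    fin_cases i
    · have := main 1
      simpa [RupC, Rup] using this
    · have := main 0
      rw [← abs_neg, ← coeff_neg] at this
      simp only [RupC, Rup]
      convert this using 3
      simp; ring
  · simp only [RM, Sum.elim_inr]
    split_ifs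
    · simp; nlinarith
    · simp; nlinarith

theorem eval_map_apply_aux {L : Type*} [CommRing L] (P : Fin 2 → ℤ) (f : MvPolynomial (Fin 2) ℤ) :
    eval (fun i => (P i : L)) (map (Int.castRingHom L) f) = ((eval P f : ℤ) : L) := by
  rw [eval_map]
  exact (eval₂_comp_left (Int.castRingHom L) (RingHom.id ℤ) P f).symm

theorem gram_exists {d : ℕ} (hd : 1 ≤ d) {f : MvPolynomial (Fin 2) ℤ} (hfd : f.totalDegree = d)
    (hirr : Irreducible (map (Int.castRingHom ℚ) f)) {P : Fin 2 → ℤ} (h0 : eval P f = 0)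
    (h1 : eval P (pderiv 1 f) ≠ 0) {H : ℤ} (hH1 : 1 ≤ H) (hH : ∀ m, |f.coeff m| ≤ H) :
    ∃ G : ℤ, G ≠ 0 ∧ |G| ≤ (2*d^2).factorial * (5*d^2 * (2 * d * H) ^ 2) ^ (2*d^2) ∧
      ∀ p [Fact p.Prime], d < p → ¬ (p : ℤ) ∣ G → map (Int.castRingHom (ZMod p)) f ≠ 0 →
        IsUnit (map (Int.castRingHom (ZMod p)) f) ∨ Irreducible (map (Int.castRingHom (ZMod p)) f) := by
  have hm : ∃ m, (pderiv 1 f).coeff m ≠ 0 := by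
    by_contra hcon
    push Not at hcon
    apply h1
    have : pderiv 1 f = 0 := by ext m; simpa using hcon m
    rw [this, map_zero]
  obtain ⟨m, hm⟩ := hm
  have hmd := le_deg2 (mem_support_iff.2 hm)
  have hmd2 := totalDegree_pderiv_le 1 f
  have hq : ∃ q : Sx d, sm q = m :=
    ⟨⟨(⟨m 0, by omega⟩, ⟨m 1, by omega⟩), by simp only; omega⟩, mk2_eq m⟩
  obtain ⟨q, rfl⟩ := hq
  set A := RM d f (1, q) with hA
  have hinjZ : Function.Injective (Int.castRingHom ℚ) := Int.cast_injective
  refine ⟨(A.transpose * A).det, ?_, ?_, ?_⟩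
  · apply gram_ne_zero
    intro v hv
    set v' : Fin 2 × Sx d → ℚ := fun c => (v c : ℚ) with hv'
    have hv2 : (RM d (map (Int.castRingHom ℚ) f) (1, q)).mulVec v' = 0 := by
      rw [RM_map, ← hA]
      have := RingHom.map_mulVec (Int.castRingHom ℚ) A v
      ext r
      have h3 := this r
      rw [hv] at h3
      simp only [Pi.zero_apply, map_zero] at h3
      rw [Pi.zero_apply]
      exact h3.symm
    have hdeg : (map (Int.castRingHom ℚ) f).totalDegree = d := by
      rw [← hfd]; unfold totalDegree; rw [support_map_of_injective f hinjZ]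
    rw [RM_ker hd hdeg.le (v := v')] at hv2
    obtain ⟨hr, hz⟩ := hv2
    obtain ⟨b, hb0, hb1⟩ := rup_unique (P := fun i => (P i : ℚ)) hirr.prime (by omega) (by
      have := eval_map_apply_aux (L := ℚ) P f; rw [h0, Int.cast_zero] at this; exact this) (by
      rw [pderiv_map]
      have := eval_map_apply_aux (L := ℚ) P (pderiv 1 f)
      intro h3; rw [h3] at this; exact h1 (by exact_mod_cast this.symm)) (by rw [hdeg]; exact vp_deg v' 0) (by rw [hdeg]; exact vp_deg v' 1) hr
    have hb : b = 0 := by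
      have h3 := congrArg (coeff (sm q)) hb1
      rw [vp_coeff, hz, coeff_C_mul, pderiv_map, coeff_map] at h3
      rcases mul_eq_zero.1 h3.symm with h4 | h4
      · exact h4
      · exfalso; apply hm; simpa using h4
    rw [hb, map_zero, zero_mul] at hb0 hb1
    ext ⟨i, r⟩
    have h3 : (vp v' i).coeff (sm r) = 0 := by
      fin_cases i
      · exact hb0 ▸ coeff_zero _
      · exact hb1 ▸ coeff_zero _
    rw [vp_coeff] at h3
    have h4 : ((v (i, r) : ℤ) : ℚ) = 0 := h3
    rw [Pi.zero_apply]
    exact_mod_cast h4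
  · have h3 := gram_le A (2 * d * H) (RM_le hfd.le hH1 hH (1, q))
    refine h3.trans ?_
    have hc1 : Fintype.card (Fin 2 × Sx d) ≤ 2 * d ^ 2 := by
      rw [Fintype.card_prod, Fintype.card_fin]
      have : Fintype.card (Sx d) ≤ _ := Fintype.card_subtype_le (fun q : Fin d × Fin d => q.1.1 + q.2.1 < d)
      rw [Fintype.card_prod, Fintype.card_fin, ← sq] at this
      omega
    have hc2 : Fintype.card (Fin (2*d) × Fin (2*d) ⊕ Unit) ≤ 5 * d ^ 2 := by
      rw [Fintype.card_sum, Fintype.card_prod, Fintype.card_fin, Fintype.card_unit]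
      nlinarith
    have hd' : (1:ℤ) ≤ d := by exact_mod_cast hd
    have hc2' : ((Fintype.card (Fin (2*d) × Fin (2*d) ⊕ Unit) : ℕ) : ℤ) ≤ 5 * d ^ 2 := by exact_mod_cast hc2
    have hx : (1:ℤ) ≤ 2 * d * H := by nlinarith
    have hy : (1:ℤ) ≤ 5 * d ^ 2 * (2 * d * H) ^ 2 := by
      have := one_le_pow₀ (n := 2) hx
      nlinarith
    have e1 : (((Fintype.card (Fin 2 × Sx d)).factorial : ℕ) : ℤ) ≤ ((2 * d ^ 2).factorial : ℕ) := by
      exact_mod_cast Nat.factorial_le hc1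
    refine mul_le_mul e1 ?_ (by positivity) (by positivity)
    refine (pow_le_pow_left₀ (by positivity) (mul_le_mul_of_nonneg_right hc2' (by positivity)) _).trans ?_
    exact pow_le_pow_right₀ hy hc1
  · intro p hp hdp hpG hne
    by_contra hcon
    push Not at hcon
    set fp := map (Int.castRingHom (ZMod p)) f with hfp
    have hdeg : fp.totalDegree ≤ d := by
      apply totalDegree_le2
      intro m hm
      rw [← hfd]
      apply le_deg2
      rw [mem_support_iff] at hm ⊢
      intro h3; apply hm
      rw [hfp, coeff_map, h3, map_zero]
    obtain ⟨g, h, g', h', r1, r2, e1, e2, e3, e4, hind⟩ := rup_two hdp hne hdeg hcon.1 hcon.2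
    -- combination
    set s := h'.coeff (sm q) with hs
    set t := -h.coeff (sm q) with ht
    have main : ∀ s t : ZMod p, (C s * h + C t * h').coeff (sm q) = 0 → s = 0 ∧ t = 0 := by
      intro s t hst
      set w : Fin 2 → MvPolynomial (Fin 2) (ZMod p) := ![C s * g + C t * g', C s * h + C t * h'] with hw
      have dC : ∀ (a : ZMod p) (x : MvPolynomial (Fin 2) (ZMod p)), x.totalDegree ≤ d - 1 → (C a * x).totalDegree ≤ d - 1 := by
        intro a x hx
        have := totalDegree_mul (C a) x
        rw [totalDegree_C] at this
        omega
      have hwd : ∀ i, (w i).totalDegree ≤ d - 1 := by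
        intro i
        fin_cases i
        · exact (totalDegree_add _ _).trans (max_le (dC _ _ e1) (dC _ _ e3))
        · exact (totalDegree_add _ _).trans (max_le (dC _ _ e2) (dC _ _ e4))
      set v : Fin 2 × Sx d → ZMod p := fun c => (w c.1).coeff (sm c.2) with hv
      have hv0 : v = 0 := by
        apply gram_mod A hpG
        rw [hA, ← RM_map, RM_ker hd hdeg (v := v), hv, vp_of hd w hwd, vp_of hd w hwd]
        refine ⟨?_, hst⟩
        have : Rup fp (C s * g + C t * g') (C s * h + C t * h') = C s * Rup fp g h + C t * Rup fp g' h' := by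
          simp only [Rup, map_add, pderiv_C_mul]; ring
        simp only [hw, Matrix.cons_val_zero, Matrix.cons_val_one]
        rw [this, r1, r2]; simp
      have hvz : ∀ i, w i = 0 := by
        intro i
        rw [← vp_of hd w hwd i, ← hv, hv0]
        simp [vp]
      exact hind s t (hvz 0) (hvz 1)
    have m1 := main s t (by simp [hs, ht]; ring)
    have m2 := main 1 0 (by
      have := m1.2
      rw [ht, neg_eq_zero] at this
      simp [this])
    exact one_ne_zero m2.1

/-! Part E -/

open MvPolynomial

theorem det_points {k : Type*} [Field k] {f : MvPolynomial (Fin 2) k} (hf : f ≠ 0) {d : ℕ} (hfd : f.totalDegree = d)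
    (S : Finset (Fin 2 → k)) (hS : ∀ P ∈ S, eval P f = 0) :
    ∃ T ⊆ S, T.card + Tri d ≤ Tri (2*d) ∧ ∀ g : MvPolynomial (Fin 2) k, g.totalDegree ≤ 2*d →
      (∀ P ∈ T, eval P g = 0) → ∀ P ∈ S, eval P g = 0 := by
  classical
  set V := restrictTotalDegree (Fin 2) k (2*d) with hV
  set ev : (Fin 2 → k) → Module.Dual k V := fun P =>
    (MvPolynomial.aeval P : MvPolynomial (Fin 2) k →ₐ[k] k).toLinearMap.comp V.subtype with hev
  have hev_apply : ∀ P (g : V), ev P g = eval P g.1 := by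
    intro P g
    simp [hev, aeval_eq_eval]
  obtain ⟨b, hbt, hspan, hli⟩ := exists_linearIndependent k (Set.image ev (S : Set (Fin 2 → k)))
  obtain ⟨T, hTS, hbij⟩ := Set.SurjOn.exists_bijOn_subset (f := ev) (s := (S : Set (Fin 2 → k))) (t := b) hbt
  have hTfin : T.Finite := S.finite_toSet.subset hTS
  have hbfin : b.Finite := (S.finite_toSet.image _).subset hbt
  have hle : mulSub f d ≤ V := by
    intro x hx
    obtain ⟨q, hq, rfl⟩ := mem_mulSub.1 hx
    rw [hV, mem_restrictTotalDegree]
    have := totalDegree_mul f q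
    omega
  set K := (mulSub f d).comap V.subtype with hK
  have hKr : Module.finrank k K = Tri d := by
    rw [← finrank_mulSub f hf d]
    exact (Submodule.comapSubtypeEquivOfLe hle).finrank_eq
  have hVr : Module.finrank k V = Tri (2*d) := finrank_restrictTotalDegree k _
  have hKa := Subspace.finrank_add_finrank_dualAnnihilator_eq K
  have hsub : Submodule.span k b ≤ K.dualAnnihilator := by
    rw [Submodule.span_le]
    intro φ hφ
    obtain ⟨P, hP, rfl⟩ := hbt hφ
    rw [SetLike.mem_coe, Submodule.mem_dualAnnihilator]
    intro w hw
    rw [hev_apply]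
    obtain ⟨q, _, hq⟩ := mem_mulSub.1 (Submodule.mem_comap.1 hw)
    have : w.1 = f * q := hq.symm
    rw [this, map_mul, hS P hP, zero_mul]
  haveI : Fintype b := hbfin.fintype
  have hbr : Module.finrank k (Submodule.span k b) = b.toFinset.card := finrank_span_set_eq_card hli
  have hmono := Submodule.finrank_mono hsub
  refine ⟨hTfin.toFinset, ?_, ?_, ?_⟩
  · intro x hx
    exact hTS (by simpa using hx)
  · have hc : hTfin.toFinset.card = b.toFinset.card := by
      rw [← Set.ncard_eq_toFinset_card T hTfin, ← Set.ncard_eq_toFinset_card' b, ← hbij.image_eq,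
        Set.ncard_image_of_injOn hbij.injOn]
    omega
  · intro g hg hz P hP
    set g' : V := ⟨g, by rw [hV, mem_restrictTotalDegree]; exact hg⟩ with hg'
    have h1 : ev P ∈ Submodule.span k b := by
      rw [hspan]; exact Submodule.subset_span ⟨P, hP, rfl⟩
    have h2 : Submodule.span k b ≤ LinearMap.ker (Module.Dual.eval k V g') := by
      rw [Submodule.span_le]
      intro φ hφ
      obtain ⟨Q, hQ, rfl⟩ := hbij.surjOn hφ
      rw [SetLike.mem_coe, LinearMap.mem_ker, Module.Dual.eval_apply, hev_apply]
      exact hz Q (by simpa using hQ)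
    have h3 := h2 h1
    rw [LinearMap.mem_ker, Module.Dual.eval_apply, hev_apply] at h3
    exact h3

theorem eval_mon_le {P : Fin 2 → ℤ} {b : ℕ} (hb : 1 ≤ b) (hP : ∀ i, |P i| ≤ b) {m : Fin 2 →₀ ℕ} {l : ℕ}
    (hm : m 0 + m 1 ≤ l) (c : ℤ) : |eval P (monomial m c)| ≤ |c| * (b:ℤ) ^ l := by
  rw [eval_monomial, Finsupp.prod_fintype _ _ (by simp), Fin.prod_univ_two, abs_mul, abs_mul, abs_pow, abs_pow]
  apply mul_le_mul_of_nonneg_left _ (abs_nonneg _)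
  calc |P 0| ^ m 0 * |P 1| ^ m 1 ≤ (b:ℤ) ^ m 0 * (b:ℤ) ^ m 1 := by
        gcongr
        · exact hP 0
        · exact hP 1
    _ = (b:ℤ) ^ (m 0 + m 1) := (pow_add _ _ _).symm
    _ ≤ _ := pow_le_pow_right₀ (by exact_mod_cast hb) hm

theorem small_multiple {d b H : ℕ} (hb : 1 ≤ b) (T : Finset (Fin 2 → ℤ)) (hT : ∀ P ∈ T, ∀ i, |P i| ≤ b)
    (hlt : (2 * (Tri (2*d) * H * b ^ (2*d)) + 1) ^ T.card < (H+1) ^ Tri (2*d)) :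
    ∃ g : MvPolynomial (Fin 2) ℤ, g ≠ 0 ∧ g.totalDegree ≤ 2*d ∧ (∀ m, |g.coeff m| ≤ H) ∧ ∀ P ∈ T, eval P g = 0 := by
  classical
  set κ : Set (Fin 2 →₀ ℕ) := {m : Fin 2 →₀ ℕ | (m.sum fun _ e ↦ e) ≤ 2*d} with hκ
  have hcard : Nat.card κ = Tri (2*d) := natCard_deg_le (2*d)
  have hTri : Tri (2*d) ≠ 0 := by
    have := Tri_two (2*d); intro h; rw [h] at this; simp at this
  haveI : Finite κ := Nat.finite_of_card_ne_zero (by rw [hcard]; exact hTri)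
  haveI : Fintype κ := Fintype.ofFinite κ
  rw [Nat.card_eq_fintype_card] at hcard
  set gg : (κ → Fin (H+1)) → MvPolynomial (Fin 2) ℤ := fun c => ∑ m, monomial m.1 ((c m).1 : ℤ) with hgg
  have hco : ∀ c (m : κ), (gg c).coeff m.1 = (c m).1 := by
    intro c m
    rw [hgg, coeff_sum, Finset.sum_eq_single m]
    · simp
    · intro m' _ hne
      rw [coeff_monomial, if_neg]
      intro e; exact hne (Subtype.ext e)
    · simp
  have hdeg : ∀ c, (gg c).totalDegree ≤ 2*d := by
    intro c
    apply totalDegree_finsetSum_le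
    intro m _
    exact (totalDegree_mon2 _ _).trans (by rw [← deg2]; exact m.2)
  set N := Tri (2*d) * H * b ^ (2*d) with hN
  have hmaps : ∀ c ∈ (Finset.univ : Finset (κ → Fin (H+1))), (fun P : T => eval P.1 (gg c)) ∈
      Fintype.piFinset (fun _ : T => Finset.Icc (-(N:ℤ)) N) := by
    intro c _
    rw [Fintype.mem_piFinset]
    intro P
    rw [Finset.mem_Icc, ← abs_le, hgg, map_sum]
    refine (Finset.abs_sum_le_sum_abs _ _).trans ?_
    have : ∀ m ∈ (Finset.univ : Finset κ), |eval P.1 (monomial m.1 ((c m).1 : ℤ))| ≤ (H : ℤ) * (b:ℤ) ^ (2*d) := by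
      intro m _
      refine (eval_mon_le hb (hT P.1 P.2) (l := 2*d) (by rw [← deg2]; exact m.2) _).trans ?_
      apply mul_le_mul_of_nonneg_right _ (by positivity)
      rw [abs_of_nonneg (by positivity)]
      have := (c m).2
      exact_mod_cast (by omega : (c m).1 ≤ H)
    refine (Finset.sum_le_card_nsmul _ _ _ this).trans ?_
    rw [Finset.card_univ, hcard, hN]
    simp [mul_assoc]
  obtain ⟨c, _, c', _, hne, heq⟩ := Finset.exists_ne_map_eq_of_card_lt_of_maps_to (by
    rw [Fintype.card_piFinset, Finset.card_univ, Fintype.card_fun, Fintype.card_fin, hcard]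
    simp only [Finset.prod_const, Int.card_Icc, Finset.card_univ, Fintype.card_coe]
    convert hlt using 2
    omega) hmaps
  refine ⟨gg c - gg c', ?_, ?_, ?_, ?_⟩
  · intro h0
    apply hne
    ext m
    have := congrArg (coeff m.1) h0
    rw [coeff_sub, hco, hco, coeff_zero] at this
    omega
  · exact (totalDegree_sub _ _).trans (max_le (hdeg c) (hdeg c'))
  · intro m
    by_cases hm : m ∈ κ
    · have h1 := hco c ⟨m, hm⟩
      have h2 := hco c' ⟨m, hm⟩
      simp only at h1 h2
      rw [coeff_sub, h1, h2, abs_le]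
      have := (c ⟨m, hm⟩).2
      have := (c' ⟨m, hm⟩).2
      omega
    · have : ∀ c, (gg c).coeff m = 0 := by
        intro c
        by_contra hne
        apply hm
        have := le_deg2 (mem_support_iff.2 hne)
        have h2 := hdeg c
        change (m.sum fun _ e ↦ e) ≤ 2*d
        rw [deg2]; omega
      rw [coeff_sub, this, this]; simp
  · intro P hP
    have := congrFun heq ⟨P, hP⟩
    simp only at this
    rw [map_sub, this, sub_self]

/-! Part E2 -/

open MvPolynomial

section kronecker
variable {K : Type*} [CommRing K]

/-- Kronecker substitution -/
noncomputable def kro (N : ℕ) : MvPolynomial (Fin 2) K →ₐ[K] Polynomial K :=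
  aeval ![Polynomial.X, Polynomial.X ^ N]

theorem kro_monomial (N : ℕ) (m : Fin 2 →₀ ℕ) (c : K) :
    kro N (monomial m c) = Polynomial.monomial (m 0 + N * m 1) c := by
  rw [kro, aeval_monomial, Finsupp.prod_fintype _ _ (by simp), Fin.prod_univ_two]
  simp only [Matrix.cons_val_zero, Matrix.cons_val_one]
  rw [← pow_mul, ← pow_add, ← Polynomial.C_mul_X_pow_eq_monomial]
  rfl

theorem kro_eq (N : ℕ) (g : MvPolynomial (Fin 2) K) :
    kro N g = ∑ m ∈ g.support, Polynomial.monomial (m 0 + N * m 1) (g.coeff m) := by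
  conv_lhs => rw [g.as_sum, map_sum]
  exact Finset.sum_congr rfl fun m _ => kro_monomial _ _ _

theorem kro_exp_inj {N : ℕ} {m m' : Fin 2 →₀ ℕ} (h : m 0 < N) (h' : m' 0 < N)
    (e : m 0 + N * m 1 = m' 0 + N * m' 1) : m = m' := by
  have e0 : m 0 = m' 0 := by
    have := congrArg (· % N) e
    simpa [Nat.add_mul_mod_self_left, Nat.mod_eq_of_lt h, Nat.mod_eq_of_lt h'] using this
  have e1 : m 1 = m' 1 := by
    rw [e0] at e
    exact Nat.eq_of_mul_eq_mul_left (by omega) (by omega : N * m 1 = N * m' 1)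
  ext i; fin_cases i
  · exact e0
  · exact e1

theorem kro_coeff {N : ℕ} {g : MvPolynomial (Fin 2) K} (hg : ∀ m ∈ g.support, m 0 < N) {m : Fin 2 →₀ ℕ}
    (hm : m 0 < N) : (kro N g).coeff (m 0 + N * m 1) = g.coeff m := by
  classical
  rw [kro_eq, Polynomial.finsetSum_coeff, Finset.sum_eq_single m]
  · simp
  · intro m' hm' hne
    rw [Polynomial.coeff_monomial, if_neg]
    intro e
    exact hne (kro_exp_inj (hg m' hm') hm e)
  · intro h
    simpa using h

theorem kro_coeff_or {N : ℕ} {g : MvPolynomial (Fin 2) K} (hg : ∀ m ∈ g.support, m 0 < N) (e : ℕ) :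
    (kro N g).coeff e = 0 ∨ ∃ m, (kro N g).coeff e = g.coeff m := by
  by_cases h : ∃ m ∈ g.support, m 0 + N * m 1 = e
  · obtain ⟨m, hm, rfl⟩ := h
    exact Or.inr ⟨m, kro_coeff hg (hg m hm)⟩
  · left
    push Not at h
    rw [kro_eq, Polynomial.finsetSum_coeff]
    apply Finset.sum_eq_zero
    intro m hm
    rw [Polynomial.coeff_monomial, if_neg (h m hm)]

theorem kro_natDegree {N d : ℕ} (hN : 1 ≤ N) {g : MvPolynomial (Fin 2) K} (hg : g.totalDegree ≤ d) :
    (kro N g).natDegree ≤ d * N := by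
  rw [kro_eq]
  apply Polynomial.natDegree_sum_le_of_forall_le
  intro m hm
  refine (Polynomial.natDegree_monomial_le _).trans ?_
  have := le_deg2 hm
  have h2 : m 0 + m 1 ≤ d := this.trans hg
  nlinarith [Nat.zero_le (m 0)]

theorem kro_map {L : Type*} [CommRing L] (φ : K →+* L) (N : ℕ) (g : MvPolynomial (Fin 2) K) :
    (kro N g).map φ = kro N (map φ g) := by
  induction g using MvPolynomial.induction_on with
  | C a => simp [kro]
  | add p q hp hq => simp [hp, hq]
  | mul_X p i hp =>
    simp only [map_mul, Polynomial.map_mul, hp, map_X]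
    congr 1
    fin_cases i <;> simp [kro]

end kronecker

theorem kro_primitive {N : ℕ} {f : MvPolynomial (Fin 2) ℤ} (hg : ∀ m ∈ f.support, m 0 < N)
    (hf : Finset.gcd f.support f.coeff = 1) : (kro N f).IsPrimitive := by
  intro r hr
  rw [Polynomial.C_dvd_iff_dvd_coeff] at hr
  apply isUnit_of_dvd_one
  rw [← hf]
  apply Finset.dvd_gcd
  intro m hm
  rw [← kro_coeff hg (hg m hm)]
  exact hr _

theorem mignotte {d b : ℕ} {f g : MvPolynomial (Fin 2) ℤ} (hfd : f.totalDegree ≤ d)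
    (hf : Finset.gcd f.support f.coeff = 1) (hg0 : g ≠ 0) (hgd : g.totalDegree ≤ 2 * d)
    (hdvd : map (Int.castRingHom ℚ) f ∣ map (Int.castRingHom ℚ) g) {H : ℕ} (hH : ∀ m, |g.coeff m| ≤ H) (m) :
    ((|f.coeff m| : ℤ) : ℝ) ≤ 2 ^ (d * (2*d+1)) * ((2*d*(2*d+1) + 1) * H) := by
  by_cases hm : m ∈ f.support
  swap
  · have : f.coeff m = 0 := by simpa using hm
    rw [this]; simp; positivity
  set N := 2*d+1 with hN
  have hfs : ∀ m ∈ f.support, m 0 < N := by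
    intro m hm; have := le_deg2 hm; omega
  have hgs : ∀ m ∈ g.support, m 0 < N := by
    intro m hm; have := le_deg2 hm; omega
  have hprim := kro_primitive hfs hf
  have hd2 : kro N f ∣ kro N g := by
    rw [Polynomial.IsPrimitive.Int.dvd_iff_map_cast_dvd_map_cast _ _ hprim, kro_map, kro_map]
    exact map_dvd _ hdvd
  obtain ⟨h, hh⟩ := hd2
  have hG0 : kro N g ≠ 0 := by
    obtain ⟨m, hm⟩ := MvPolynomial.ne_zero_iff.1 hg0
    intro h0
    apply hm
    rw [← kro_coeff hgs (hgs m (mem_support_iff.2 hm)), h0]; simp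
  have hh0 : h ≠ 0 := by rintro rfl; rw [mul_zero] at hh; exact hG0 hh
  have h1 := Polynomial.norm_coeff_le_choose_mul_mahlerMeasure_of_one_le_mahlerMeasure (m 0 + N * m 1)
    ((kro N f).map (Int.castRingHom ℂ)) (h.map (Int.castRingHom ℂ)) (Polynomial.one_le_mahlerMeasure_of_ne_zero hh0)
  rw [← Polynomial.map_mul, ← hh, Polynomial.coeff_map, kro_coeff hfs (hfs m hm)] at h1
  have hn : ‖(Int.castRingHom ℂ) (f.coeff m)‖ = ((|f.coeff m| : ℤ) : ℝ) := by simp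
  rw [hn] at h1
  refine h1.trans ?_
  have hdegF : ((kro N f).map (Int.castRingHom ℂ)).natDegree ≤ d * N :=
    (Polynomial.natDegree_map_le).trans (kro_natDegree (by omega) hfd)
  have hdegG : ((kro N g).map (Int.castRingHom ℂ)).natDegree ≤ 2 * d * N :=
    (Polynomial.natDegree_map_le).trans (kro_natDegree (by omega) hgd)
  have hchoose : ((((kro N f).map (Int.castRingHom ℂ)).natDegree.choose (m 0 + N * m 1) : ℕ) : ℝ) ≤ 2 ^ (d * N) := by
    have : ((kro N f).map (Int.castRingHom ℂ)).natDegree.choose (m 0 + N * m 1) ≤ 2 ^ (d*N) :=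
      (Nat.choose_le_two_pow _ _).trans (Nat.pow_le_pow_right (by norm_num) hdegF)
    exact_mod_cast this
  have hM : ((kro N g).map (Int.castRingHom ℂ)).mahlerMeasure ≤ (2*d*(2*d+1) + 1) * H := by
    refine (Polynomial.mahlerMeasure_le_sum_norm_coeff _).trans ?_
    rw [Polynomial.sum_over_range' _ (by simp) (2*d*N+1) (by omega)]
    have : ∀ e ∈ Finset.range (2*d*N+1), ‖((kro N g).map (Int.castRingHom ℂ)).coeff e‖ ≤ H := by
      intro e _
      rw [Polynomial.coeff_map]
      rcases kro_coeff_or hgs e with h | ⟨m', h⟩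
      · rw [h]; simp
      · rw [h]
        have := hH m'
        have h3 : ((|g.coeff m'| : ℤ) : ℝ) ≤ ((H : ℤ) : ℝ) := by exact_mod_cast this
        simpa using h3
    refine (Finset.sum_le_card_nsmul _ _ _ this).trans ?_
    rw [Finset.card_range, nsmul_eq_mul, hN]
    push_cast
    exact le_rfl
  exact mul_le_mul hchoose hM (Polynomial.mahlerMeasure_nonneg _) (by positivity)

theorem count_ineq {n t T b H : ℕ} (X : ℕ) (hX : X = 3 * n * b) (hn : 1 ≤ n) (hb : 1 ≤ b) (hH : H = X ^ 3) (h1 : T + t ≤ n) (h2 : n ≤ 4 * t) :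
    (2 * (n * H * b) + 1) ^ T < (H + 1) ^ n := by
  have hnb : 1 ≤ n * b := Nat.mul_pos hn hb
  have hX1 : 1 ≤ X := by rw [hX]; nlinarith
  have hH1 : 1 ≤ H := by rw [hH]; exact Nat.one_le_pow _ _ hX1
  have ht : t ≠ 0 := by omega
  have e1 : 2 * (n * H * b) + 1 ≤ X * (H + 1) := by
    rw [hX]; nlinarith [Nat.mul_le_mul hnb hH1]
  calc (2 * (n * H * b) + 1) ^ T ≤ (X * (H+1)) ^ T := Nat.pow_le_pow_left e1 _
    _ = X ^ T * (H+1) ^ T := mul_pow _ _ _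
    _ ≤ X ^ (3 * t) * (H+1) ^ T := Nat.mul_le_mul_right _ (Nat.pow_le_pow_right hX1 (by omega))
    _ = H ^ t * (H+1)^T := by rw [pow_mul, hH]
    _ < (H+1) ^ t * (H+1)^T := Nat.mul_lt_mul_of_pos_right (Nat.pow_lt_pow_left (by omega) ht) (by positivity)
    _ = (H+1) ^ (t + T) := (pow_add _ _ _).symm
    _ ≤ _ := Nat.pow_le_pow_right (by omega) (by omega)

theorem height_bound {d b : ℕ} (hd : 1 ≤ d) (hb : 1 ≤ b) {f : MvPolynomial (Fin 2) ℤ} (hfd : f.totalDegree = d)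
    (hf : Finset.gcd f.support f.coeff = 1) (hirr : Irreducible (map (Int.castRingHom ℚ) f))
    (S : Finset (Fin 2 → ℤ)) (hS0 : ∀ P ∈ S, eval P f = 0) (hSb : ∀ P ∈ S, ∀ i, |P i| ≤ b)
    (hcard : d * (2 * d) < S.card) (m) :
    ((|f.coeff m| : ℤ) : ℝ) ≤ 2 ^ (d * (2*d+1)) * ((2*d*(2*d+1) + 1) * (3 * Tri (2*d) * b ^ (2*d)) ^ 3) := by
  classical
  set fq := map (Int.castRingHom ℚ) f with hfq
  have hinjZ : Function.Injective (Int.castRingHom ℚ) := Int.cast_injective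
  have hdeg : fq.totalDegree = d := by
    rw [← hfd, hfq]; unfold totalDegree; rw [support_map_of_injective f hinjZ]
  set ι : (Fin 2 → ℤ) → (Fin 2 → ℚ) := fun P i => (P i : ℚ) with hι
  have hιinj : Function.Injective ι := by
    intro P Q h
    ext i
    have := congrFun h i
    simpa [hι] using this
  have hev : ∀ P (g : MvPolynomial (Fin 2) ℤ), eval (ι P) (map (Int.castRingHom ℚ) g) = ((eval P g : ℤ) : ℚ) :=
    fun P g => eval_map_apply_aux P g
  obtain ⟨T, hTS, hTc, hT⟩ := det_points (f := fq) hirr.ne_zero hdeg (S.image ι) (by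
    intro P hP
    obtain ⟨Q, hQ, rfl⟩ := Finset.mem_image.1 hP
    rw [hfq, hev, hS0 Q hQ, Int.cast_zero])
  obtain ⟨T', hT'S, rfl⟩ := Finset.subset_image_iff.1 hTS
  rw [Finset.card_image_of_injective _ hιinj] at hTc
  have hTri1 := Tri_two d
  have hTri2 := Tri_two (2*d)
  obtain ⟨g, hg0, hgd, hgH, hgT⟩ := small_multiple (d := d) (H := (3 * Tri (2*d) * b^(2*d))^3) hb T'
    (fun P hP => hSb P (hT'S hP)) (count_ineq (t := Tri d) _ rfl (by nlinarith) (Nat.one_le_pow _ _ hb) rfl hTc (by nlinarith))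
  have hgS : ∀ P ∈ S.image ι, eval P (map (Int.castRingHom ℚ) g) = 0 := by
    apply hT
    · refine le_trans ?_ hgd
      unfold totalDegree; rw [support_map_of_injective g hinjZ]
    · intro P hP
      obtain ⟨Q, hQ, rfl⟩ := Finset.mem_image.1 hP
      rw [hev, hgT Q hQ, Int.cast_zero]
  have hdvd : fq ∣ map (Int.castRingHom ℚ) g := by
    by_contra hnd
    have := bezout_points hirr.prime hnd (e := 2*d) (by
      refine le_trans ?_ hgd
      unfold totalDegree; rw [support_map_of_injective g hinjZ]) (S.image ι) (by
        intro P hP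
        obtain ⟨Q, hQ, rfl⟩ := Finset.mem_image.1 hP
        rw [hfq, hev, hS0 Q hQ, Int.cast_zero]) hgS
    rw [Finset.card_image_of_injective _ hιinj, hdeg] at this
    omega
  have := mignotte (b := b) hfd.le hf hg0 hgd hdvd hgH m
  refine this.trans (le_of_eq ?_)
  push_cast
  rfl

/-! Part F -/

open MvPolynomial

theorem choose_two_le_sum (s : Finset ℕ) : (s.card).choose 2 ≤ ∑ i ∈ s, i := by
  classical
  induction s using Finset.induction_on_max with
  | empty => simp
  | insert a s h ih =>
    have ha : a ∉ s := fun h2 => lt_irrefl _ (h a h2)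
    rw [Finset.card_insert_of_notMem ha, Finset.sum_insert ha, Nat.choose_succ_succ' s.card 1, Nat.choose_one_right]
    have : s.card ≤ a := by
      have : s ⊆ Finset.range a := fun x hx => Finset.mem_range.2 (h x hx)
      simpa using Finset.card_le_card this
    simpa using add_le_add this ih

theorem det_modEq {ι : Type*} [Fintype ι] [DecidableEq ι] {q : ℤ} {M N : Matrix ι ι ℤ}
    (h : ∀ i j, q ∣ M i j - N i j) : q ∣ M.det - N.det := by
  have h1 : (Ideal.Quotient.mk (Ideal.span {q})) M.det = (Ideal.Quotient.mk (Ideal.span {q})) N.det := by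
    rw [RingHom.map_det, RingHom.map_det]
    congr 1
    ext i j
    simp only [RingHom.mapMatrix_apply, Matrix.map_apply]
    rw [Ideal.Quotient.eq, Ideal.mem_span_singleton]
    exact h i j
  rwa [Ideal.Quotient.eq, Ideal.mem_span_singleton] at h1

theorem det_dvd {ι κ : Type*} [Fintype ι] [DecidableEq ι] [DecidableEq κ] (M : Matrix ι ι ℤ) (p : ℤ)
    (Z : Finset κ) (c : ι → κ) (K : ℕ) (t : ι → ℤ) (v : κ → ℕ → ι → ℤ)
    (h : ∀ i, c i ∈ Z → ∀ j, p ^ K ∣ M i j - ∑ l ∈ Finset.range K, (p * t i) ^ l * v (c i) l j)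
    (hK : ∑ z ∈ Z, ((Finset.univ.filter fun i => c i = z).card).choose 2 ≤ K) :
    p ^ (∑ z ∈ Z, ((Finset.univ.filter fun i => c i = z).card).choose 2) ∣ M.det := by
  classical
  set A : ι → Finset ℕ := fun i => if c i ∈ Z then Finset.range K else {0} with hA
  set w : ι → ℕ → ι → ℤ := fun i l j => if c i ∈ Z then (p * t i) ^ l * v (c i) l j else M i j with hw
  set N : Matrix ι ι ℤ := Matrix.of fun i j => ∑ l ∈ A i, w i l j with hN
  have h1 : p ^ K ∣ M.det - N.det := by
    apply det_modEq
    intro i j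
    by_cases hi : c i ∈ Z
    · have := h i hi j
      simpa [hN, hA, hw, hi] using this
    · simp [hN, hA, hw, hi]
  suffices h2 : p ^ (∑ z ∈ Z, ((Finset.univ.filter fun i => c i = z).card).choose 2) ∣ N.det by
    have := dvd_add ((pow_dvd_pow p hK).trans h1) h2
    rwa [sub_add_cancel] at this
  have h3 : N.det = ∑ r ∈ Fintype.piFinset A, Matrix.det (Matrix.of fun i j => w i (r i) j) := by
    have := MultilinearMap.map_sum_finset (Matrix.detRowAlternating (n := ι) (R := ℤ)).toMultilinearMap
      w A
    refine Eq.trans ?_ this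
    have e : N = Matrix.of (fun i => ∑ l ∈ A i, w i l) := by
      ext i j
      simp [hN, Finset.sum_apply]
    rw [e]
    rfl
  rw [h3]
  apply Finset.dvd_sum
  intro r _
  have h4 : Matrix.det (Matrix.of fun i j => w i (r i) j) =
      (∏ i, if c i ∈ Z then (p * t i) ^ (r i) else 1) *
        Matrix.det (Matrix.of fun i j => if c i ∈ Z then v (c i) (r i) j else M i j) := by
    rw [← Matrix.det_mul_column]
    congr 1
    ext i j
    by_cases hi : c i ∈ Z <;> simp [hi, hw]
  rw [h4]
  by_cases hinj : ∀ i i', c i ∈ Z → c i = c i' → r i = r i' → i = i'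
  · apply Dvd.dvd.mul_right
    rw [← Finset.prod_filter]
    simp only [mul_pow]
    rw [Finset.prod_mul_distrib]
    apply Dvd.dvd.mul_right
    rw [Finset.prod_pow_eq_pow_sum]
    apply pow_dvd_pow
    rw [← Finset.sum_fiberwise_of_maps_to (g := c) (t := Z) (by simp)]
    apply Finset.sum_le_sum
    intro z hz
    have hi2 : Set.InjOn r (Finset.univ.filter fun i => c i = z) := by
      intro i hi i' hi' e
      simp at hi hi'
      exact hinj i i' (hi ▸ hz) (hi.trans hi'.symm) e
    have h5 := choose_two_le_sum ((Finset.univ.filter fun i => c i = z).image r)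
    rw [Finset.card_image_of_injOn hi2, Finset.sum_image hi2] at h5
    refine h5.trans (le_of_eq ?_)
    apply Finset.sum_congr _ fun _ _ => rfl
    ext i
    simp only [Finset.mem_filter, Finset.mem_univ, true_and]
    constructor
    · intro e; exact ⟨e ▸ hz, e⟩
    · exact fun e => e.2
  · push Not at hinj
    obtain ⟨i, i', hi, hc, hr, hne⟩ := hinj
    rw [Matrix.det_zero_of_row_eq hne, mul_zero]
    · exact dvd_zero _
    · ext j; simp only [Matrix.of_apply, hi, ← hc, hr, if_true]

theorem peval (a : ℤ) (X Y : Polynomial ℤ) (f : MvPolynomial (Fin 2) ℤ) :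
    Polynomial.eval a (aeval ![X, Y] f) = eval ![X.eval a, Y.eval a] f := by
  induction f using MvPolynomial.induction_on with
  | C a => simp
  | add p q hp hq => simp [hp, hq]
  | mul_X p i hp =>
    simp only [map_mul, Polynomial.eval_mul, hp, aeval_X, eval_X]
    fin_cases i <;> simp

theorem eval_congr_mod {q : ℤ} {P Q : Fin 2 → ℤ} (h : ∀ i, q ∣ P i - Q i) (f : MvPolynomial (Fin 2) ℤ) :
    q ∣ eval P f - eval Q f := by
  induction f using MvPolynomial.induction_on with
  | C a => simp
  | add a b ha hb =>
    rw [map_add, map_add, add_sub_add_comm]; exact dvd_add ha hb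
  | mul_X a i ha =>
    simp only [map_mul, eval_X]
    have : eval P a * P i - eval Q a * Q i = (eval P a - eval Q a) * P i + eval Q a * (P i - Q i) := by ring
    rw [this]
    exact dvd_add (ha.mul_right _) ((h i).mul_left _)

theorem vec2_mod {q a b a' b' : ℤ} (h0 : q ∣ a - a') (h1 : q ∣ b - b') : ∀ i, q ∣ (![a, b] : Fin 2 → ℤ) i - (![a', b'] : Fin 2 → ℤ) i := by
  intro i; fin_cases i
  · simpa using h0
  · simpa using h1

theorem hensel_poly {p : ℤ} (f : MvPolynomial (Fin 2) ℤ) (x0 y0 b : ℤ)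
    (hb : p ∣ 1 - b * eval ![x0, y0] (pderiv 1 f)) (k : ℕ) :
    ∃ Y : Polynomial ℤ, ∀ x y t : ℤ, x = x0 + p * t → p ∣ y - y0 → eval ![x, y] f = 0 →
      p ^ (k+1) ∣ y - Y.eval (p * t) := by
  induction k with
  | zero => exact ⟨Polynomial.C y0, by intro x y t h1 h2 h3; simpa using h2⟩
  | succ k ih =>
    obtain ⟨Y, hY⟩ := ih
    refine ⟨Y - Polynomial.C b * aeval ![Polynomial.C x0 + Polynomial.X, Y] f, ?_⟩
    intro x y t h1 h2 h3
    have h4 := hY x y t h1 h2 h3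
    rw [Polynomial.eval_sub, Polynomial.eval_mul, Polynomial.eval_C, peval]
    simp only [Polynomial.eval_add, Polynomial.eval_C, Polynomial.eval_X, ← h1]
    set Y0 := Y.eval (p * t) with hY0
    obtain ⟨r, hr⟩ := taylor_y x y (Y0 - y) f
    rw [add_sub_cancel] at hr
    simp only [aeval_eq_eval, RingHom.coe_coe] at hr
    have hr' : eval ![x, Y0] f = eval ![x, y] f + eval ![x, y] (pderiv 1 f) * (Y0 - y) + r * (Y0 - y) ^ 2 := hr
    rw [hr', h3]
    have h5 := eval_congr_mod (vec2_mod (q := p) (a := x) (a' := x0) (by rw [h1]; simp) h2) (pderiv 1 f)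
    set F := eval ![x, y] (pderiv 1 f)
    set F0 := eval ![x0, y0] (pderiv 1 f)
    have h6 : p ∣ 1 - b * F := by
      have : 1 - b * F = (1 - b * F0) - b * (F - F0) := by ring
      rw [this]; exact dvd_sub hb (h5.mul_left _)
    have e : y - (Y0 - b * (0 + F * (Y0 - y) + r * (Y0 - y)^2)) = (y - Y0) * (1 - b * F) + b * r * (y - Y0) ^ 2 := by ring
    rw [e]
    apply dvd_add
    · rw [pow_succ]; exact mul_dvd_mul h4 h6
    · apply Dvd.dvd.mul_left
      exact (pow_dvd_pow p (by omega : k+1+1 ≤ (k+1)*2)).trans (by rw [pow_mul]; exact pow_dvd_pow_of_dvd h4 2)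

theorem poly_trunc (p t : ℤ) (K : ℕ) (F : Polynomial ℤ) :
    p ^ K ∣ F.eval (p * t) - ∑ l ∈ Finset.range K, (p * t) ^ l * F.coeff l := by
  rw [Polynomial.eval_eq_sum_range' (n := K + (F.natDegree + 1)) (by omega), Finset.sum_range_add]
  have : ∑ l ∈ Finset.range K, (p * t) ^ l * F.coeff l = ∑ l ∈ Finset.range K, F.coeff l * (p * t) ^ l :=
    Finset.sum_congr rfl fun _ _ => mul_comm _ _
  rw [this, add_sub_cancel_left]
  apply Finset.dvd_sum
  intro i _
  apply Dvd.dvd.mul_left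
  rw [mul_pow, pow_add, mul_assoc]
  exact dvd_mul_right _ _

theorem det_dvd_p {ι : Type*} [Fintype ι] [DecidableEq ι] {p : ℕ} [Fact p.Prime] (f : MvPolynomial (Fin 2) ℤ)
    (g : ι → MvPolynomial (Fin 2) ℤ) (P : ι → Fin 2 → ℤ) (hP : ∀ i, eval (P i) f = 0)
    (Z : Finset (Fin 2 → ZMod p))
    (hZ : ∀ z ∈ Z, eval z (pderiv 1 (map (Int.castRingHom (ZMod p)) f)) ≠ 0) :
    (p : ℤ) ^ (∑ z ∈ Z, ((Finset.univ.filter fun i => (fun k => (P i k : ZMod p)) = z).card).choose 2) ∣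
      Matrix.det (Matrix.of fun i j => eval (P i) (g j)) := by
  classical
  set K := ∑ z ∈ Z, ((Finset.univ.filter fun i => (fun k => (P i k : ZMod p)) = z).card).choose 2 with hK
  have hex : ∀ z : Fin 2 → ZMod p, ∃ Y : Polynomial ℤ, z ∈ Z → ∀ x y t : ℤ, x = (z 0).val + p * t →
      (p : ℤ) ∣ y - (z 1).val → eval ![x, y] f = 0 → (p : ℤ) ^ (K+1) ∣ y - Y.eval (p * t) := by
    intro z
    by_cases hz : z ∈ Z
    · have h1 := hZ z hz
      have hz2 : z = fun i => (((![((z 0).val : ℤ), ((z 1).val : ℤ)] : Fin 2 → ℤ) i : ℤ) : ZMod p) := by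
        ext i; fin_cases i <;> simp
      rw [pderiv_map] at h1
      set F0 := eval ![((z 0).val : ℤ), ((z 1).val : ℤ)] (pderiv 1 f) with hF0
      have h2 : ((F0 : ℤ) : ZMod p) ≠ 0 := by
        rw [hF0, ← eval_map_apply_aux, ← hz2]; exact h1
      obtain ⟨Y, hY⟩ := hensel_poly (p := p) f (z 0).val (z 1).val ((F0 : ZMod p)⁻¹.val) (by
        rw [← ZMod.intCast_zmod_eq_zero_iff_dvd, ← hF0]
        push_cast
        rw [ZMod.natCast_zmod_val, inv_mul_cancel₀ h2, sub_self]) K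
      exact ⟨Y, fun _ => hY⟩
    · exact ⟨0, fun h => absurd h hz⟩
  choose Y hY using hex
  have hdiv : ∀ i k, (p : ℤ) ∣ P i k - ((P i k : ZMod p)).val := by
    intro i k
    rw [← ZMod.intCast_zmod_eq_zero_iff_dvd]
    push_cast
    rw [ZMod.natCast_zmod_val, sub_self]
  choose t ht using fun i => hdiv i 0
  refine det_dvd _ p Z (fun i => (fun k => (P i k : ZMod p))) K t
    (fun z l j => (aeval ![Polynomial.C (((z 0).val : ℕ) : ℤ) + Polynomial.X, Y z] (g j)).coeff l) ?_ le_rfl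
  intro i hi j
  set z : Fin 2 → ZMod p := fun k => (P i k : ZMod p) with hz
  have hPi : ![P i 0, P i 1] = P i := by ext k; fin_cases k <;> rfl
  have h1 := hY z hi (P i 0) (P i 1) (t i) (by rw [← ht i]; simp [hz]) (hdiv i 1) (by rw [hPi]; exact hP i)
  have h2 := poly_trunc p (t i) K (aeval ![Polynomial.C (((z 0).val : ℕ) : ℤ) + Polynomial.X, Y z] (g j))
  rw [peval] at h2
  simp only [Polynomial.eval_add, Polynomial.eval_C, Polynomial.eval_X] at h2
  have h3 := eval_congr_mod (vec2_mod (q := (p:ℤ)^K) (a := P i 0) (a' := (((z 0).val : ℕ) : ℤ) + p * t i)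
    (by rw [← ht i]; simp [hz]) ((pow_dvd_pow _ (by omega)).trans h1)) (g j)
  rw [hPi] at h3
  have := dvd_add h3 h2
  rw [sub_add_sub_cancel] at this
  exact this

/-! Part G -/

theorem log_fact_lower (n : ℕ) (hn : 1 ≤ n) : n * Real.log n - n ≤ Real.log n.factorial := by
  have h := Real.pow_div_factorial_le_exp (x := (n:ℝ)) (by positivity) n
  have hn' : (0:ℝ) < n := by exact_mod_cast hn
  have hf : (0:ℝ) < n.factorial := by exact_mod_cast n.factorial_pos
  have := Real.log_le_log (by positivity) h
  rw [Real.log_exp, Real.log_div (by positivity) (by positivity), Real.log_pow] at this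
  linarith

theorem log_fact_upper (n : ℕ) : Real.log n.factorial ≤ n * Real.log n := by
  have hf : (0:ℝ) < n.factorial := by exact_mod_cast n.factorial_pos
  have h : ((n.factorial : ℕ) : ℝ) ≤ (n:ℝ)^n := by exact_mod_cast n.factorial_le_pow
  have := Real.log_le_log hf h
  rwa [Real.log_pow] at this

theorem log_fact_eq (n : ℕ) : Real.log n.factorial =
    ∑ p ∈ n.primesLE, (n.factorial.factorization p : ℝ) * Real.log p := by
  have h := Nat.prod_factorization_pow_eq_self n.factorial_ne_zero
  have hsub : n.factorial.factorization.support ⊆ n.primesLE := by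
    intro p hp
    rw [Nat.support_factorization, Nat.mem_primeFactors] at hp
    rw [Nat.mem_primesLE]
    exact ⟨(hp.1.dvd_factorial).1 hp.2.1, hp.1⟩
  rw [Finsupp.prod_of_support_subset _ hsub _ (by simp)] at h
  conv_lhs => rw [← h]
  push_cast
  rw [Real.log_prod]
  · refine Finset.sum_congr rfl fun p hp => ?_
    rw [Real.log_pow]
  · intro p hp
    have := (Nat.mem_primesLE.1 hp).2.pos
    positivity

theorem log_le_two_sqrt (k : ℕ) (hk : 1 ≤ k) : Real.log ((k:ℝ)+1) ≤ 2 * Real.sqrt k := by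
  have hk' : (1:ℝ) ≤ k := by exact_mod_cast hk
  have h0 : (0:ℝ) < (k:ℝ)+1 := by linarith
  have h1 : Real.log ((k:ℝ)+1) = 2 * Real.log (Real.sqrt ((k:ℝ)+1)) := by
    rw [Real.log_sqrt h0.le]; ring
  have h2 := Real.log_le_sub_one_of_pos (Real.sqrt_pos.2 h0)
  have h3 : Real.sqrt ((k:ℝ)+1) ≤ Real.sqrt k + 1 := by
    rw [Real.sqrt_le_left (by positivity)]
    nlinarith [Real.sq_sqrt (show (0:ℝ) ≤ k by linarith), Real.sqrt_nonneg (k:ℝ)]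
  rw [h1]; linarith

theorem tele_term (k : ℕ) (hk : 1 ≤ k) : Real.log ((k:ℝ)+1) / (((k:ℝ)+1) * k) ≤
    4 * (1 / Real.sqrt k - 1 / Real.sqrt ((k:ℝ)+1)) := by
  have hk' : (1:ℝ) ≤ k := by exact_mod_cast hk
  set a := Real.sqrt k with ha
  set c := Real.sqrt ((k:ℝ)+1) with hc
  have hap : 0 < a := Real.sqrt_pos.2 (by linarith)
  have hcp : 0 < c := Real.sqrt_pos.2 (by linarith)
  have ha2 : a^2 = k := Real.sq_sqrt (by linarith)
  have hc2 : c^2 = k+1 := Real.sq_sqrt (by linarith)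
  have hac : a ≤ c := Real.sqrt_le_sqrt (by linarith)
  have hl := log_le_two_sqrt k hk
  have e1 : Real.log ((k:ℝ)+1) / (((k:ℝ)+1) * k) ≤ 2 * a / (c^2 * a^2) := by
    rw [hc2, ha2]; gcongr
  refine e1.trans ?_
  have e2 : 4 * (1 / a - 1 / c) = 4 * (c - a) / (a * c) := by field_simp
  rw [e2, div_le_div_iff₀ (by positivity) (by positivity)]
  have e3 : (c - a) * (c + a) = 1 := by nlinarith
  have e4 : 1 ≤ (c - a) * (2 * c) := by nlinarith
  have e5 : 0 ≤ a^2 * c * 2 := by positivity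
  nlinarith [mul_le_mul_of_nonneg_left e4 e5]

theorem tele_sum (n : ℕ) : ∑ k ∈ Finset.range n, Real.log ((k:ℝ)+1) / (((k:ℝ)+1) * k) ≤
    4 * (1 - (if n = 0 then 1 else 0)) := by
  have : ∀ n : ℕ, ∑ k ∈ Finset.range (n+1), Real.log ((k:ℝ)+1) / (((k:ℝ)+1) * k) ≤
    4 * (1 - (1 / Real.sqrt ((n:ℝ)+1))) := by
    intro n
    induction n with
    | zero => simp
    | succ n ih =>
      rw [Finset.sum_range_succ]
      have := tele_term (n+1) (by omega)
      push_cast at this ih ⊢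
      linarith
  rcases n with _ | n
  · simp
  · refine (this n).trans ?_
    simp

theorem mertens_lower (n : ℕ) (hn : 1 ≤ n) : Real.log n - 5 ≤ ∑ p ∈ n.primesLE, Real.log p / p := by
  have hn' : (0:ℝ) < n := by exact_mod_cast hn
  have h1 := log_fact_lower n hn
  rw [log_fact_eq] at h1
  have h2 : ∀ p ∈ n.primesLE, (n.factorial.factorization p : ℝ) * Real.log p ≤
      n * (Real.log p / p) + n * (Real.log p / (p * (p-1))) := by
    intro p hp
    have hpp := (Nat.mem_primesLE.1 hp).2
    have hp2 : (2:ℝ) ≤ p := by exact_mod_cast hpp.two_le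
    have hv : (n.factorial.factorization p : ℝ) ≤ n / (p - 1) := by
      have := Nat.factorization_factorial_le_div_pred hpp n
      have h3 : ((n / (p-1) : ℕ) : ℝ) ≤ (n:ℝ) / ((p-1 : ℕ) : ℝ) := Nat.cast_div_le
      rw [Nat.cast_sub hpp.one_le, Nat.cast_one] at h3
      exact le_trans (by exact_mod_cast this) h3
    have hlog : 0 ≤ Real.log p := Real.log_nonneg (by linarith)
    have hp1 : (p:ℝ) - 1 ≠ 0 := by linarith
    have hp0 : (p:ℝ) ≠ 0 := by linarith
    calc _ ≤ (n:ℝ) / (p-1) * Real.log p := mul_le_mul_of_nonneg_right hv hlog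
      _ = _ := by field_simp; ring
  have h3 := h1.trans (Finset.sum_le_sum h2)
  rw [Finset.sum_add_distrib, ← Finset.mul_sum, ← Finset.mul_sum] at h3
  have h4 : ∑ p ∈ n.primesLE, Real.log p / ((p:ℝ) * (p-1)) ≤ 4 := by
    have := tele_sum n
    have h5 : ∑ p ∈ n.primesLE, Real.log p / ((p:ℝ) * (p-1)) ≤
        ∑ k ∈ Finset.range n, Real.log ((k:ℝ)+1) / (((k:ℝ)+1) * k) := by
      rw [show ∑ k ∈ Finset.range n, Real.log ((k:ℝ)+1) / (((k:ℝ)+1) * k)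
        = ∑ p ∈ Finset.Ico 1 (n+1), Real.log p / ((p:ℝ) * (p-1)) by
          rw [Finset.sum_Ico_eq_sum_range]
          refine Finset.sum_congr (by simp) fun k _ => ?_
          push_cast
          rw [add_comm (1:ℝ)]; simp]
      apply Finset.sum_le_sum_of_subset_of_nonneg
      · intro p hp
        have := Nat.mem_primesLE.1 hp
        have := this.2.one_le
        rw [Finset.mem_Ico]; omega
      · intro p hp _
        have : (1:ℝ) ≤ p := by exact_mod_cast (Finset.mem_Ico.1 hp).1
        have := Real.log_nonneg this
        have : (0:ℝ) ≤ (p:ℝ) - 1 := by linarith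
        positivity
    refine h5.trans (this.trans ?_)
    rw [if_neg (by omega)]; norm_num
  have h6 : n * (Real.log n - 1) ≤ n * ((∑ p ∈ n.primesLE, Real.log p / p) + 4) := by
    nlinarith [mul_le_mul_of_nonneg_left h4 hn'.le]
  have := le_of_mul_le_mul_left h6 hn'
  linarith

theorem mertens_upper (n : ℕ) (hn : 1 ≤ n) : ∑ p ∈ n.primesLE, Real.log p / p ≤ Real.log n + Real.log 4 := by
  have hn' : (0:ℝ) < n := by exact_mod_cast hn
  have h1 := log_fact_upper n
  rw [log_fact_eq] at h1
  have h2 : ∀ p ∈ n.primesLE, n * (Real.log p / p) - Real.log p ≤ (n.factorial.factorization p : ℝ) * Real.log p := by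
    intro p hp
    obtain ⟨hpn, hpp⟩ := (Nat.mem_primesLE.1 hp)
    have hp2 : (2:ℝ) ≤ p := by exact_mod_cast hpp.two_le
    have hlog : 0 ≤ Real.log p := Real.log_nonneg (by linarith)
    have hv : (n:ℝ) / p - 1 ≤ (n.factorial.factorization p : ℝ) := by
      have h3 : n / p ≤ n.factorial.factorization p := by
        rw [Nat.factorization_factorial hpp (Nat.lt_succ_self _)]
        have := Finset.single_le_sum (f := fun i => n / p^i) (s := Finset.Ico 1 (Nat.log p n).succ) (fun i _ => Nat.zero_le _)
          (show 1 ∈ _ by rw [Finset.mem_Ico]; have := Nat.log_pos hpp.one_lt hpn; omega)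
        simpa using this
      have h4 : (n:ℝ)/p - 1 ≤ ((n/p : ℕ) : ℝ) := by
        have := Nat.lt_floor_add_one ((n:ℝ)/p)
        rw [Nat.floor_div_eq_div] at this
        linarith
      exact h4.trans (by exact_mod_cast h3)
    calc _ = ((n:ℝ)/p - 1) * Real.log p := by field_simp
      _ ≤ _ := mul_le_mul_of_nonneg_right hv hlog
  have h3 := (Finset.sum_le_sum h2).trans h1
  rw [Finset.sum_sub_distrib, ← Finset.mul_sum, ← Chebyshev.theta_eq_sum_primesLE_log] at h3
  have h4 := Chebyshev.theta_le_log4_mul_x hn'.le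
  have h6 : n * (∑ p ∈ n.primesLE, Real.log p / p) ≤ n * (Real.log n + Real.log 4) := by linarith
  exact le_of_mul_le_mul_left h6 hn'

/-- primes in `(Y, X]` -/
def prI (Y X : ℕ) : Finset ℕ := X.primesLE.filter (fun p => Y < p)

theorem mem_prI {Y X p : ℕ} : p ∈ prI Y X ↔ p.Prime ∧ Y < p ∧ p ≤ X := by
  unfold prI
  rw [Finset.mem_filter, Nat.mem_primesLE]; tauto

theorem prI_log_nonneg {Y X p : ℕ} (hp : p ∈ prI Y X) : 0 ≤ Real.log p :=
  Real.log_natCast_nonneg p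

theorem log4_le : Real.log 4 ≤ 1.4 := by
  have : Real.log 4 = 2 * Real.log 2 := by
    rw [show (4:ℝ) = 2^2 by norm_num, Real.log_pow]; norm_num
  have := Real.log_two_lt_d9
  linarith

theorem prI_mertens {Y X : ℕ} (hY : 1 ≤ Y) (hX : Y ≤ X) :
    Real.log X - Real.log Y - 7 ≤ ∑ p ∈ prI Y X, Real.log p / p := by
  have h1 := mertens_lower X (by omega)
  have h2 := mertens_upper Y hY
  have h3 := Finset.sum_filter_add_sum_filter_not X.primesLE (fun p => Y < p) (fun p => Real.log p / (p:ℝ))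
  have h4 : X.primesLE.filter (fun p => ¬ Y < p) = Y.primesLE := by
    ext p; simp only [Finset.mem_filter, Nat.mem_primesLE]
    constructor
    · rintro ⟨⟨a, b⟩, c⟩; exact ⟨by omega, b⟩
    · rintro ⟨a, b⟩; exact ⟨⟨by omega, b⟩, by omega⟩
  rw [h4] at h3
  have := log4_le
  unfold prI
  linarith

theorem prI_theta (Y X : ℕ) : ∑ p ∈ prI Y X, Real.log p ≤ 1.4 * X := by
  have h1 := Chebyshev.theta_le_log4_mul_x (x := (X:ℝ)) (by positivity)
  rw [Chebyshev.theta_eq_sum_primesLE_log] at h1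
  have h2 : ∑ p ∈ prI Y X, Real.log p ≤ ∑ p ∈ X.primesLE, Real.log p :=
    Finset.sum_le_sum_of_subset_of_nonneg (Finset.filter_subset _ _) (fun p _ _ => Real.log_natCast_nonneg p)
  have := log4_le
  have hX : (0:ℝ) ≤ X := by positivity
  nlinarith

theorem prI_step (Y : ℕ) (hY : 1 ≤ Y) : ∑ p ∈ prI Y (2*Y), Real.log p / (p * Real.sqrt p) ≤
    10 * (1 / Real.sqrt Y - 1 / Real.sqrt ((2*Y : ℕ):ℝ)) := by
  have hY' : (1:ℝ) ≤ Y := by exact_mod_cast hY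
  have h1 := prI_theta Y (2*Y)
  have hs : 0 < Real.sqrt Y := Real.sqrt_pos.2 (by linarith)
  have h2 : ∑ p ∈ prI Y (2*Y), Real.log p / (p * Real.sqrt p) ≤ ∑ p ∈ prI Y (2*Y), Real.log p / (Y * Real.sqrt Y) := by
    refine Finset.sum_le_sum fun p hp => ?_
    have h3 : (Y:ℝ) ≤ p := by exact_mod_cast (mem_prI.1 hp).2.1.le
    have := Real.sqrt_le_sqrt h3
    have := prI_log_nonneg hp
    gcongr
  refine h2.trans ?_
  rw [← Finset.sum_div]
  push_cast at h1 ⊢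
  have h4 : (∑ p ∈ prI Y (2*Y), Real.log p) / (Y * Real.sqrt Y) ≤ (1.4 * (2 * Y)) / (Y * Real.sqrt Y) := by gcongr
  refine h4.trans ?_
  have h5 : Real.sqrt (2 * Y) = Real.sqrt 2 * Real.sqrt Y := Real.sqrt_mul (by norm_num) _
  rw [h5]
  have hr : (1.4:ℝ) ≤ Real.sqrt 2 := Real.le_sqrt_of_sq_le (by norm_num)
  have h6 : 1 / (Real.sqrt 2 * Real.sqrt Y) ≤ 1 / (1.4 * Real.sqrt Y) := by gcongr
  have h7 : (1.4 * (2 * (Y:ℝ))) / (Y * Real.sqrt Y) = 2.8 * (1 / Real.sqrt Y) := by field_simp; norm_num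
  have h8 : 1 / (1.4 * Real.sqrt Y) = (1/1.4) * (1 / Real.sqrt Y) := by field_simp
  have : 0 < 1 / Real.sqrt Y := by positivity
  rw [h7]; rw [h8] at h6
  nlinarith

theorem prI_dyadic (Y : ℕ) (hY : 1 ≤ Y) (j : ℕ) : ∑ p ∈ prI Y (2^j*Y), Real.log p / (p * Real.sqrt p) ≤
    10 * (1 / Real.sqrt Y - 1 / Real.sqrt ((2^j*Y : ℕ):ℝ)) := by
  induction j with
  | zero =>
    have : prI Y (2^0*Y) = ∅ := by
      ext p; rw [mem_prI]; simp; try omega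
    rw [this]; simp
  | succ j ih =>
    have h := prI_step (2^j*Y) (Nat.mul_pos (by positivity) hY)
    rw [show 2 * (2^j*Y) = 2^(j+1)*Y by ring] at h
    have hsub : prI Y (2^(j+1)*Y) ⊆ prI Y (2^j*Y) ∪ prI (2^j*Y) (2^(j+1)*Y) := by
      intro p
      rw [Finset.mem_union, mem_prI, mem_prI, mem_prI]
      rintro ⟨a, b, c⟩
      by_cases h : p ≤ 2^j*Y
      · exact Or.inl ⟨a, b, h⟩
      · exact Or.inr ⟨a, by omega, c⟩
    have hnn : ∀ p : ℕ, 0 ≤ Real.log p / (p * Real.sqrt p) := fun p => by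
      have := Real.log_natCast_nonneg p
      positivity
    have h1 := Finset.sum_le_sum_of_subset_of_nonneg hsub (fun p _ _ => hnn p)
    have h2 := Finset.sum_union_inter (s₁ := prI Y (2^j*Y)) (s₂ := prI (2^j*Y) (2^(j+1)*Y)) (f := fun p : ℕ => Real.log p / (p * Real.sqrt p))
    have h3 : 0 ≤ ∑ p ∈ prI Y (2^j*Y) ∩ prI (2^j*Y) (2^(j+1)*Y), Real.log p / ((p:ℝ) * Real.sqrt p) :=
      Finset.sum_nonneg fun p _ => hnn p
    linarith

theorem prI_tail (Y X : ℕ) (hY : 1 ≤ Y) : ∑ p ∈ prI Y X, Real.log p / (p * Real.sqrt p) ≤ 10 / Real.sqrt Y := by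
  have hsub : prI Y X ⊆ prI Y (2^X*Y) := by
    intro p
    rw [mem_prI, mem_prI]
    rintro ⟨a, b, c⟩
    refine ⟨a, b, ?_⟩
    have : X < 2^X := Nat.lt_two_pow_self
    nlinarith
  have hnn : ∀ p : ℕ, 0 ≤ Real.log p / (p * Real.sqrt p) := fun p => by
    have := Real.log_natCast_nonneg p
    positivity
  have h1 := Finset.sum_le_sum_of_subset_of_nonneg hsub (fun p _ _ => hnn p)
  have h2 := prI_dyadic Y hY X
  have h3 : 0 ≤ 1 / Real.sqrt ((2^X*Y : ℕ):ℝ) := by positivity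
  have : 10 / Real.sqrt Y = 10 * (1 / Real.sqrt Y) := by ring
  linarith

/-- primes dividing a nonzero integer -/
theorem sum_log_dvd (Q : Finset ℕ) (hQ : ∀ p ∈ Q, p.Prime) (G : ℤ) (hG : G ≠ 0) (hd : ∀ p ∈ Q, (p:ℤ) ∣ G) :
    ∑ p ∈ Q, Real.log p ≤ Real.log ((|G| : ℤ) : ℝ) := by
  have h1 : (∏ p ∈ Q, p) ∣ G.natAbs := by
    apply Finset.prod_primes_dvd _ (fun p hp => (hQ p hp).prime)
    intro p hp
    exact Int.natCast_dvd.1 (hd p hp)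
  have h2 := Nat.le_of_dvd (Int.natAbs_pos.2 hG) h1
  rw [← Real.log_prod (fun p hp => by have := (hQ p hp).pos; positivity)]
  apply Real.log_le_log
  · exact Finset.prod_pos fun p hp => by exact_mod_cast (hQ p hp).pos
  · rw [Int.abs_eq_natAbs, Int.cast_natCast]
    rw [← Nat.cast_prod]
    exact_mod_cast h2

theorem sum_log_dvd_pow (Q : Finset ℕ) (hQ : ∀ p ∈ Q, p.Prime) (e : ℕ → ℕ) (G : ℤ) (hG : G ≠ 0)
    (hd : ∀ p ∈ Q, (p:ℤ)^(e p) ∣ G) :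
    ∑ p ∈ Q, e p * Real.log p ≤ Real.log ((|G| : ℤ) : ℝ) := by
  have h1 : (∏ p ∈ Q, p ^ e p) ∣ G.natAbs := by
    apply Finset.prod_dvd_of_isRelPrime
    · intro p hp q hq hpq
      rw [Function.onFun, ← Nat.coprime_iff_isRelPrime]
      exact Nat.Coprime.pow _ _ ((Nat.coprime_primes (hQ p hp) (hQ q hq)).2 hpq)
    intro p hp
    have := hd p hp
    rw [← Nat.cast_pow] at this
    exact Int.natCast_dvd.1 this
  have h2 := Nat.le_of_dvd (Int.natAbs_pos.2 hG) h1
  have h3 : ∑ p ∈ Q, e p * Real.log p = ∑ p ∈ Q, Real.log ((p:ℝ) ^ e p) :=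
    Finset.sum_congr rfl fun p _ => by rw [Real.log_pow]
  rw [h3, ← Real.log_prod (fun p hp => by have := (hQ p hp).pos; positivity)]
  apply Real.log_le_log
  · exact Finset.prod_pos fun p hp => by have := (hQ p hp).pos; positivity
  · rw [Int.abs_eq_natAbs, Int.cast_natCast]
    exact_mod_cast h2

/-! Part H1 -/

open MvPolynomial

theorem exists_rows {K ι α : Type*} [Field K] [Fintype ι] [DecidableEq ι] (S : Set α) (R : α → ι → K)
    (h : ∀ c : ι → K, (∀ x ∈ S, ∑ j, R x j * c j = 0) → c = 0) :
    ∃ P : ι → α, (∀ i, P i ∈ S) ∧ Matrix.det (Matrix.of fun i j => R (P i) j) ≠ 0 := by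
  obtain ⟨b, hbS, hspan, hli⟩ := exists_linearIndependent K (Set.image R S)
  have htop : Submodule.span K (Set.image R S) = ⊤ := by
    by_contra hne
    obtain ⟨φ, hφ0, hφ⟩ := Submodule.exists_le_ker_of_lt_top _ (lt_top_iff_ne_top.2 hne)
    apply hφ0
    have := h (fun i => φ fun j => if i = j then 1 else 0) (by
      intro x hx
      have h1 : R x ∈ LinearMap.ker φ := hφ (Submodule.subset_span ⟨x, hx, rfl⟩)
      rw [LinearMap.mem_ker, LinearMap.pi_apply_eq_sum_univ] at h1
      simpa using h1)
    ext x
    rw [LinearMap.coe_comp, Function.comp_apply, LinearMap.pi_apply_eq_sum_univ φ]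
    have h2 := fun i => congrFun this i
    simp only [Pi.zero_apply] at h2
    simp [h2]
  rw [htop] at hspan
  let bas : Module.Basis b K (ι → K) := Module.Basis.mk hli (by rw [Subtype.range_coe]; exact hspan.ge)
  let e : ι ≃ b := (Pi.basisFun K ι).indexEquiv bas
  have : ∀ i, ∃ x ∈ S, R x = (e i : ι → K) := fun i => hbS (e i).2
  choose P hP1 hP2 using this
  refine ⟨P, hP1, ?_⟩
  have h3 : LinearIndependent K (fun i => R (P i)) := by
    have := hli.comp e e.injective
    rwa [show (Subtype.val ∘ e : ι → ι → K) = fun i => R (P i) from funext fun i => (hP2 i).symm] at this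
  have h4 := (Matrix.linearIndependent_rows_iff_isUnit (A := Matrix.of fun i j => R (P i) j)).1 h3
  exact ((Matrix.isUnit_iff_isUnit_det _).1 h4).ne_zero

theorem totalDegree_mapQ (f : MvPolynomial (Fin 2) ℤ) : (map (Int.castRingHom ℚ) f).totalDegree = f.totalDegree := by
  have hinjZ : Function.Injective (Int.castRingHom ℚ) := Int.cast_injective
  unfold totalDegree; rw [support_map_of_injective f hinjZ]

def toQ (P : Fin 2 → ℤ) : Fin 2 → ℚ := fun i => (P i : ℚ)

theorem toQ_inj : Function.Injective toQ := by
  intro P Q h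
  ext i
  have := congrFun h i
  simpa [toQ] using this

theorem bezout_int {f : MvPolynomial (Fin 2) ℤ} (hirr : Irreducible (map (Int.castRingHom ℚ) f)) {e : ℕ}
    {g : MvPolynomial (Fin 2) ℚ} (hg : ¬ map (Int.castRingHom ℚ) f ∣ g) (he : g.totalDegree ≤ e)
    (S : Finset (Fin 2 → ℤ)) (h1 : ∀ P ∈ S, eval P f = 0) (h2 : ∀ P ∈ S, eval (toQ P) g = 0) :
    S.card ≤ f.totalDegree * e := by
  classical
  have := bezout_points hirr.prime hg he (S.image toQ) (by
    intro P hP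
    obtain ⟨Q, hQ, rfl⟩ := Finset.mem_image.1 hP
    unfold toQ
    rw [eval_map_apply_aux, h1 Q hQ, Int.cast_zero]) (by
    intro P hP
    obtain ⟨Q, hQ, rfl⟩ := Finset.mem_image.1 hP
    exact h2 Q hQ)
  rwa [Finset.card_image_of_injective _ toQ_inj, totalDegree_mapQ] at this

theorem exists_det {d n : ℕ} {f : MvPolynomial (Fin 2) ℤ} (hfd : f.totalDegree = d)
    (hirr : Irreducible (map (Int.castRingHom ℚ) f))
    (S : Finset (Fin 2 → ℤ)) (hS : ∀ P ∈ S, eval P f = 0) (hc : d * (d + n) < S.card) :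
    ∃ a : ℕ, ∃ P : Fin d × Fin n → (Fin 2 → ℤ), (∀ i, P i ∈ S) ∧
      Matrix.det (Matrix.of fun i j => eval (P i) (monomial (Jm a (j.1:ℕ) (j.2:ℕ)) (1:ℤ))) ≠ 0 := by
  classical
  obtain ⟨a, ha, h⟩ := exists_std hirr.ne_zero
  rw [totalDegree_mapQ, hfd] at h
  obtain ⟨P, hP1, hP2⟩ := exists_rows (K := ℚ) (ι := Fin d × Fin n) (S : Set (Fin 2 → ℤ))
    (fun P j => ((eval P (monomial (Jm a (j.1:ℕ) (j.2:ℕ)) (1:ℤ)) : ℤ) : ℚ)) (by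
      intro c hc0
      by_contra hne
      have h1 := bezout_int (f := f) hirr (h n c hne) (e := d + n) (stdPoly_deg.trans (by omega)) S hS (by
        intro P hP
        have := hc0 P hP
        rw [← this]
        unfold stdPoly
        rw [map_sum]
        refine Finset.sum_congr rfl fun j _ => ?_
        unfold toQ
        simp only [eval_monomial, one_mul]
        rw [mul_comm]
        congr 1
        simp [Finsupp.prod])
      rw [hfd] at h1
      omega)
  refine ⟨a, P, hP1, ?_⟩
  intro h0
  apply hP2
  have := congrArg (Int.castRingHom ℚ) h0
  rw [RingHom.map_det, map_zero] at this
  exact this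

theorem det_upper {d n b : ℕ} (hb : 1 ≤ b) (a : ℕ) (P : Fin d × Fin n → (Fin 2 → ℤ)) (hP : ∀ i k, |P i k| ≤ b) :
    |Matrix.det (Matrix.of fun i j => eval (P i) (monomial (Jm a (j.1:ℕ) (j.2:ℕ)) (1:ℤ)))| ≤
      (d*n).factorial * (b:ℤ)^(∑ j : Fin d × Fin n, ((j.1:ℕ)+(j.2:ℕ))) := by
  classical
  rw [Matrix.det_apply]
  refine (Finset.abs_sum_le_sum_abs _ _).trans ?_
  have h1 : ∀ σ ∈ (Finset.univ : Finset (Equiv.Perm (Fin d × Fin n))),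
      |Equiv.Perm.sign σ • ∏ i, (Matrix.of fun i j => eval (P i) (monomial (Jm a (j.1:ℕ) (j.2:ℕ)) (1:ℤ))) (σ i) i| ≤
       (b:ℤ)^(∑ j : Fin d × Fin n, ((j.1:ℕ)+(j.2:ℕ))) := by
    intro σ _
    have h2 : |∏ i, (Matrix.of fun i j => eval (P i) (monomial (Jm a (j.1:ℕ) (j.2:ℕ)) (1:ℤ))) (σ i) i| ≤
       (b:ℤ)^(∑ j : Fin d × Fin n, ((j.1:ℕ)+(j.2:ℕ))) := by
      rw [Finset.abs_prod, ← Finset.prod_pow_eq_pow_sum]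
      refine Finset.prod_le_prod (fun _ _ => abs_nonneg _) fun j _ => ?_
      have := eval_mon_le hb (hP (σ j)) (Jm_deg (a := a) (r := (j.1:ℕ)) (l := (j.2:ℕ))).le 1
      simpa using this
    rcases Int.units_eq_one_or (Equiv.Perm.sign σ) with h | h <;> rw [h]
    · simpa using h2
    · rw [Units.neg_smul, abs_neg]; simpa using h2
  refine (Finset.sum_le_card_nsmul _ _ _ h1).trans ?_
  rw [Finset.card_univ, Fintype.card_perm, Fintype.card_prod, Fintype.card_fin, Fintype.card_fin, nsmul_eq_mul]

theorem sum_deg (d n : ℕ) : 2 * ∑ j : Fin d × Fin n, ((j.1:ℕ)+(j.2:ℕ)) ≤ (d*n)*(d+n) := by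
  have h1 : ∀ m : ℕ, 2 * ∑ i : Fin m, (i:ℕ) ≤ m * m := by
    intro m
    rw [Fin.sum_univ_eq_sum_range (fun i => i) m]
    have := Finset.sum_range_id_mul_two m
    calc _ = m * (m-1) := by rw [← this]; ring
      _ ≤ _ := Nat.mul_le_mul_left _ (by omega)
  rw [Fintype.sum_prod_type]
  simp only [Finset.sum_add_distrib, Finset.sum_const, Finset.card_univ, Fintype.card_fin, smul_eq_mul]
  rw [← Finset.mul_sum]
  nlinarith [Nat.mul_le_mul_left n (h1 d), Nat.mul_le_mul_left d (h1 n)]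

/-- vertical case -/
theorem vertical {d b : ℕ} (hd : 1 ≤ d) {f : MvPolynomial (Fin 2) ℤ} (hfd : f.totalDegree = d)
    (hirr : Irreducible (map (Int.castRingHom ℚ) f)) (h0 : pderiv 1 f = 0)
    (S : Finset (Fin 2 → ℤ)) (hS : ∀ P ∈ S, eval P f = 0) (hSb : ∀ P ∈ S, ∀ i, |P i| ≤ b)
    (hne : S.Nonempty) : d = 1 ∧ S.card ≤ 2 * b + 1 := by
  classical
  have hsupp : ∀ m ∈ f.support, m 1 = 0 := by
    intro m hm
    by_contra h
    have h1 : coeff (m - Finsupp.single 1 1) (pderiv 1 f) = 0 := by rw [h0]; simp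
    rw [coeff_pderiv] at h1
    rw [tsub_add_cancel_of_le (by simpa using Nat.one_le_iff_ne_zero.2 h)] at h1
    rcases mul_eq_zero.1 h1 with h2 | h2
    · exact (mem_support_iff.1 hm) h2
    · norm_cast at h2
  have hev : ∀ P Q : Fin 2 → ℤ, P 0 = Q 0 → eval P f = eval Q f := by
    intro P Q h
    rw [eval_eq', eval_eq']
    refine Finset.sum_congr rfl fun m hm => ?_
    rw [Fin.prod_univ_two, Fin.prod_univ_two, hsupp m hm, h]; simp
  obtain ⟨P, hP⟩ := hne
  have hX : (X 0 - C ((P 0 : ℤ) : ℚ) : MvPolynomial (Fin 2) ℚ).totalDegree ≤ 1 :=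
    (totalDegree_sub_C_le _ _).trans (totalDegree_X _).le
  have hdvd : map (Int.castRingHom ℚ) f ∣ (X 0 - C ((P 0 : ℤ) : ℚ) : MvPolynomial (Fin 2) ℚ) := by
    by_contra hnd
    have hinj : Function.Injective (fun y : ℕ => (![P 0, (y:ℤ)] : Fin 2 → ℤ)) := by
      intro y y' h
      have := congrFun h 1
      simpa using this
    have := bezout_int (f := f) hirr hnd hX ((Finset.range (d+1)).image fun y : ℕ => (![P 0, (y:ℤ)] : Fin 2 → ℤ)) (by
      intro Q hQ
      obtain ⟨y, _, rfl⟩ := Finset.mem_image.1 hQ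
      rw [hev _ P (by simp), hS P hP]) (by
      intro Q hQ
      obtain ⟨y, _, rfl⟩ := Finset.mem_image.1 hQ
      simp [toQ])
    rw [Finset.card_image_of_injective _ hinj, hfd, Finset.card_range] at this
    omega
  have hne0 : (X 0 - C ((P 0 : ℤ) : ℚ) : MvPolynomial (Fin 2) ℚ) ≠ 0 := by
    intro h
    have := congrArg (eval (fun _ => ((P 0 : ℤ) : ℚ) + 1)) h
    simp at this
  constructor
  · by_contra hd1
    apply hne0
    apply eq_zero_of_dvd_of_deg hdvd
    rw [totalDegree_mapQ, hfd]
    omega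
  · have hx : ∀ Q ∈ S, Q 0 = P 0 := by
      intro Q hQ
      obtain ⟨q, hq⟩ := hdvd
      have := congrArg (eval (toQ Q)) hq
      unfold toQ at this
      rw [map_mul, eval_map_apply_aux, hS Q hQ] at this
      simp [sub_eq_zero] at this
      exact this
    have : S.card ≤ (Finset.Icc (-(b:ℤ)) b).card := by
      refine Finset.card_le_card_of_injOn (fun Q => Q 1) ?_ ?_
      · intro Q hQ
        simpa [abs_le] using hSb Q hQ 1
      · intro Q hQ Q' hQ' h
        ext i
        fin_cases i
        · exact (hx Q hQ).trans (hx Q' hQ').symm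
        · exact h
    rw [Int.card_Icc] at this
    omega

theorem singular_count {d : ℕ} (hd : 1 ≤ d) {f : MvPolynomial (Fin 2) ℤ} (hfd : f.totalDegree = d)
    (hirr : Irreducible (map (Int.castRingHom ℚ) f)) (h0 : pderiv 1 f ≠ 0)
    (S : Finset (Fin 2 → ℤ)) (hS : ∀ P ∈ S, eval P f = 0) (hS1 : ∀ P ∈ S, eval P (pderiv 1 f) = 0) :
    S.card ≤ d * d := by
  have hinjZ : Function.Injective (Int.castRingHom ℚ) := Int.cast_injective
  have hdeg := totalDegree_pderiv_le 1 f
  rw [hfd] at hdeg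
  have := bezout_int (f := f) hirr (g := map (Int.castRingHom ℚ) (pderiv 1 f)) (e := d) (by
    intro hdvd
    apply h0
    apply map_injective _ hinjZ
    rw [map_zero]
    apply eq_zero_of_dvd_of_deg hdvd
    rw [totalDegree_mapQ, totalDegree_mapQ, hfd]
    omega) (by rw [totalDegree_mapQ]; omega) S hS (by
    intro P hP
    unfold toQ
    rw [eval_map_apply_aux, hS1 P hP, Int.cast_zero])
  rwa [hfd] at this

/-! Part H2 -/

open MvPolynomial

theorem expo {J α : Type*} [Fintype J] [DecidableEq α] (z : J → α) (Z : Finset α) (N p s σ : ℝ) (hp : 0 < p)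
    (hN : p ≤ N) (hZ : (Z.card : ℝ) ≤ N) (hs : s = Fintype.card J)
    (hσ : σ = ((Finset.univ.filter fun i => z i ∉ Z).card : ℕ)) :
    s^2 / N - 2 * (s * σ / p) - s ≤ 2 * ((∑ w ∈ Z, ((Finset.univ.filter fun i => z i = w).card).choose 2 : ℕ) : ℝ) := by
  have hN0 : 0 < N := by linarith
  set c : α → ℕ := fun w => (Finset.univ.filter fun i => z i = w).card with hc
  have hsum : (∑ w ∈ Z, c w) + (Finset.univ.filter fun i => z i ∉ Z).card = Fintype.card J := by
    have h1 : (Finset.univ.filter fun i => z i ∈ Z).card = ∑ w ∈ Z, c w := by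
      rw [Finset.card_eq_sum_card_fiberwise (f := z) (t := Z) (by intro i hi; simpa using hi)]
      refine Finset.sum_congr rfl fun w hw => ?_
      rw [hc]
      congr 1
      ext i
      simp only [Finset.mem_filter, Finset.mem_univ, true_and]
      constructor
      · exact fun h => h.2
      · exact fun h => ⟨h ▸ hw, h⟩
    rw [← h1, Finset.card_filter_add_card_filter_not, Finset.card_univ]
  have hsum' : (∑ w ∈ Z, (c w : ℝ)) = s - σ := by
    rw [hs, hσ, ← hsum]; push_cast; ring
  have hσ0 : 0 ≤ σ := by rw [hσ]; positivity
  have hs0 : 0 ≤ s := by rw [hs]; positivity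
  push_cast
  rw [Finset.mul_sum]
  have h2 : ∀ w ∈ Z, 2 * (s/N) * c w - (s/N)^2 - c w ≤ 2 * (((c w).choose 2 : ℕ) : ℝ) := by
    intro w _
    rw [Nat.cast_choose_two]
    nlinarith [sq_nonneg ((c w : ℝ) - s / N)]
  refine le_trans ?_ (Finset.sum_le_sum h2)
  rw [Finset.sum_sub_distrib, Finset.sum_sub_distrib, ← Finset.mul_sum, hsum', Finset.sum_const, nsmul_eq_mul]
  have h3 : (Z.card:ℝ) * (s/N)^2 ≤ N * (s/N)^2 := mul_le_mul_of_nonneg_right hZ (by positivity)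
  have h4 : N * (s/N)^2 = s^2/N := by field_simp
  have h5 : s * σ / N ≤ s * σ / p := by gcongr
  have h6 : 2 * (s/N) * (s - σ) = 2 * (s^2/N) - 2 * (s*σ/N) := by field_simp
  rw [h6]
  linarith

theorem inv_lower (p t : ℝ) (hp : 0 < p) (ht : 0 ≤ t) : 1 / p - t / (p * Real.sqrt p) ≤ 1 / (p + t * Real.sqrt p) := by
  have hs := Real.sqrt_pos.2 hp
  have h2 := Real.sq_sqrt hp.le
  set r := Real.sqrt p
  rw [← h2]
  have : 1 / r^2 - t / (r^2 * r) = (r - t) / r^3 := by field_simp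
  rw [this, div_le_div_iff₀ (by positivity) (by positivity)]
  nlinarith [mul_nonneg (mul_nonneg ht ht) hs.le]

theorem good_prime {d p : ℕ} [Fact p.Prime] {f : MvPolynomial (Fin 2) ℤ} (hfd : f.totalDegree ≤ d)
    (hpd : 256 * d^4 ≤ p)
    (hgood : IsUnit (map (Int.castRingHom (ZMod p)) f) ∨ Irreducible (map (Int.castRingHom (ZMod p)) f))
    {J : Type*} [Fintype J] [DecidableEq J] (P : J → Fin 2 → ℤ) (hP : ∀ i, eval (P i) f = 0)
    (g : J → MvPolynomial (Fin 2) ℤ) :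
    ∃ e : ℕ, (p:ℤ)^e ∣ Matrix.det (Matrix.of fun i j => eval (P i) (g j)) ∧
      ((Fintype.card J : ℝ)^2 / 2) * (1 / p - 12 * d^2 / (p * Real.sqrt p))
       - (Fintype.card J : ℝ) * (((Finset.univ.filter fun i => (p:ℤ) ∣ eval (P i) (pderiv 1 f)).card : ℕ) : ℝ) / p
       - (Fintype.card J : ℝ) / 2 ≤ e := by
  classical
  set fb := map (Int.castRingHom (ZMod p)) f with hfb
  have hp0 : (0:ℝ) < p := by exact_mod_cast (Fact.out : p.Prime).pos
  let Z : Finset (Fin 2 → ZMod p) := Finset.univ.filter fun z => eval z fb = 0 ∧ eval z (pderiv 1 fb) ≠ 0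
  have hZ : ((Z.card : ℕ) : ℝ) ≤ p + 12 * d^2 * Real.sqrt p := by
    rcases hgood with hu | hi
    · have : Z = ∅ := by
        ext z
        simp only [Z, Finset.mem_filter, Finset.mem_univ, true_and, Finset.notMem_empty, iff_false, not_and]
        intro h
        have := hu.map (eval z)
        rw [h] at this
        exact absurd this not_isUnit_zero
      rw [this]; simp; positivity
    · refine stepanov hi.prime ?_ ?_ hpd Z ?_ ?_
      · by_contra h
        have h0 : fb.totalDegree = 0 := by omega
        rw [totalDegree_eq_zero_iff_eq_C] at h0
        have hc : coeff 0 fb ≠ 0 := by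
          intro hc; rw [hc, C_0] at h0; exact hi.ne_zero h0
        apply hi.not_isUnit
        rw [h0]
        exact (isUnit_iff_ne_zero.2 hc).map C
      · refine le_trans ?_ hfd
        exact Finset.sup_mono (support_map_subset _ _)
      · intro z hz; exact (Finset.mem_filter.1 hz).2.1
      · intro z hz; exact (Finset.mem_filter.1 hz).2.2
  have hdvd := det_dvd_p f g P hP Z (fun z hz => (Finset.mem_filter.1 hz).2.2)
  refine ⟨_, hdvd, ?_⟩
  have hex := expo (fun i => (fun k => (P i k : ZMod p))) Z (p + 12 * d^2 * Real.sqrt p) p _ _ hp0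
    (by have : 0 ≤ 12 * (d:ℝ)^2 * Real.sqrt p := by positivity
        linarith) hZ rfl rfl
  have hσ : (Finset.univ.filter fun i => (fun k => (P i k : ZMod p)) ∉ Z) =
      Finset.univ.filter fun i => (p:ℤ) ∣ eval (P i) (pderiv 1 f) := by
    ext i
    simp only [Z, Finset.mem_filter, Finset.mem_univ, true_and]
    rw [hfb, eval_map_apply_aux, hP i, pderiv_map, eval_map_apply_aux, ← ZMod.intCast_zmod_eq_zero_iff_dvd]
    simp
  rw [hσ] at hex
  have hinv := inv_lower p (12 * (d:ℝ)^2) hp0 (by positivity)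
  set s : ℝ := (Fintype.card J : ℝ)
  have h1 : s^2 * (1 / p - 12 * d^2 / (p * Real.sqrt p)) ≤ s^2 / (p + 12 * d^2 * Real.sqrt p) := by
    rw [div_eq_mul_one_div (s^2)]
    exact mul_le_mul_of_nonneg_left hinv (by positivity)
  linarith

/-! Part H3 -/

open MvPolynomial

theorem map_ne_zero_of_prim {p : ℕ} [Fact p.Prime] {f : MvPolynomial (Fin 2) ℤ}
    (hf : Finset.gcd f.support f.coeff = 1) : map (Int.castRingHom (ZMod p)) f ≠ 0 := by
  intro h
  have h1 : (p:ℤ) ∣ Finset.gcd f.support f.coeff := by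
    apply Finset.dvd_gcd
    intro m _
    have := congrArg (coeff m) h
    rw [coeff_map, coeff_zero] at this
    exact (ZMod.intCast_zmod_eq_zero_iff_dvd _ _).1 this
  rw [hf] at h1
  have hp := (Fact.out : p.Prime).one_lt
  have := Int.le_of_dvd one_pos h1
  omega

/-- double counting of the bad incidences -/
theorem sigma_sum {J : Type*} [Fintype J] {Y X : ℕ} (hY : 1 ≤ Y) (v : J → ℤ) (hv : ∀ i, v i ≠ 0) (L : ℝ)
    (hL : ∀ i, Real.log ((|v i| : ℤ) : ℝ) ≤ L) (Q : Finset ℕ) (hQ : Q ⊆ prI Y X) :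
    ∑ p ∈ Q, (((Finset.univ.filter fun i => (p:ℤ) ∣ v i).card : ℕ) : ℝ) / p * Real.log p ≤
      Fintype.card J * (L / Y) := by
  classical
  have hY' : (0:ℝ) < Y := by exact_mod_cast hY
  have h1 : ∀ p ∈ Q, (((Finset.univ.filter fun i => (p:ℤ) ∣ v i).card : ℕ) : ℝ) / p * Real.log p ≤
      ∑ i : J, if (p:ℤ) ∣ v i then Real.log p / Y else 0 := by
    intro p hp
    have hpY : (Y:ℝ) ≤ p := by exact_mod_cast (mem_prI.1 (hQ hp)).2.1.le
    have hl := Real.log_natCast_nonneg p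
    rw [← Finset.sum_filter, Finset.sum_const, nsmul_eq_mul]
    have : Real.log p / p ≤ Real.log p / Y := by gcongr
    calc _ = (((Finset.univ.filter fun i => (p:ℤ) ∣ v i).card : ℕ) : ℝ) * (Real.log p / p) := by ring
      _ ≤ _ := mul_le_mul_of_nonneg_left this (by positivity)
  refine (Finset.sum_le_sum h1).trans ?_
  rw [Finset.sum_comm]
  have h2 : ∀ i ∈ (Finset.univ : Finset J), (∑ p ∈ Q, if (p:ℤ) ∣ v i then Real.log p / Y else 0) ≤ L / Y := by
    intro i _
    rw [← Finset.sum_filter, ← Finset.sum_div]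
    have := sum_log_dvd (Q.filter fun p => (p:ℤ) ∣ v i) (fun p hp => (mem_prI.1 (hQ (Finset.mem_filter.1 hp).1)).1)
      (v i) (hv i) (fun p hp => (Finset.mem_filter.1 hp).2)
    have := this.trans (hL i)
    gcongr
  refine (Finset.sum_le_card_nsmul _ _ _ h2).trans ?_
  rw [nsmul_eq_mul, Finset.card_univ]

theorem core {d Y : ℕ} (hd : 1 ≤ d) {f : MvPolynomial (Fin 2) ℤ} (hfd : f.totalDegree = d)
    (hf : Finset.gcd f.support f.coeff = 1)
    {J : Type*} [Fintype J] [DecidableEq J] (P : J → Fin 2 → ℤ) (hP : ∀ i, eval (P i) f = 0)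
    (hP1 : ∀ i, eval (P i) (pderiv 1 f) ≠ 0)
    (hL : ∀ i, Real.log ((|eval (P i) (pderiv 1 f)| : ℤ) : ℝ) ≤ Y)
    (G : ℤ) (hG0 : G ≠ 0) (hGY : Real.log ((|G| : ℤ) : ℝ) ≤ Y)
    (hG : ∀ (p : ℕ) [Fact p.Prime], d < p → ¬ (p:ℤ) ∣ G → map (Int.castRingHom (ZMod p)) f ≠ 0 →
      IsUnit (map (Int.castRingHom (ZMod p)) f) ∨ Irreducible (map (Int.castRingHom (ZMod p)) f))
    (hYd : 256 * d^4 ≤ Y) (hYs : Y ≤ Fintype.card J)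
    (g : J → MvPolynomial (Fin 2) ℤ)
    (hΔ : Matrix.det (Matrix.of fun i j => eval (P i) (g j)) ≠ 0) :
    ((Fintype.card J : ℝ)^2 / 2) * (Real.log (Fintype.card J) - Real.log Y - 20) ≤
      Real.log ((|Matrix.det (Matrix.of fun i j => eval (P i) (g j))| : ℤ) : ℝ) := by
  classical
  set Δ := Matrix.det (Matrix.of fun i j => eval (P i) (g j)) with hΔdef
  set X := Fintype.card J with hX
  have hd4 : d ≤ d^4 := Nat.le_self_pow (by norm_num) d
  have hY1 : 1 ≤ Y := by omega
  have hY' : (0:ℝ) < Y := by exact_mod_cast hY1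
  set Q := (prI Y X).filter fun p : ℕ => ¬ (p:ℤ) ∣ G with hQ
  have hQsub : Q ⊆ prI Y X := Finset.filter_subset _ _
  have hgood : ∀ p : ℕ, ∃ e : ℕ, p ∈ Q → ((p:ℤ)^e ∣ Δ ∧
      ((X : ℝ)^2 / 2) * (1 / p - 12 * d^2 / (p * Real.sqrt p))
       - (X : ℝ) * (((Finset.univ.filter fun i => (p:ℤ) ∣ eval (P i) (pderiv 1 f)).card : ℕ) : ℝ) / p
       - (X : ℝ) / 2 ≤ e) := by
    intro p
    by_cases hp : p ∈ Q
    · obtain ⟨hp1, hp2⟩ := Finset.mem_filter.1 hp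
      obtain ⟨hpp, hpY, hpX⟩ := mem_prI.1 hp1
      haveI : Fact p.Prime := ⟨hpp⟩
      obtain ⟨e, he⟩ := good_prime hfd.le (by omega) (hG p (by omega) hp2 (map_ne_zero_of_prim hf)) P hP g
      exact ⟨e, fun _ => he⟩
    · exact ⟨0, fun h => absurd h hp⟩
  choose e he using hgood
  have h1 := sum_log_dvd_pow Q (fun p hp => (mem_prI.1 (hQsub hp)).1) e Δ hΔ (fun p hp => (he p hp).1)
  refine le_trans ?_ h1
  -- lower bound for the sum
  have h2 : ∀ p ∈ Q, ((X : ℝ)^2 / 2) * (Real.log p / p) - ((X : ℝ)^2 / 2) * (12 * d^2) * (Real.log p / (p * Real.sqrt p))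
       - (X : ℝ) * ((((Finset.univ.filter fun i => (p:ℤ) ∣ eval (P i) (pderiv 1 f)).card : ℕ) : ℝ) / p * Real.log p)
       - (X : ℝ) / 2 * Real.log p ≤ e p * Real.log p := by
    intro p hp
    have := mul_le_mul_of_nonneg_right (he p hp).2 (Real.log_natCast_nonneg p)
    refine le_trans (le_of_eq ?_) this
    ring
  refine le_trans ?_ (Finset.sum_le_sum h2)
  rw [Finset.sum_sub_distrib, Finset.sum_sub_distrib, Finset.sum_sub_distrib, ← Finset.mul_sum, ← Finset.mul_sum,
    ← Finset.mul_sum, ← Finset.mul_sum]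
  have k1 : Real.log X - Real.log Y - 8 ≤ ∑ p ∈ Q, Real.log p / p := by
    have m1 := prI_mertens hY1 hYs
    have m2 := Finset.sum_filter_add_sum_filter_not (prI Y X) (fun p : ℕ => ¬ (p:ℤ) ∣ G) (fun p : ℕ => Real.log p / (p:ℝ))
    have m3 : ∑ p ∈ (prI Y X).filter (fun p : ℕ => ¬ ¬ (p:ℤ) ∣ G), Real.log p / (p:ℝ) ≤ 1 := by
      have m4 : ∑ p ∈ (prI Y X).filter (fun p : ℕ => ¬ ¬ (p:ℤ) ∣ G), Real.log p / (p:ℝ) ≤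
          (∑ p ∈ (prI Y X).filter (fun p : ℕ => ¬ ¬ (p:ℤ) ∣ G), Real.log p) / Y := by
        rw [Finset.sum_div]
        refine Finset.sum_le_sum fun p hp => ?_
        have hpY : (Y:ℝ) ≤ p := by exact_mod_cast (mem_prI.1 (Finset.mem_filter.1 hp).1).2.1.le
        have hl := Real.log_natCast_nonneg p
        gcongr
      refine m4.trans ?_
      rw [div_le_one hY']
      refine le_trans (sum_log_dvd _ ?_ G hG0 ?_) hGY
      · exact fun p hp => (mem_prI.1 (Finset.mem_filter.1 hp).1).1
      · exact fun p hp => not_not.1 (Finset.mem_filter.1 hp).2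
    linarith
  have k2 : (12 * (d:ℝ)^2) * ∑ p ∈ Q, Real.log p / (p * Real.sqrt p) ≤ 7.5 := by
    have m1 := prI_tail Y X hY1
    have m2 : ∑ p ∈ Q, Real.log p / ((p:ℝ) * Real.sqrt p) ≤ ∑ p ∈ prI Y X, Real.log p / (p * Real.sqrt p) :=
      Finset.sum_le_sum_of_subset_of_nonneg hQsub (fun p _ _ => by
        have := Real.log_natCast_nonneg p
        positivity)
    have m3 : 16 * (d:ℝ)^2 ≤ Real.sqrt Y := by
      apply Real.le_sqrt_of_sq_le
      have : ((256 * d^4 : ℕ):ℝ) ≤ Y := by exact_mod_cast hYd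
      push_cast at this
      nlinarith
    have hd0 : (0:ℝ) < d := by exact_mod_cast hd
    have m4 : 10 / Real.sqrt Y ≤ 10 / (16 * (d:ℝ)^2) := by gcongr
    calc _ ≤ (12 * (d:ℝ)^2) * (10 / (16 * (d:ℝ)^2)) :=
          mul_le_mul_of_nonneg_left (m2.trans (m1.trans m4)) (by positivity)
      _ = 7.5 := by field_simp; norm_num
  have k3 : ∑ p ∈ Q, (((Finset.univ.filter fun i => (p:ℤ) ∣ eval (P i) (pderiv 1 f)).card : ℕ) : ℝ) / p * Real.log p ≤ X := by
    have := sigma_sum hY1 (fun i => eval (P i) (pderiv 1 f)) hP1 Y hL Q hQsub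
    rwa [div_self hY'.ne', mul_one] at this
  have k4 : ∑ p ∈ Q, Real.log p ≤ 1.4 * X :=
    (Finset.sum_le_sum_of_subset_of_nonneg hQsub (fun p _ _ => Real.log_natCast_nonneg p)).trans (prI_theta Y X)
  have hX0 : (0:ℝ) ≤ X := by positivity
  have hX2 : (0:ℝ) ≤ (X:ℝ)^2/2 := by positivity
  have l1 := mul_le_mul_of_nonneg_left k1 hX2
  have l2 := mul_le_mul_of_nonneg_left k2 hX2
  have l3 := mul_le_mul_of_nonneg_left k3 hX0
  have l4 := mul_le_mul_of_nonneg_left k4 (show (0:ℝ) ≤ (X:ℝ)/2 by positivity)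
  rw [mul_assoc ((X:ℝ)^2/2) (12 * (d:ℝ)^2)]
  nlinarith

/-! Part H4 -/

open MvPolynomial

/-- the explicit height bound -/
def Hbd (d b : ℕ) : ℕ := 2 ^ (d * (2*d+1)) * ((2*d*(2*d+1) + 1) * (3 * Tri (2*d) * b ^ (2*d)) ^ 3)

theorem Tri_pos' (l : ℕ) : 1 ≤ Tri l := by
  have := Tri_two l
  nlinarith

theorem Hbd_pos {d b : ℕ} (hb : 1 ≤ b) : 1 ≤ Hbd d b := by
  have := Tri_pos' (2*d)
  unfold Hbd
  have : 0 < b := hb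
  apply Nat.succ_le_of_lt
  positivity

theorem Hbd_log {d b : ℕ} (hd : 1 ≤ d) (hb : 1 ≤ b) {u : ℝ} (hu : 0 ≤ u) (hbu : Real.log b ≤ d * u) :
    Real.log (Hbd d b) ≤ 70 * d^2 * (1+u) := by
  have hT := Tri_two (2*d)
  have hT1 := Tri_pos' (2*d)
  unfold Hbd
  set T := Tri (2*d)
  have hd' : (1:ℝ) ≤ d := by exact_mod_cast hd
  have hb' : (1:ℝ) ≤ b := by exact_mod_cast hb
  have hT1' : (1:ℝ) ≤ T := by exact_mod_cast hT1
  have hT' : 2 * (T:ℝ) = (2*d+1)*(2*d+2) := by exact_mod_cast hT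
  push_cast
  rw [Real.log_mul (by positivity) (by positivity), Real.log_mul (by positivity) (by positivity), Real.log_pow,
    Real.log_pow, Real.log_mul (by positivity) (by positivity), Real.log_pow]
  have h1 : Real.log 2 ≤ 1 := by have := Real.log_two_lt_d9; linarith
  have h2 : Real.log (2 * (d:ℝ) * (2*d+1) + 1) ≤ 7 * d^2 := by
    refine (Real.log_le_self (by positivity)).trans ?_
    nlinarith
  have h3 : Real.log (3 * (T:ℝ)) ≤ 18 * d^2 := by
    refine (Real.log_le_self (by positivity)).trans ?_
    nlinarith
  push_cast
  have h4 : (d:ℝ) * (2*d+1) * Real.log 2 ≤ (d:ℝ) * (2*d+1) * 1 := mul_le_mul_of_nonneg_left h1 (by positivity)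
  have h5 : 2 * (d:ℝ) * Real.log b ≤ 2 * d * (d * u) := mul_le_mul_of_nonneg_left hbu (by positivity)
  have h6 : 0 ≤ (d:ℝ)^2 * u := by positivity
  nlinarith

theorem G_log {d : ℕ} (hd : 1 ≤ d) {H : ℕ} (hH : 1 ≤ H) {u : ℝ} (hu : 0 ≤ u)
    (hlog : Real.log H ≤ 70 * d^2 * (1+u)) {G : ℤ} (hG0 : G ≠ 0)
    (hG : |G| ≤ (2*d^2).factorial * (5*d^2 * (2*d*(H:ℤ))^2)^(2*d^2)) :
    Real.log ((|G| : ℤ) : ℝ) ≤ 302 * d^4 * (1+u) := by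
  have hd' : (1:ℝ) ≤ d := by exact_mod_cast hd
  have hH' : (1:ℝ) ≤ H := by exact_mod_cast hH
  have h0 : (0:ℝ) < ((|G| : ℤ) : ℝ) := by exact_mod_cast abs_pos.2 hG0
  have h1 : ((|G| : ℤ) : ℝ) ≤ ((2*d^2).factorial : ℝ) * (5*d^2 * (2*d*(H:ℝ))^2)^(2*d^2) := by exact_mod_cast hG
  have hfp : (0:ℝ) < ((2*d^2).factorial : ℝ) := by exact_mod_cast Nat.factorial_pos _
  refine (Real.log_le_log h0 h1).trans ?_
  rw [Real.log_mul (by positivity) (by positivity), Real.log_pow,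
    Real.log_mul (x := 5*(d:ℝ)^2) (y := (2*d*(H:ℝ))^2) (by positivity) (by positivity),
    Real.log_pow, Real.log_mul (x := 2*(d:ℝ)) (y := (H:ℝ)) (by positivity) (by positivity)]
  have h2 := log_fact_upper (2*d^2)
  push_cast at h2 ⊢
  have h3 : Real.log (2*(d:ℝ)^2) ≤ 2*d^2 := Real.log_le_self (by positivity)
  have h4 : Real.log (5*(d:ℝ)^2) ≤ 5*d^2 := Real.log_le_self (by positivity)
  have h5 : Real.log (2*(d:ℝ)) ≤ 2*d^2 := (Real.log_le_self (by positivity)).trans (by nlinarith)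
  have h6 : 2*(d:ℝ)^2 * Real.log (2*(d:ℝ)^2) ≤ 2*(d:ℝ)^2 * (2*d^2) := mul_le_mul_of_nonneg_left h3 (by positivity)
  have h7 : 2*(d:ℝ)^2 * (Real.log (5*(d:ℝ)^2) + 2 * (Real.log (2*(d:ℝ)) + Real.log H)) ≤
     2*(d:ℝ)^2 * (5*d^2 + 2 * (2*d^2 + 70 * d^2 * (1+u))) := mul_le_mul_of_nonneg_left (by linarith) (by positivity)
  have h8 : 0 ≤ (d:ℝ)^4 * u := by positivity
  nlinarith

theorem eval_bound {d b : ℕ} (hb : 1 ≤ b) {h : MvPolynomial (Fin 2) ℤ} (hd : h.totalDegree ≤ d) {H : ℤ}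
    (hH : ∀ m, |h.coeff m| ≤ H) {P : Fin 2 → ℤ} (hP : ∀ i, |P i| ≤ b) :
    |eval P h| ≤ ((d+1)*(d+1) : ℕ) * (H * (b:ℤ)^d) := by
  have hH0 : 0 ≤ H := (abs_nonneg _).trans (hH 0)
  rw [h.as_sum, map_sum]
  refine (Finset.abs_sum_le_sum_abs _ _).trans ?_
  have h1 : ∀ m ∈ h.support, |eval P (monomial m (h.coeff m))| ≤ H * (b:ℤ)^d := by
    intro m hm
    refine (eval_mon_le hb hP ((le_deg2 hm).trans hd) _).trans ?_
    exact mul_le_mul_of_nonneg_right (hH m) (by positivity)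
  refine (Finset.sum_le_card_nsmul _ _ _ h1).trans ?_
  rw [nsmul_eq_mul]
  have h2 : h.support.card ≤ (d+1)*(d+1) := by
    have := Finset.card_le_card_of_injOn (s := h.support) (t := Finset.range (d+1) ×ˢ Finset.range (d+1))
      (fun m => (m 0, m 1)) (by
        intro m hm
        have := le_deg2 hm
        simp only [Finset.coe_product, Set.mem_prod, Finset.coe_range, Set.mem_Iio]
        omega) (by
        intro m _ m' _ h
        simp only [Prod.mk.injEq] at h
        ext i
        fin_cases i
        · exact h.1
        · exact h.2)
    simpa using this
  exact mul_le_mul_of_nonneg_right (by exact_mod_cast h2) (by positivity)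

theorem L_log {d b : ℕ} (hd : 1 ≤ d) (hb : 1 ≤ b) {f : MvPolynomial (Fin 2) ℤ} (hfd : f.totalDegree = d) {H : ℕ} (hH1 : 1 ≤ H)
    (hH : ∀ m, |f.coeff m| ≤ (H:ℤ)) {u : ℝ} (hu : 0 ≤ u) (hbu : Real.log b ≤ d * u)
    (hlog : Real.log H ≤ 70 * d^2 * (1+u)) {P : Fin 2 → ℤ} (hP : ∀ i, |P i| ≤ b)
    (h0 : eval P (pderiv 1 f) ≠ 0) :
    Real.log ((|eval P (pderiv 1 f)| : ℤ) : ℝ) ≤ 100 * d^4 * (1+u) := by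
  have hd' : (1:ℝ) ≤ d := by exact_mod_cast hd
  have hb' : (1:ℝ) ≤ b := by exact_mod_cast hb
  have hH' : (1:ℝ) ≤ H := by exact_mod_cast hH1
  have hdeg := totalDegree_pderiv_le 1 f
  have h1 := eval_bound (d := d) hb (h := pderiv 1 f) (by omega) (coeff_pderiv_le hfd.le hH 1) hP
  have h2 : (0:ℝ) < ((|eval P (pderiv 1 f)| : ℤ) : ℝ) := by exact_mod_cast abs_pos.2 h0
  have h3 : ((|eval P (pderiv 1 f)| : ℤ) : ℝ) ≤ (((d:ℝ)+1)*(d+1)) * ((d * H) * (b:ℝ)^d) := by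
    have : ((|eval P (pderiv 1 f)| : ℤ) : ℝ) ≤ ((((d+1)*(d+1) : ℕ) * ((d * H : ℤ) * (b:ℤ)^d) : ℤ) : ℝ) := by
      exact_mod_cast h1
    refine this.trans (le_of_eq ?_)
    push_cast
    ring
  refine (Real.log_le_log h2 h3).trans ?_
  rw [Real.log_mul (by positivity) (by positivity),
    Real.log_mul (x := (d:ℝ) * H) (y := (b:ℝ)^d) (by positivity) (by positivity),
    Real.log_mul (by positivity) (by positivity) (x := (d:ℝ)) (y := (H:ℝ)), Real.log_pow]
  have h4 : Real.log (((d:ℝ)+1)*(d+1)) ≤ 4 * d^2 := (Real.log_le_self (by positivity)).trans (by nlinarith)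
  have h5 : Real.log d ≤ d^2 := (Real.log_le_self (by positivity)).trans (by nlinarith)
  have h6 : (d:ℝ) * Real.log b ≤ d * (d * u) := mul_le_mul_of_nonneg_left hbu (by positivity)
  have h7 : (d:ℝ)^2 * (1+u) ≤ d^4 * (1+u) := by
    apply mul_le_mul_of_nonneg_right _ (by positivity)
    exact pow_le_pow_right₀ hd' (by norm_num)
  have h8 : (0:ℝ) ≤ d^2 * u := by positivity
  nlinarith

theorem det_log {d n b : ℕ} (hb : 1 ≤ b) {Δ : ℤ} (hΔ0 : Δ ≠ 0) {u : ℝ} (hu : 0 ≤ u) (hbu : Real.log b ≤ d * u) {D : ℕ}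
    (hD : 2 * D ≤ (d*n)*(d+n)) (hΔ : |Δ| ≤ (d*n).factorial * (b:ℤ)^D) (hn : (d:ℝ)^2 * u ≤ (d*n : ℕ)) :
    Real.log ((|Δ| : ℤ) : ℝ) ≤ ((d*n : ℕ):ℝ)^2/2 * (u + 3) := by
  have hb' : (1:ℝ) ≤ b := by exact_mod_cast hb
  have h0 : (0:ℝ) < ((|Δ| : ℤ) : ℝ) := by exact_mod_cast abs_pos.2 hΔ0
  have hfp : (0:ℝ) < ((d*n).factorial : ℝ) := by exact_mod_cast Nat.factorial_pos _
  have h1 : ((|Δ| : ℤ) : ℝ) ≤ ((d*n).factorial : ℝ) * (b:ℝ)^D := by exact_mod_cast hΔ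
  refine (Real.log_le_log h0 h1).trans ?_
  rw [Real.log_mul (by positivity) (by positivity), Real.log_pow]
  have h2 := log_fact_upper (d*n)
  have hD' : 2 * (D:ℝ) ≤ ((d*n:ℕ):ℝ) * (d+n) := by exact_mod_cast hD
  have hs : ((d*n:ℕ):ℝ) = d * n := by push_cast; ring
  set s : ℝ := ((d*n:ℕ):ℝ)
  have hs0 : 0 ≤ s := by positivity
  have h3 : Real.log s ≤ s := Real.log_le_self hs0
  have h4 : s * Real.log s ≤ s * s := mul_le_mul_of_nonneg_left h3 hs0
  have h5 : (D:ℝ) * Real.log b ≤ D * (d * u) := mul_le_mul_of_nonneg_left hbu (by positivity)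
  have h6 : 2 * (D:ℝ) * (d * u) ≤ s * (d+n) * (d * u) := mul_le_mul_of_nonneg_right hD' (by positivity)
  have h7 : s * (d+n) * (d * u) = s^2 * u + s * (d^2 * u) := by rw [hs]; ring
  have h8 : s * ((d:ℝ)^2 * u) ≤ s * s := mul_le_mul_of_nonneg_left hn hs0
  nlinarith

theorem smooth_count {d b n Y : ℕ} (hd : 1 ≤ d) (hb : 1 ≤ b) {f : MvPolynomial (Fin 2) ℤ} (hfd : f.totalDegree = d)
    (hf : Finset.gcd f.support f.coeff = 1) (hirr : Irreducible (map (Int.castRingHom ℚ) f))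
    {u : ℝ} (hu : 0 ≤ u) (hbu : Real.log b ≤ d * u) (hY : 1000 * d^4 * (1+u) ≤ (Y:ℝ))
    (hn : (Y:ℝ) * Real.exp (u + 24) ≤ (d * n : ℕ))
    (S : Finset (Fin 2 → ℤ)) (hS : ∀ P ∈ S, eval P f = 0) (hSb : ∀ P ∈ S, ∀ i, |P i| ≤ b)
    (hS1 : ∀ P ∈ S, eval P (pderiv 1 f) ≠ 0) : S.card ≤ d * (d + n) := by
  classical
  by_contra hcon
  push Not at hcon
  have hd' : (1:ℝ) ≤ d := by exact_mod_cast hd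
  have hd4u : 0 ≤ (d:ℝ)^4 * u := by positivity
  have hd41 : (1:ℝ) ≤ (d:ℝ)^4 := one_le_pow₀ hd'
  have hYd : 256 * d^4 ≤ Y := by
    have : (256:ℝ) * d^4 ≤ Y := by nlinarith
    exact_mod_cast this
  have hY0 : (0:ℝ) < Y := by nlinarith
  have hYs : Y ≤ d * n := by
    have h1 : (1:ℝ) ≤ Real.exp (u+24) := Real.one_le_exp (by linarith)
    have : (Y:ℝ) ≤ (d*n:ℕ) := by nlinarith
    exact_mod_cast this
  have hYs' : (Y:ℝ) ≤ (d*n:ℕ) := by exact_mod_cast hYs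
  have hdd : d * d ≤ d * n := by
    have : d^2 ≤ d^4 := Nat.pow_le_pow_right hd (by norm_num)
    nlinarith
  have hH := height_bound hd hb hfd hf hirr S hS hSb (by nlinarith)
  have hH' : ∀ m, |f.coeff m| ≤ (Hbd d b : ℤ) := by
    intro m
    have h1 := hH m
    have : ((|f.coeff m| : ℤ) : ℝ) ≤ ((Hbd d b : ℤ) : ℝ) := by
      refine h1.trans (le_of_eq ?_)
      unfold Hbd; push_cast; rfl
    exact_mod_cast this
  have hH1 : 1 ≤ Hbd d b := Hbd_pos hb
  have hHl := Hbd_log hd hb hu hbu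
  obtain ⟨a, P, hPS, hΔ⟩ := exists_det (n := n) hfd hirr S hS hcon
  have hJ : Fintype.card (Fin d × Fin n) = d * n := by simp
  have hSne : S.Nonempty := Finset.card_pos.1 (by omega)
  obtain ⟨P0, hP0⟩ := hSne
  obtain ⟨G, hG0, hGle, hG⟩ := gram_exists hd hfd hirr (hS P0 hP0) (hS1 P0 hP0) (H := (Hbd d b : ℤ)) (by exact_mod_cast hH1) hH'
  have hGl := G_log hd hH1 hu hHl hG0 hGle
  have hcore := core (Y := Y) hd hfd hf P (fun i => hS _ (hPS i)) (fun i => hS1 _ (hPS i)) (by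
    intro i
    have := L_log hd hb hfd hH1 hH' hu hbu hHl (hSb _ (hPS i)) (hS1 _ (hPS i))
    nlinarith) G hG0 (by nlinarith) hG hYd (by rw [hJ]; exact hYs) _ hΔ
  rw [hJ] at hcore
  have hup := det_log hb hΔ hu hbu (sum_deg d n) (det_upper hb a P (fun i => hSb _ (hPS i))) (by
    have : (d:ℝ)^2 ≤ d^4 := pow_le_pow_right₀ hd' (by norm_num)
    have : (d:ℝ)^2 * u ≤ d^4 * u := mul_le_mul_of_nonneg_right this hu
    nlinarith)
  have hs0 : (0:ℝ) < (d*n:ℕ) := by linarith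
  have h1 := le_of_mul_le_mul_left (hcore.trans hup) (by positivity)
  have h2 := Real.log_le_log (by positivity) hn
  rw [Real.log_mul (by positivity) (by positivity), Real.log_exp] at h2
  linarith

theorem final_arith {d u Y n e : ℝ} (hd : 1 ≤ d) (hu : 0 ≤ u) (he : 1 ≤ e) {E : ℝ} (hE : 1 ≤ E)
    (hY : Y ≤ 1000 * d^4 * (1+u) + 1) (hn : d * n ≤ Y * (e * E) + d) :
    d * (d + n) + d * d ≤ 1004 * E * (d^4 * (1+u) * e) := by
  have h1 : 1 ≤ d^4 * (1+u) := one_le_mul_of_one_le_of_one_le (one_le_pow₀ hd) (by linarith)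
  have h2 : 1 ≤ e * E := one_le_mul_of_one_le_of_one_le he hE
  have h3 : d^2 ≤ d^4 * (1+u) := by
    calc d^2 ≤ d^4 := pow_le_pow_right₀ hd (by norm_num)
      _ ≤ d^4 * (1+u) := le_mul_of_one_le_right (by positivity) (by linarith)
  set W := d^4 * (1+u)
  have h4 : Y * (e*E) ≤ (1001 * W) * (e*E) := mul_le_mul_of_nonneg_right (by linarith) (by linarith)
  have h5 : W ≤ W * (e * E) := le_mul_of_one_le_right (by linarith) h2
  nlinarith

/-- **Affine plane curves (improved Bombieri–Pila).** There is an absolute constant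
`c > 0` such that for every primitive polynomial `f ∈ ℤ[x_1,x_2]` of degree `d ≥ 1`
irreducible over `ℚ` and every `B ≥ 1`, one has
`N_aff(f,B) ≤ c · d^3 · B^(1/d) · (log B + d)`. -/
theorem affine_plane_curves_bound :
    ∃ c : ℝ, 0 < c ∧
      ∀ (d : ℕ) (f : MvPolynomial (Fin 2) ℤ) (B : ℝ),
        1 ≤ d → f.totalDegree = d →
        Finset.gcd f.support f.coeff = 1 →
        Irreducible (MvPolynomial.map (Int.castRingHom ℚ) f) →
        1 ≤ B →
        (Naff f B : ℝ) ≤ c * (d : ℝ) ^ 3 * B ^ (1 / (d : ℝ)) * (Real.log B + d) := by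
  classical
  refine ⟨1004 * Real.exp 24, by positivity, ?_⟩
  intro d f B hd hfd hf hirr hB
  have hd' : (1:ℝ) ≤ d := by exact_mod_cast hd
  have hB0 : 0 < B := by linarith
  have hlB : 0 ≤ Real.log B := Real.log_nonneg hB
  obtain ⟨b, hbdef⟩ : ∃ b, b = ⌊B⌋₊ := ⟨_, rfl⟩
  have hb : 1 ≤ b := by rw [hbdef]; exact Nat.one_le_floor_iff _ |>.2 hB
  have hb0 : (0:ℝ) < b := by exact_mod_cast hb
  have hbB : (b:ℝ) ≤ B := by rw [hbdef]; exact Nat.floor_le hB0.le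
  obtain ⟨u, hudef⟩ : ∃ u, u = Real.log B / d := ⟨_, rfl⟩
  have hu : 0 ≤ u := by rw [hudef]; positivity
  have hdu : Real.log B = d * u := by rw [hudef]; field_simp
  have hbu : Real.log b ≤ d * u := by rw [← hdu]; exact Real.log_le_log hb0 hbB
  have hpow : B ^ (1 / (d:ℝ)) = Real.exp u := by
    rw [Real.rpow_def_of_pos hB0, hudef]; congr 1; ring
  have hE : (1:ℝ) ≤ Real.exp 24 := Real.one_le_exp (by norm_num)
  have he : (1:ℝ) ≤ Real.exp u := Real.one_le_exp hu
  have hbox : ∀ x : Fin 2 → ℤ, (∀ i, |(x i : ℝ)| ≤ B) → ∀ i, |x i| ≤ (b:ℤ) := by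
    intro x hx i
    have h1 : (((x i).natAbs : ℕ) : ℝ) ≤ B := by
      have := hx i
      rwa [Nat.cast_natAbs, Int.cast_abs]
    have h2 := Nat.le_floor h1
    rw [← hbdef] at h2
    rw [Int.abs_eq_natAbs]
    exact_mod_cast h2
  have hfin : {x : Fin 2 → ℤ | (∀ i, |(x i : ℝ)| ≤ B) ∧ MvPolynomial.eval x f = 0}.Finite := by
    refine Set.Finite.subset (Set.finite_Icc (fun _ : Fin 2 => -(b:ℤ)) (fun _ => (b:ℤ))) ?_
    intro x hx
    have := hbox x hx.1
    exact ⟨fun i => (abs_le.1 (this i)).1, fun i => (abs_le.1 (this i)).2⟩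
  obtain ⟨S, hSdef⟩ : ∃ S : Finset (Fin 2 → ℤ), S = hfin.toFinset := ⟨_, rfl⟩
  have hN : Naff f B = S.card := by
    unfold Naff
    rw [Set.ncard_eq_toFinset_card _ hfin, hSdef]
  have hmem : ∀ P ∈ S, (∀ i, |P i| ≤ (b:ℤ)) ∧ eval P f = 0 := by
    intro P hP
    rw [hSdef, Set.Finite.mem_toFinset] at hP
    exact ⟨hbox P hP.1, hP.2⟩
  rw [hN, hpow, hdu]
  have htarget : 1004 * Real.exp 24 * (d:ℝ)^3 * Real.exp u * (d * u + d) =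
      1004 * Real.exp 24 * ((d:ℝ)^4 * (1+u) * Real.exp u) := by ring
  rw [htarget]
  by_cases h0 : pderiv 1 f = 0
  · rcases S.eq_empty_or_nonempty with hS | hS
    · rw [hS]; simp; positivity
    · obtain ⟨hd1, hc⟩ := vertical hd hfd hirr h0 S (fun P hP => (hmem P hP).2) (fun P hP => (hmem P hP).1) hS
      have hc' : ((S.card : ℕ):ℝ) ≤ 2 * b + 1 := by exact_mod_cast hc
      have h1 : B = Real.exp u := by
        rw [← hpow, hd1]; simp
      have h2 : ((S.card : ℕ):ℝ) ≤ 3 * Real.exp u := by rw [← h1]; linarith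
      have h3 : (1:ℝ) ≤ (d:ℝ)^4 * (1+u) := one_le_mul_of_one_le_of_one_le (one_le_pow₀ hd') (by linarith)
      have h4 : Real.exp u ≤ (d:ℝ)^4 * (1+u) * Real.exp u := le_mul_of_one_le_left (by positivity) h3
      have h5 : 1004 * 1 * ((d:ℝ)^4 * (1+u) * Real.exp u) ≤ 1004 * Real.exp 24 * ((d:ℝ)^4 * (1+u) * Real.exp u) := by
        gcongr
      linarith
  · obtain ⟨Y, hYdef⟩ : ∃ Y, Y = ⌈1000 * (d:ℝ)^4 * (1+u)⌉₊ := ⟨_, rfl⟩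
    have hY1 : 1000 * (d:ℝ)^4 * (1+u) ≤ Y := by rw [hYdef]; exact Nat.le_ceil _
    have hY2 : (Y:ℝ) ≤ 1000 * (d:ℝ)^4 * (1+u) + 1 := by
      rw [hYdef]; exact (Nat.ceil_lt_add_one (by positivity)).le
    obtain ⟨n, hndef⟩ : ∃ n, n = ⌈(Y:ℝ) * Real.exp (u+24) / d⌉₊ := ⟨_, rfl⟩
    have hn1 : (Y:ℝ) * Real.exp (u+24) / d ≤ n := by rw [hndef]; exact Nat.le_ceil _
    have hn2 : (n:ℝ) ≤ (Y:ℝ) * Real.exp (u+24) / d + 1 := by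
      rw [hndef]; exact (Nat.ceil_lt_add_one (by positivity)).le
    have hd0 : (0:ℝ) < d := by linarith
    have hc1 := smooth_count (n := n) (Y := Y) hd hb hfd hf hirr hu hbu hY1 (by
      rw [div_le_iff₀ hd0] at hn1
      push_cast
      linarith) (S.filter fun P => eval P (pderiv 1 f) ≠ 0)
      (fun P hP => (hmem P (Finset.mem_filter.1 hP).1).2) (fun P hP => (hmem P (Finset.mem_filter.1 hP).1).1)
      (fun P hP => (Finset.mem_filter.1 hP).2)
    have hc2 := singular_count hd hfd hirr h0 (S.filter fun P => ¬ eval P (pderiv 1 f) ≠ 0)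
      (fun P hP => (hmem P (Finset.mem_filter.1 hP).1).2) (fun P hP => not_not.1 (Finset.mem_filter.1 hP).2)
    have hc3 : S.card ≤ d * (d + n) + d * d := by
      rw [← Finset.card_filter_add_card_filter_not (s := S) (fun P => eval P (pderiv 1 f) ≠ 0)]
      omega
    have hc4 : ((S.card : ℕ):ℝ) ≤ d * (d + n) + d * d := by exact_mod_cast hc3
    refine hc4.trans ?_
    refine final_arith hd' hu he hE hY2 ?_
    rw [← Real.exp_add]
    have := mul_le_mul_of_nonneg_left hn2 hd0.le
    have h9 : (d:ℝ) * ((Y:ℝ) * Real.exp (u+24) / d + 1) = Y * Real.exp (u+24) + d := by field_simp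
    linarith
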